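/- Let D be a countable rooted digraph and F a vertex-flame in D. Then there exists a spanning subdigraph F* of D with F ⊆ F* such that F* is a vertex-flame and F* is D-large. -/

import Mathlib

/-!  Common framework: digraphs as edge sets on a vertex type, directed paths,
path-systems, separations, flames and largeness. -/

universe u

variable {V : Type u}

/-- A directed path in the digraph on `V` with edge set `E`, given by its
(nonempty, repetition-free) list of vertices `start :: rest`. -/
structure Dipath (E : Set (V × V)) : Type u where
  start : V
  rest : List V
  chain : List.Chain (fun a b => (a, b) ∈ E) start rest
  nodup : (start :: rest).Nodup

namespace Dipath

variable {E : Set (V × V)}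

/-- The list of vertices of the path. -/
def verts (p : Dipath E) : List V := p.start :: p.rest

/-- The terminal vertex of the path. -/
def last (p : Dipath E) : V := (p.start :: p.rest).getLast (List.cons_ne_nil _ _)

/-- The set of vertices of the path. -/
def support (p : Dipath E) : Set V := {v | v ∈ p.verts}

/-- The internal vertices of the path (all vertices except the first and the last). -/
def internal (p : Dipath E) : Set V := {v | v ∈ p.rest.dropLast}

/-- The list of (directed) edges of the path. -/
def edges (p : Dipath E) : List (V × V) := p.verts.zip p.rest

/-- The set of edges of the path. -/
def edgeSet (p : Dipath E) : Set (V × V) := {e | e ∈ p.edges}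

/-- The last edge of the path, if the path has at least one edge. -/
def lastEdge? (p : Dipath E) : Option (V × V) := p.edges.getLast?

end Dipath

section Defs

variable (E : Set (V × V))

/-- The set of ingoing edges of `v`. -/
def inEdges (v : V) : Set (V × V) := {e ∈ E | e.2 = v}

/-- The set of initial vertices of a set of paths. -/
def initVerts {E : Set (V × V)} (P : Set (Dipath E)) : Set V := Dipath.start '' P

/-- The set of terminal vertices of a set of paths. -/
def termVerts {E : Set (V × V)} (P : Set (Dipath E)) : Set V := Dipath.last '' P

/-- The set of terminal edges of a set of paths. -/
def termEdges {E : Set (V × V)} (P : Set (Dipath E)) : Set (V × V) :=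
  {e | ∃ p ∈ P, p.lastEdge? = some e}

/-- An `(r,v)`-path-system: a set of pairwise internally disjoint directed
paths from `r` to `v`. -/
def IsRVSystem (r v : V) (P : Set (Dipath E)) : Prop :=
  (∀ p ∈ P, p.start = r ∧ p.last = v) ∧
    P.Pairwise fun p q => p.support ∩ q.support ⊆ {r, v}

/-- An `(r,v)`-separation: a set of vertices avoiding `r` and `v` and meeting
every directed path from `r` to `v`. -/
def IsSeparation (r v : V) (S : Set V) : Prop :=
  r ∉ S ∧ v ∉ S ∧ ∀ p : Dipath E, p.start = r → p.last = v → (p.support ∩ S).Nonempty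

/-- A set of paths `P` and a vertex set `S` are orthogonal:  every path of `P`
meets `S` in exactly one vertex and every vertex of `S` lies on a path of `P`. -/
def Orthogonal {E : Set (V × V)} (P : Set (Dipath E)) (S : Set V) : Prop :=
  (∀ p ∈ P, ∃! x, x ∈ p.support ∩ S) ∧ ∀ x ∈ S, ∃ p ∈ P, x ∈ p.support

/-- An Erdős–Menger `(r,v)`-path-system: one orthogonal to some `(r,v)`-separation. -/
def IsEMSystem (r v : V) (P : Set (Dipath E)) : Prop :=
  IsRVSystem E r v P ∧ ∃ S, IsSeparation E r v S ∧ Orthogonal P S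

/-- An Erdős–Menger `(r,v)`-separation: one orthogonal to some `(r,v)`-path-system. -/
def IsEMSeparation (r v : V) (S : Set V) : Prop :=
  IsSeparation E r v S ∧ ∃ P : Set (Dipath E), IsRVSystem E r v P ∧ Orthogonal P S

/-- `𝒢_E(v)` (with root `r`): the collection of edge sets `I` that arise as the set of
terminal edges of an internally disjoint `(r,v)`-path-system in `E`. -/
def GSet (r v : V) : Set (Set (V × V)) :=
  {I | ∃ P : Set (Dipath E), IsRVSystem E r v P ∧ termEdges P = I}

/-- A vertex-flame (with root `r`): for every `v ≠ r`, the whole in-edge set of `v`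
is the terminal edge set of an internally disjoint `(r,v)`-path-system. -/
def IsFlame (r : V) : Prop := ∀ v, v ≠ r → inEdges E v ∈ GSet E r v

/-- `L` is `v`-large with respect to the digraph `E` rooted at `r`: `L` contains `rv`
whenever `E` does, and some Erdős–Menger `(r,v)`-path-system of `E - rv` lies in `L`. -/
def VLarge (r : V) (L : Set (V × V)) (v : V) : Prop :=
  ((r, v) ∈ E → (r, v) ∈ L) ∧
    ∃ P : Set (Dipath (E \ {(r, v)})),
      IsEMSystem (E \ {(r, v)}) r v P ∧ ∀ p ∈ P, p.edgeSet ⊆ L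

/-- `L` is large with respect to the digraph `E` rooted at `r`. -/
def Large (r : V) (L : Set (V × V)) : Prop := ∀ v, v ≠ r → VLarge E r L v

/-- An `(X,Y)`-path: from `X` to `Y`, internally disjoint from `X ∪ Y`. -/
def IsXYPath (X Y : Set V) (p : Dipath E) : Prop :=
  p.start ∈ X ∧ p.last ∈ Y ∧ ∀ w ∈ p.internal, w ∉ X ∪ Y

/-- An `(X,Y)`-path-system: pairwise disjoint `(X,Y)`-paths. -/
def IsXYSystem (X Y : Set V) (P : Set (Dipath E)) : Prop :=
  (∀ p ∈ P, IsXYPath E X Y p) ∧ P.Pairwise fun p q => Disjoint p.support q.support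

/-- `X` is joinable to `Y`: some `(X,Y)`-path-system covers `X` with its initial vertices. -/
def Joinable (X Y : Set V) : Prop :=
  ∃ P : Set (Dipath E), IsXYSystem E X Y P ∧ initVerts P = X

/-- `X` is incompressible to `Y`: `X` is joinable to `Y` and every witnessing
path-system covers `Y` with its terminal vertices. -/
def Incompressible (X Y : Set V) : Prop :=
  Joinable E X Y ∧
    ∀ P : Set (Dipath E), IsXYSystem E X Y P → initVerts P = X → termVerts P = Y

/-- An `(X,Y)`-separation: a vertex set meeting every `(X,Y)`-path. -/
def IsXYSeparation (X Y : Set V) (S : Set V) : Prop :=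
  ∀ p : Dipath E, IsXYPath E X Y p → (p.support ∩ S).Nonempty

/-- An Erdős–Menger `(X,Y)`-separation: one orthogonal to some `(X,Y)`-path-system. -/
def IsEMXYSeparation (X Y : Set V) (S : Set V) : Prop :=
  IsXYSeparation E X Y S ∧ ∃ P : Set (Dipath E), IsXYSystem E X Y P ∧ Orthogonal P S

/-- `X'` is `(X,Y)`-finitely extendable: every `O` with `X' ⊆ O ⊆ X` and `O \ X'`
finite is joinable to `Y`. -/
def FinExtendable (X Y X' : Set V) : Prop :=
  X' ⊆ X ∧ ∀ O, X' ⊆ O → O ⊆ X → (O \ X').Finite → Joinable E O Y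

/-- `S` separates the vertex `y` from `r`:  every directed path from `r` to `y` meets `S`. -/
def SeparatesFrom (r : V) (S : Set V) (y : V) : Prop :=
  ∀ p : Dipath E, p.start = r → p.last = y → (p.support ∩ S).Nonempty

/-- An `(X,y)`-path: from a vertex of `X` to `y`, internally disjoint from `X`. -/
def IsXyPath (X : Set V) (y : V) (p : Dipath E) : Prop :=
  p.start ∈ X ∧ p.last = y ∧ ∀ w ∈ p.internal, w ∉ X

/-- An `(X,y)`-path-system: `(X,y)`-paths, pairwise disjoint except possibly at `y`. -/
def IsXySystem (X : Set V) (y : V) (P : Set (Dipath E)) : Prop :=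
  (∀ p ∈ P, IsXyPath E X y p) ∧ P.Pairwise fun p q => p.support ∩ q.support ⊆ {y}

/-- An `(r,S)`-path: from `r` to a vertex of `S`, internally disjoint from `S`. -/
def IsRSPath (r : V) (S : Set V) (p : Dipath E) : Prop :=
  p.start = r ∧ p.last ∈ S ∧ ∀ w ∈ p.internal, w ∉ S

/-- An `(r,S)`-path-system: `(r,S)`-paths, pairwise disjoint apart from `r`. -/
def IsRSSystem (r : V) (S : Set V) (P : Set (Dipath E)) : Prop :=
  (∀ p ∈ P, IsRSPath E r S p) ∧ P.Pairwise fun p q => p.support ∩ q.support ⊆ {r}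

/-- `E` is a `G`-quasi-flame (with root `r`): for every `v ≠ r`, every set `I` of
ingoing edges of `v` with `I \ inEdges G v` finite lies in `𝒢_E(v)`. -/
def QuasiFlame (r : V) (G : Set (V × V)) : Prop :=
  ∀ v, v ≠ r → ∀ I, I ⊆ inEdges E v → (I \ inEdges G v).Finite → I ∈ GSet E r v

/-- The local connectivity `κ_E(r,v)`: the maximum size of an internally disjoint
`(r,v)`-path-system. -/
noncomputable def kappa (r v : V) : ℕ :=
  sSup {n | ∃ P : Set (Dipath E), IsRVSystem E r v P ∧ P.Finite ∧ P.ncard = n}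

end Defs

/-! Part 1 -/
namespace FL

open Relation


theorem _root_.Relation.ReflTransGen.mn {M N : V → V → Prop} {a b : V} (h : ReflTransGen M a b)
    (f : ∀ x y, M x y → N x y) : ReflTransGen N a b := by
  induction h with
  | refl => exact .refl
  | tail _ h2 ih => exact ih.tail (f _ _ h2)

/-- Vertices reachable from `A` in `G` by walks avoiding `X`. -/
inductive Rc (G : V → V → Prop) (A X : Set V) : V → Prop
  | base {a : V} : a ∈ A → a ∉ X → Rc G A X a
  | step {x y : V} : Rc G A X x → G x y → y ∉ X → Rc G A X y

theorem Rc.notMem {G : V → V → Prop} {A X : Set V} {z : V} (h : Rc G A X z) : z ∉ X := by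
  cases h <;> assumption

/-- General monotonicity of reachability. -/
theorem Rc.mono' {G G' : V → V → Prop} {A A' X X' : Set V} (hA : A ⊆ A')
    (hG : ∀ x y, Rc G A X x → G x y → G' x y)
    (hX : ∀ z, Rc G A X z → z ∉ X') {z : V} (h : Rc G A X z) : Rc G' A' X' z := by
  induction h with
  | base ha hx => exact .base (hA ha) (hX _ (.base ha hx))
  | step h1 h2 h3 ih => exact .step ih (hG _ _ h1 h2) (hX _ (.step h1 h2 h3))

theorem Rc.anti {G : V → V → Prop} {A X X' : Set V}
    (hX : ∀ z, Rc G A X z → z ∉ X') {z : V} (h : Rc G A X z) : Rc G A X' z :=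
  h.mono' subset_rfl (fun _ _ _ h => h) hX

theorem Rc.next {G : V → V → Prop} {A X : Set V} {x y : V} (h : Rc G A X x) (g : G x y) :
    Rc G A X y ∨ y ∈ X := by
  by_cases hy : y ∈ X
  · exact .inr hy
  · exact .inl (.step h g hy)

theorem Rc.start {G : V → V → Prop} {A X : Set V} {x : V} (h : x ∈ A) :
    Rc G A X x ∨ x ∈ X := by
  by_cases hy : x ∈ X
  · exact .inr hy
  · exact .inl (.base h hy)

/-- `M` is a system of disjoint finite paths in `G` starting in `A` and ending exactly in the
points of `Y` (there may be superfluous edges). -/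
structure Lk (G : V → V → Prop) (A Y : Set V) (M : V → V → Prop) : Prop where
  sub : ∀ {x y}, M x y → G x y
  inA : ∀ {x y}, M x y → y ∉ A
  inj : ∀ {x y z}, M x z → M y z → x = y
  fn : ∀ {x y z}, M x y → M x z → y = z
  tgt : ∀ {y}, y ∈ Y → ∃ a ∈ A, ReflTransGen M a y
  noOut : ∀ {y z}, y ∈ Y → ¬ M y z

/-- `z` lies on one of the paths of `M` from `A` to `Y`. -/
def On (A Y : Set V) (M : V → V → Prop) (z : V) : Prop :=
  (∃ a ∈ A, ReflTransGen M a z) ∧ ∃ y ∈ Y, ReflTransGen M z y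

/-- The initial vertices used. -/
def ini (A Y : Set V) (M : V → V → Prop) : Set V := {a | a ∈ A ∧ ∃ y ∈ Y, ReflTransGen M a y}

namespace Lk

variable {G : V → V → Prop} {A Y : Set V} {M : V → V → Prop}

theorem subM (h : Lk G A Y M) {Y' : Set V} {M' : V → V → Prop} (hM : ∀ x y, M' x y → M x y)
    (ht : ∀ y ∈ Y', ∃ a ∈ A, ReflTransGen M' a y) (hs : ∀ y ∈ Y', ∀ z, ¬ M' y z) :
    Lk G A Y' M' where
  sub h' := h.sub (hM _ _ h')
  inA h' := h.inA (hM _ _ h')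
  inj h1 h2 := h.inj (hM _ _ h1) (hM _ _ h2)
  fn h1 h2 := h.fn (hM _ _ h1) (hM _ _ h2)
  tgt hy := ht _ hy
  noOut hy := hs _ hy _

theorem subset (h : Lk G A Y M) {Y' : Set V} (hY : Y' ⊆ Y) : Lk G A Y' M :=
  h.subM (fun _ _ h => h) (fun _ hy => h.tgt (hY hy)) (fun _ hy _ => h.noOut (hY hy))

theorem monoG (h : Lk G A Y M) {G' : V → V → Prop} (hG : ∀ x y, M x y → G x y → G' x y) :
    Lk G' A Y M := ⟨fun h' => hG _ _ h' (h.sub h'), h.inA, h.inj, h.fn, h.tgt, h.noOut⟩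

theorem ftotal (h : Lk G A Y M) {x y z : V} (h1 : ReflTransGen M x y) (h2 : ReflTransGen M x z) :
    ReflTransGen M y z ∨ ReflTransGen M z y :=
  ReflTransGen.total_of_right_unique (fun _ _ _ a b => h.fn a b) h1 h2

theorem btotal (h : Lk G A Y M) {x y z : V} (h1 : ReflTransGen M x z) (h2 : ReflTransGen M y z) :
    ReflTransGen M x y ∨ ReflTransGen M y x := by
  have := ReflTransGen.total_of_right_unique (r := Function.swap M) (fun _ _ _ a b => h.inj a b)
    (reflTransGen_swap.2 h1) (reflTransGen_swap.2 h2)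
  rcases this with t | t
  · exact .inr (reflTransGen_swap.1 t)
  · exact .inl (reflTransGen_swap.1 t)

theorem eq_of_src (h : Lk G A Y M) {x a : V} (ha : a ∈ A) (h1 : ReflTransGen M x a) : x = a := by
  rcases h1.cases_tail with h1 | ⟨w, _, h2⟩
  · exact h1.symm
  · exact absurd ha (h.inA h2)

theorem eq_of_tgt (h : Lk G A Y M) {x y : V} (hy : y ∈ Y) (h1 : ReflTransGen M y x) : x = y := by
  rcases h1.cases_head with h1 | ⟨w, h2, _⟩
  · exact h1.symm
  · exact absurd h2 (h.noOut hy)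

theorem tgt_unique (h : Lk G A Y M) {x y y' : V} (hy : y ∈ Y) (hy' : y' ∈ Y)
    (h1 : ReflTransGen M x y) (h2 : ReflTransGen M x y') : y = y' := by
  rcases h.ftotal h1 h2 with h3 | h3
  · exact (h.eq_of_tgt hy h3).symm
  · exact h.eq_of_tgt hy' h3

theorem src_unique (h : Lk G A Y M) {x a a' : V} (hy : a ∈ A) (hy' : a' ∈ A)
    (h1 : ReflTransGen M a x) (h2 : ReflTransGen M a' x) : a = a' := by
  rcases h.btotal h1 h2 with h3 | h3
  · exact h.eq_of_src hy' h3
  · exact (h.eq_of_src hy h3).symm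

theorem acyc (h : Lk G A Y M) {a z : V} (ha : a ∈ A) (h1 : ReflTransGen M a z) :
    ¬ TransGen M z z := by
  induction h1 with
  | refl =>
    intro h2
    obtain ⟨w, _, h3⟩ := TransGen.tail'_iff.1 h2
    exact h.inA h3 ha
  | tail _ h2 ih =>
    intro h3
    obtain ⟨w, h4, h5⟩ := TransGen.tail'_iff.1 h3
    obtain rfl := h.inj h2 h5
    exact ih (TransGen.head'_iff.2 ⟨_, h2, h4⟩)

theorem on_tgt (h : Lk G A Y M) {y : V} (hy : y ∈ Y) : On A Y M y := ⟨h.tgt hy, y, hy, .refl⟩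

theorem on_pred (h : Lk G A Y M) {w x : V} (hx : On A Y M x) (hM : M w x) : On A Y M w := by
  obtain ⟨⟨a, ha, h1⟩, y, hy, h2⟩ := hx
  refine ⟨⟨a, ha, ?_⟩, y, hy, .head hM h2⟩
  rcases h1.cases_tail with h1 | ⟨w', h3, h4⟩
  · subst h1; exact absurd ha (h.inA hM)
  · rwa [h.inj hM h4]

theorem on_succ (h : Lk G A Y M) {w x : V} (hw : On A Y M w) (hM : M w x) : On A Y M x := by
  obtain ⟨⟨a, ha, h1⟩, y, hy, h2⟩ := hw
  refine ⟨⟨a, ha, h1.tail hM⟩, y, hy, ?_⟩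
  rcases h2.cases_head with h1 | ⟨w', h3, h4⟩
  · subst h1; exact absurd hM (h.noOut hy)
  · rwa [h.fn hM h3]

theorem on_path (h : Lk G A Y M) {w x : V} (hw : On A Y M w) (hM : ReflTransGen M w x) :
    On A Y M x := by
  induction hM with
  | refl => exact hw
  | tail _ h2 ih => exact h.on_succ ih h2

/-- Prune to the edges on the paths. -/
theorem prune (h : Lk G A Y M) : Lk G A Y (fun x y => M x y ∧ On A Y M x) := by
  refine h.subM (fun _ _ h => h.1) ?_ (fun y hy z h' => h.noOut hy h'.1)
  intro y hy
  obtain ⟨a, ha, h1⟩ := h.tgt hy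
  refine ⟨a, ha, ?_⟩
  have key : ∀ z, ReflTransGen M z y → (∃ a ∈ A, ReflTransGen M a z) →
      ReflTransGen (fun x y => M x y ∧ On A Y M x) z y := by
    intro z hz
    induction hz using ReflTransGen.head_induction_on with
    | refl => intro _; exact .refl
    | head h2 h3 ih =>
      rintro ⟨a, ha, h4⟩
      exact .head ⟨h2, ⟨a, ha, h4⟩, y, hy, .head h2 h3⟩ (ih ⟨a, ha, h4.tail h2⟩)
  exact key a h1 ⟨a, ha, .refl⟩

/-- Walking a path before the first point of `Y`. -/
theorem rc_path (h : Lk G A Y M) {X : Set V} {a z : V} (ha : a ∈ A) (h1 : ReflTransGen M a z)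
    (hX : ∀ w, ReflTransGen M a w → ReflTransGen M w z → w ∉ X) : Rc G A X z := by
  induction h1 with
  | refl => exact .base ha (hX _ .refl .refl)
  | tail h2 h3 ih =>
    exact .step (ih fun w h4 h5 => hX w h4 (h5.tail h3)) (h.sub h3) (hX _ (h2.tail h3) .refl)

theorem rc_succ (h : Lk G A Y M) {U : Set V} (hU : U ⊆ Y) {a z w : V} (ha : a ∈ A)
    (h1 : ReflTransGen M a z) (h2 : M z w) : Rc G A U z := by
  refine h.rc_path ha h1 fun x _ h4 hx => ?_
  rcases h4.cases_head with h5 | ⟨w', h5, _⟩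
  · subst h5; exact h.noOut (hU hx) h2
  · exact h.noOut (hU hx) h5

/-- The paths from `A` to `Y` stay in the closed side of `U`, for `U ⊆ Y`. -/
theorem pruneRc' (h : Lk G A Y M) {U : Set V} (hU : U ⊆ Y) :
    Lk G A Y (fun x y => M x y ∧ Rc G A U x) := by
  refine h.subM (fun _ _ h => h.1) ?_ (fun y hy z h' => h.noOut hy h'.1)
  intro y hy
  obtain ⟨a, ha, h1⟩ := h.tgt hy
  refine ⟨a, ha, ?_⟩
  have key : ∀ z, ReflTransGen M z y → (∃ a ∈ A, ReflTransGen M a z) →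
      ReflTransGen (fun x y => M x y ∧ Rc G A U x) z y := by
    intro z hz
    induction hz using ReflTransGen.head_induction_on with
    | refl => intro _; exact .refl
    | head h2 h3 ih =>
      rintro ⟨a, ha, h4⟩
      exact .head ⟨h2, h.rc_succ hU ha h4 h2⟩ (ih ⟨a, ha, h4.tail h2⟩)
  exact key a h1 ⟨a, ha, .refl⟩

theorem pruneRc (h : Lk G A Y M) : Lk G A Y (fun x y => M x y ∧ Rc G A Y x) :=
  h.pruneRc' subset_rfl

end Lk

/-- The part of `G` outside `R`. -/
def Gb (G : V → V → Prop) (R : V → Prop) (x y : V) : Prop := G x y ∧ ¬ R x ∧ ¬ R y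

theorem Lk.compose {G : V → V → Prop} {A U W Z : Set V} {M N : V → V → Prop} {R : V → Prop}
    (hM : Lk G A (U ∪ W) M) (hN : Lk (Gb G R) U Z N)
    (hA : ∀ a ∈ A, R a ∨ a ∈ U) (hMR : ∀ x y, M x y → R x ∧ (R y ∨ y ∈ U))
    (hW : ∀ w ∈ W, R w) : Lk G A (Z ∪ W) (fun x y => M x y ∨ N x y) where
  sub h := h.elim hM.sub fun h => (hN.sub h).1
  inA := by
    rintro x y (h | h) ha
    · exact hM.inA h ha
    · exact (hA _ ha).elim (hN.sub h).2.2 (hN.inA h)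
  inj := by
    rintro x y z (h | h) (h' | h')
    · exact hM.inj h h'
    · exact ((hMR _ _ h).2.elim (hN.sub h').2.2 (hN.inA h')).elim
    · exact ((hMR _ _ h').2.elim (hN.sub h).2.2 (hN.inA h)).elim
    · exact hN.inj h h'
  fn := by
    rintro x y z (h | h) (h' | h')
    · exact hM.fn h h'
    · exact ((hN.sub h').2.1 (hMR _ _ h).1).elim
    · exact ((hN.sub h).2.1 (hMR _ _ h').1).elim
    · exact hN.fn h h'
  tgt := by
    rintro y (hy | hy)
    · obtain ⟨t, ht, h1⟩ := hN.tgt hy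
      obtain ⟨a, ha, h2⟩ := hM.tgt (.inl ht)
      exact ⟨a, ha, (h2.mn fun _ _ h => .inl h).trans (h1.mn fun _ _ h => .inr h)⟩
    · obtain ⟨a, ha, h2⟩ := hM.tgt (.inr hy)
      exact ⟨a, ha, h2.mn fun _ _ h => .inl h⟩
  noOut := by
    rintro y z (hy | hy) (h | h)
    · obtain ⟨t, ht, h1⟩ := hN.tgt hy
      rcases h1.cases_tail with rfl | ⟨w, _, h2⟩
      · exact hM.noOut (.inl ht) h
      · exact (hN.sub h2).2.2 (hMR _ _ h).1
    · exact hN.noOut hy h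
    · exact hM.noOut (.inr hy) h
    · exact (hN.sub h).2.1 (hW _ hy)

/-- Composition at `U` along the canonical reach set. -/
theorem Lk.comp {G : V → V → Prop} {A U W Z : Set V} {M N : V → V → Prop}
    (hM : Lk G A (U ∪ W) M) (hN : Lk (Gb G (Rc G A U)) U Z N)
    (hW : ∀ w ∈ W, Rc G A U w) :
    Lk G A (Z ∪ W) (fun x y => (M x y ∧ Rc G A U x) ∨ N x y) :=
  (hM.pruneRc' Set.subset_union_left).compose hN (fun _ ha => Rc.start ha)
    (fun _ _ h => ⟨h.2, h.2.next (hM.sub h.1)⟩) hW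

theorem Lk.comp' {G : V → V → Prop} {A U Z : Set V} {M N : V → V → Prop}
    (hM : Lk G A U M) (hN : Lk (Gb G (Rc G A U)) U Z N) :
    Lk G A Z (fun x y => (M x y ∧ Rc G A U x) ∨ N x y) := by
  have := Lk.comp (W := ∅) (by simpa using hM) hN (by simp)
  simpa using this

/-- Cutting a linkage at the last crossing of a separator. -/
theorem Lk.cut {G : V → V → Prop} {A T Y : Set V} {M : V → V → Prop} {R : V → Prop}
    (hM : Lk G A Y M) (hA : ∀ a ∈ A, R a ∨ a ∈ T) (hR : ∀ x y, R x → M x y → R y ∨ y ∈ T)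
    (hY : ∀ y ∈ Y, ¬ R y) :
    Lk (Gb G R) T Y (fun x y => M x y ∧ ¬ R x ∧ ¬ R y ∧ y ∉ T) where
  sub h := ⟨hM.sub h.1, h.2.1, h.2.2.1⟩
  inA h := h.2.2.2
  inj h h' := hM.inj h.1 h'.1
  fn h h' := hM.fn h.1 h'.1
  tgt := by
    intro y hy
    obtain ⟨a, ha, h1⟩ := hM.tgt hy
    have key : ∀ z, ReflTransGen M a z → ¬ R z →
        ∃ t ∈ T, ReflTransGen (fun x y => M x y ∧ ¬ R x ∧ ¬ R y ∧ y ∉ T) t z := by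
      intro z hz
      induction hz with
      | refl => intro h; exact ⟨a, (hA a ha).resolve_left h, .refl⟩
      | @tail w z _ h3 ih =>
        intro h
        by_cases hzT : z ∈ T
        · exact ⟨z, hzT, .refl⟩
        · by_cases hw : R w
          · exact ((hR _ _ hw h3).elim h hzT).elim
          · obtain ⟨t, ht, h4⟩ := ih hw
            exact ⟨t, ht, h4.tail ⟨h3, hw, h, hzT⟩⟩
    exact key y h1 (hY y hy)
  noOut hy h := hM.noOut hy h.1

theorem Lk.cut' {G : V → V → Prop} {A T Y : Set V} {M : V → V → Prop}
    (hM : Lk G A Y M) (hY : ∀ y ∈ Y, ¬ Rc G A T y) :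
    Lk (Gb G (Rc G A T)) T Y (fun x y => M x y ∧ ¬ Rc G A T x ∧ ¬ Rc G A T y ∧ y ∉ T) :=
  hM.cut (fun _ ha => Rc.start ha) (fun _ _ h h' => h.next (hM.sub h')) hY

end FL

/-! Part 2 -/
namespace FL
open Relation

/-- Pym's linkage theorem. -/
theorem pym {G : V → V → Prop} {A Y1 Y2 : Set V} {M1 M2 : V → V → Prop}
    (h1 : Lk G A Y1 M1) (h2 : Lk G A Y2 M2) :
    ∃ Y M, Lk G A Y M ∧ Y2 ⊆ Y ∧ Y ⊆ Y1 ∪ Y2 ∧ (∀ a ∈ ini A Y1 M1, ∃ y ∈ Y, ReflTransGen M a y) ∧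
      ∀ x y, M x y → M1 x y ∨ M2 x y := by
  classical
  let Psi : Set V → Set V := fun I => {w | On A Y2 M2 w ∧ ∀ z, TransGen M2 w z → z ∉ I}
  let Phi : Set V → Set V := fun T => {w | On A Y1 M1 w ∧ ∀ z, TransGen M1 z w → z ∉ T}
  have hmono : Monotone (fun I => Phi (Psi I)) := by
    intro I J hIJ w hw
    exact ⟨hw.1, fun z hz hzT => hw.2 z hz ⟨hzT.1, fun z' hz' hz'' => hzT.2 z' hz' (hIJ hz'')⟩⟩
  let f : Set V →o Set V := ⟨fun I => Phi (Psi I), hmono⟩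
  obtain ⟨I, hI⟩ : ∃ I, Phi (Psi I) = I := ⟨f.lfp, f.map_lfp⟩
  obtain ⟨T, hT⟩ : ∃ T, T = Psi I := ⟨_, rfl⟩
  rw [← hT] at hI
  have memI : ∀ w, w ∈ I ↔ On A Y1 M1 w ∧ ∀ z, TransGen M1 z w → z ∉ T := by
    intro w; conv_lhs => rw [← hI]
    rfl
  have memT : ∀ w, w ∈ T ↔ On A Y2 M2 w ∧ ∀ z, TransGen M2 w z → z ∉ I := by
    intro w; rw [hT]; rfl
  have Ipred : ∀ x y, M1 x y → y ∈ I → x ∈ I ∧ x ∉ T := by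
    intro x y hxy hy
    rw [memI] at hy
    refine ⟨(memI x).2 ⟨h1.on_pred hy.1 hxy, fun z hz => hy.2 z (hz.tail hxy)⟩, hy.2 x (.single hxy)⟩
  have Tsucc : ∀ x y, M2 x y → x ∈ T → y ∈ T ∧ y ∉ I := by
    intro x y hxy hy
    rw [memT] at hy
    refine ⟨(memT y).2 ⟨h2.on_succ hy.1 hxy, fun z hz => hy.2 z (hz.head hxy)⟩, hy.2 y (.single hxy)⟩
  let M : V → V → Prop := fun x y => (M1 x y ∧ y ∈ I) ∨ (M2 x y ∧ x ∈ T)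
  have reachI : ∀ w, w ∈ I → ∃ a ∈ A, ReflTransGen M a w := by
    intro w hw
    obtain ⟨⟨a, ha, h3⟩, -⟩ := ((memI w).1 hw).1
    refine ⟨a, ha, ?_⟩
    induction h3 with
    | refl => exact .refl
    | tail _ h4 ih => exact (ih (Ipred _ _ h4 hw).1).tail (.inl ⟨h4, hw⟩)
  have Y2T : ∀ y ∈ Y2, y ∈ T := by
    intro y hy
    refine (memT y).2 ⟨h2.on_tgt hy, fun z hz => ?_⟩
    obtain ⟨w, h3, _⟩ := TransGen.head'_iff.1 hz
    exact (h2.noOut hy h3).elim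
  have toY2 : ∀ w, w ∈ T → ∃ y ∈ Y2, ReflTransGen M w y := by
    intro w hw
    obtain ⟨-, y, hy, h3⟩ := ((memT w).1 hw).1
    refine ⟨y, hy, ?_⟩
    induction h3 using ReflTransGen.head_induction_on with
    | refl => exact .refl
    | head h4 _ ih => exact .head (.inr ⟨h4, hw⟩) (ih (Tsucc _ _ h4 hw).1)
  refine ⟨Y2 ∪ {y | y ∈ Y1 ∧ y ∈ I ∧ y ∉ T}, M, ⟨?_, ?_, ?_, ?_, ?_, ?_⟩, Set.subset_union_left, ?_, ?_, ?_⟩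
  · rintro x y (h | h)
    exacts [h1.sub h.1, h2.sub h.1]
  · rintro x y (h | h)
    exacts [h1.inA h.1, h2.inA h.1]
  · rintro x y z (h | h) (h' | h')
    · exact h1.inj h.1 h'.1
    · exact ((Tsucc _ _ h'.1 h'.2).2 h.2).elim
    · exact ((Tsucc _ _ h.1 h.2).2 h'.2).elim
    · exact h2.inj h.1 h'.1
  · rintro x y z (h | h) (h' | h')
    · exact h1.fn h.1 h'.1
    · exact ((Ipred _ _ h.1 h.2).2 h'.2).elim
    · exact ((Ipred _ _ h'.1 h'.2).2 h.2).elim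
    · exact h2.fn h.1 h'.1
  · rintro y (hy | hy)
    · obtain ⟨a, ha, h3⟩ := h2.tgt hy
      have key : ∀ w, ReflTransGen M2 a w → w ∈ T → ∃ a ∈ A, ReflTransGen M a w := by
        intro w hw
        induction hw with
        | refl => intro _; exact ⟨a, ha, .refl⟩
        | @tail w z h4 h5 ih =>
          intro hz
          by_cases hzI : z ∈ I
          · exact reachI z hzI
          · have hwT : w ∈ T := by
              refine (memT w).2 ⟨h2.on_pred ((memT z).1 hz).1 h5, fun v hv => ?_⟩
              obtain ⟨z', h6, h7⟩ := TransGen.head'_iff.1 hv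
              obtain rfl := h2.fn h5 h6
              rcases h7.cases_head with rfl | ⟨c, h8, h9⟩
              · exact hzI
              · exact ((memT z).1 hz).2 _ (TransGen.head'_iff.2 ⟨c, h8, h9⟩)
            obtain ⟨a', ha', h8⟩ := ih hwT
            exact ⟨a', ha', h8.tail (.inr ⟨h5, hwT⟩)⟩
      exact key y h3 (Y2T y hy)
    · exact reachI y hy.2.1
  · rintro y z (hy | hy) (h | h)
    · exact (Ipred _ _ h.1 h.2).2 (Y2T y hy)
    · exact h2.noOut hy h.1
    · exact h1.noOut hy.1 h.1
    · exact hy.2.2 h.2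
  · rintro y (hy | hy)
    exacts [.inr hy, .inl hy.1]
  · rintro a ⟨ha, y, hy, h3⟩
    have haI : a ∈ I := by
      refine (memI a).2 ⟨⟨⟨a, ha, .refl⟩, y, hy, h3⟩, fun z hz => ?_⟩
      obtain ⟨w, _, h4⟩ := TransGen.tail'_iff.1 hz
      exact (h1.inA h4 ha).elim
    clear ha
    induction h3 using ReflTransGen.head_induction_on with
    | refl =>
      by_cases hT : y ∈ T
      · obtain ⟨y', hy', h⟩ := toY2 y hT
        exact ⟨y', .inl hy', h⟩
      · exact ⟨y, .inr ⟨hy, haI, hT⟩, .refl⟩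
    | @head w z h4 h5 ih =>
      by_cases hT : w ∈ T
      · obtain ⟨y', hy', h⟩ := toY2 w hT
        exact ⟨y', .inl hy', h⟩
      · have hzI : z ∈ I := by
          refine (memI z).2 ⟨h1.on_succ ((memI w).1 haI).1 h4, fun v hv => ?_⟩
          obtain ⟨z', h6, h7⟩ := TransGen.tail'_iff.1 hv
          obtain rfl := h1.inj h4 h7
          rcases h6.cases_tail with rfl | ⟨c, h8, h9⟩
          · exact hT
          · exact ((memI w).1 haI).2 _ (TransGen.tail'_iff.2 ⟨c, h8, h9⟩)
        obtain ⟨y', hy', h⟩ := ih hzI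
        exact ⟨y', hy', .head (.inl ⟨h4, hzI⟩) h⟩
  · rintro x y (h | h)
    exacts [.inl h.1, .inr h.1]

/-- Closed sets of vertices with respect to a linkage. -/
structure Cl (G : V → V → Prop) (A Y : Set V) (M : V → V → Prop) (O : V → Prop) : Prop where
  c1 : ∀ a ∈ A, ¬ On A Y M a → O a
  c2 : ∀ w x, O w → G w x → ¬ On A Y M x → O x
  c3 : ∀ w x w', O w → G w x → On A Y M x → M w' x → O w'
  c4 : ∀ x w', O x → On A Y M x → M w' x → O w'
  c5 : ∀ y ∈ Y, ¬ O y

/-- The first vertices outside of `O`. -/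
def fst (A Y : Set V) (M : V → V → Prop) (O : V → Prop) : Set V :=
  {u | On A Y M u ∧ ¬ O u ∧ ∀ w, M w u → O w}

namespace Cl
variable {G : V → V → Prop} {A Y : Set V} {M : V → V → Prop} {O : V → Prop}

theorem back (h : Lk G A Y M) (c : Cl G A Y M O) {w x : V} (h1 : ReflTransGen M w x)
    (hx : O x) (ho : On A Y M x) : O w := by
  induction h1 using ReflTransGen.head_induction_on with
  | refl => exact hx
  | @head w z h2 h3 ih =>
    have : On A Y M z := by
      clear ih
      induction h3 using ReflTransGen.head_induction_on generalizing w with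
      | refl => exact ho
      | head h4 _ ih => exact h.on_pred (ih h4) h4
    exact c.c4 _ _ ih this h2

theorem lk (h : Lk G A Y M) (c : Cl G A Y M O) :
    Lk G A (fst A Y M O) (fun x y => M x y ∧ O x) := by
  refine h.subM (fun _ _ h => h.1) ?_ ?_
  · rintro u ⟨hu, hO, hp⟩
    obtain ⟨⟨a, ha, h1⟩, h2⟩ := hu
    refine ⟨a, ha, ?_⟩
    have key : ∀ z, ReflTransGen M a z → O z → On A Y M z →
        ReflTransGen (fun x y => M x y ∧ O x) a z := by
      intro z hz
      induction hz with
      | refl => intros; exact .refl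
      | tail _ h4 ih =>
        intro hz ho
        have := c.c4 _ _ hz ho h4
        exact (ih this (h.on_pred ho h4)).tail ⟨h4, this⟩
    rcases h1.cases_tail with rfl | ⟨w, h3, h4⟩
    · exact .refl
    · exact (key w h3 (hp w h4) (h.on_pred ⟨⟨a, ha, h1⟩, h2⟩ h4)).tail ⟨h4, hp w h4⟩
  · rintro u ⟨hu, hO, hp⟩ z ⟨-, h2⟩
    exact hO h2

theorem rc (h : Lk G A Y M) (c : Cl G A Y M O) {z : V} (hz : Rc G A (fst A Y M O) z) : O z := by
  induction hz with
  | @base a ha hx =>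
    by_contra hO
    by_cases ho : On A Y M a
    · exact hx ⟨ho, hO, fun w hw => (h.inA hw ha).elim⟩
    · exact hO (c.c1 a ha ho)
  | @step w x _ h2 h3 ih =>
    by_contra hO
    by_cases ho : On A Y M x
    · exact h3 ⟨ho, hO, fun w' hw => c.c3 _ _ _ ih h2 ho hw⟩
    · exact hO (c.c2 _ _ ih h2 ho)

theorem reached (h : Lk G A Y M) (c : Cl G A Y M O) {y : V} (hy : On A Y M y) (hO : ¬ O y) :
    ∃ u ∈ fst A Y M O, ReflTransGen M u y := by
  obtain ⟨⟨a, ha, h1⟩, -⟩ := id hy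
  induction h1 with
  | refl => exact ⟨a, ⟨hy, hO, fun w hw => (h.inA hw ha).elim⟩, .refl⟩
  | @tail w z _ h3 ih =>
    by_cases hw : O w
    · exact ⟨z, ⟨hy, hO, fun w' hw' => h.inj h3 hw' ▸ hw⟩, .refl⟩
    · obtain ⟨u, hu, h4⟩ := ih (h.on_pred hy h3) hw
      exact ⟨u, hu, h4.tail h3⟩

theorem anti (h : Lk G A Y M) (c : Cl G A Y M O) {u u' : V} (hu : u ∈ fst A Y M O)
    (hu' : u' ∈ fst A Y M O) : ¬ TransGen M u u' := by
  intro h1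
  obtain ⟨w, h2, h3⟩ := TransGen.tail'_iff.1 h1
  exact hu.2.1 (c.back h h2 (hu'.2.2 w h3) (h.on_pred hu'.1 h3))

end Cl

/-- Augmenting reachability, with depth. -/
inductive Aug (G : V → V → Prop) (A Y : Set V) (M : V → V → Prop) : ℕ → V → Prop
  | base {a} : a ∈ A → ¬ On A Y M a → Aug G A Y M 0 a
  | up {n z} : Aug G A Y M n z → Aug G A Y M (n+1) z
  | new {n w x} : Aug G A Y M n w → G w x → ¬ On A Y M x → Aug G A Y M (n+1) x
  | cut {n w x w'} : Aug G A Y M n w → G w x → M w' x → Aug G A Y M (n+1) w'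
  | back {n x w'} : Aug G A Y M n x → M w' x → Aug G A Y M (n+1) w'

theorem rtg_split {M : V → V → Prop} {w x p q : V} (h : ReflTransGen M p q) :
    ReflTransGen (fun a b => M a b ∧ ¬ (a = w ∧ b = x)) p q ∨
    (ReflTransGen (fun a b => M a b ∧ ¬ (a = w ∧ b = x)) p w ∧
     ReflTransGen (fun a b => M a b ∧ ¬ (a = w ∧ b = x)) x q) := by
  induction h using ReflTransGen.head_induction_on with
  | refl => exact .inl .refl
  | @head p p' h1 _ ih =>
    by_cases he : p = w ∧ p' = x
    · obtain ⟨rfl, rfl⟩ := he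
      exact .inr ⟨.refl, ih.elim id And.right⟩
    · exact ih.imp (.head ⟨h1, he⟩) fun h => ⟨.head ⟨h1, he⟩ h.1, h.2⟩

theorem Aug.mono {G : V → V → Prop} {A Y : Set V} {M : V → V → Prop} {n m : ℕ} {z : V}
    (h : Aug G A Y M n z) (hnm : n ≤ m) : Aug G A Y M m z := by
  induction hnm with
  | refl => exact h
  | step _ ih => exact ih.up

theorem Aug.notMem {G : V → V → Prop} {A Y : Set V} {M : V → V → Prop} (hM : Lk G A Y M)
    {n : ℕ} {z : V} (h : Aug G A Y M n z) : z ∉ Y := by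
  induction h with
  | base _ h => exact fun hy => h (hM.on_tgt hy)
  | up _ ih => exact ih
  | new _ _ h => exact fun hy => h (hM.on_tgt hy)
  | cut _ _ h => exact fun hy => hM.noOut hy h
  | back _ h => exact fun hy => hM.noOut hy h

theorem Aug.cl {G : V → V → Prop} {A Y : Set V} {M : V → V → Prop} (hM : Lk G A Y M) :
    Cl G A Y M (fun z => ∃ n, Aug G A Y M n z) where
  c1 a ha h := ⟨0, .base ha h⟩
  c2 := by rintro w x ⟨n, h⟩ h1 h2; exact ⟨n+1, .new h h1 h2⟩
  c3 := by rintro w x w' ⟨n, h⟩ h1 _ h2; exact ⟨n+1, .cut h h1 h2⟩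
  c4 := by rintro w x ⟨n, h⟩ _ h2; exact ⟨n+1, .back h h2⟩
  c5 := by rintro y hy ⟨n, h⟩; exact h.notMem hM hy

structure AugInv (G : V → V → Prop) (A Y : Set V) (M : V → V → Prop) (n : ℕ) (u : V)
    (M' : V → V → Prop) : Prop where
  lk : Lk G A (insert u Y) M'
  i1 : ∀ z, ¬ On A Y M z → ¬ Aug G A Y M n z → ∀ x, ¬ M' z x ∧ ¬ M' x z
  i2 : ∀ w x, M w x → ¬ Aug G A Y M n w → M' w x
  i3 : ∀ x y, M' x y → (∃ a ∈ A, ReflTransGen M' a x) ∨ ReflTransGen M' y x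

theorem Aug.inv {G : V → V → Prop} {A Y : Set V} {M : V → V → Prop} (hM : Lk G A Y M)
    (hp : ∀ x y, M x y → On A Y M x) (n : ℕ) :
    ∀ u, Aug G A Y M n u → ∃ M', AugInv G A Y M n u M' := by
  induction n with
  | zero =>
    intro u hu
    cases hu with
    | base ha ho =>
    refine ⟨M, ⟨?_, ?_, ?_, ?_⟩⟩
    · refine hM.subM (fun _ _ h => h) ?_ ?_
      · rintro y (rfl | hy)
        · exact ⟨y, ha, .refl⟩
        · exact hM.tgt hy
      · rintro y (rfl | hy) z hz
        · exact ho (hp _ _ hz)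
        · exact hM.noOut hy hz
    · intro z hz _ x
      exact ⟨fun h => hz (hp _ _ h), fun h => hz (hM.on_succ (hp _ _ h) h)⟩
    · intro w x h _; exact h
    · intro x y h; exact .inl (hp _ _ h).1
  | succ n ih =>
    have up : ∀ u, Aug G A Y M n u → ∃ M', AugInv G A Y M (n+1) u M' := by
      intro u hu
      obtain ⟨M', h⟩ := ih u hu
      exact ⟨M', h.lk, fun z h1 h2 => h.i1 z h1 fun h3 => h2 h3.up,
        fun w x h1 h2 => h.i2 w x h1 fun h3 => h2 h3.up, h.i3⟩
    intro u hu
    by_cases hun : Aug G A Y M n u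
    · exact up u hun
    have huY := hu.notMem hM
    cases hu with
    | up h => exact absurd h hun
    | @new _ w _ hw hg ho =>
      obtain ⟨M', h⟩ := ih w hw
      have huA : u ∉ A := fun ha => hun ((Aug.base ha ho).mono (Nat.zero_le _))
      have hi := h.i1 u ho hun
      have hwu : w ≠ u := by rintro rfl; exact hun hw
      have hwY := hw.notMem hM
      refine ⟨fun a b => M' a b ∨ (a = w ∧ b = u), ⟨?_, ?_, ?_, ?_⟩⟩
      · refine ⟨?_, ?_, ?_, ?_, ?_, ?_⟩
        · rintro x y (h1 | ⟨rfl, rfl⟩)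
          exacts [h.lk.sub h1, hg]
        · rintro x y (h1 | ⟨rfl, rfl⟩)
          exacts [h.lk.inA h1, huA]
        · rintro x y z (h1 | ⟨rfl, rfl⟩) (h2 | ⟨rfl, h2⟩)
          · exact h.lk.inj h1 h2
          · subst h2; exact ((hi _).2 h1).elim
          · exact ((hi _).2 h2).elim
          · rfl
        · rintro x y z (h1 | ⟨rfl, rfl⟩) (h2 | ⟨h2, h3⟩)
          · exact h.lk.fn h1 h2
          · subst h2; exact (h.lk.noOut (Set.mem_insert _ _) h1).elim
          · exact (h.lk.noOut (Set.mem_insert _ _) h2).elim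
          · exact h3.symm
        · rintro y (rfl | hy)
          · obtain ⟨a, ha, h1⟩ := h.lk.tgt (Set.mem_insert _ _)
            exact ⟨a, ha, (h1.mn fun _ _ h => .inl h).tail (.inr ⟨rfl, rfl⟩)⟩
          · obtain ⟨a, ha, h1⟩ := h.lk.tgt (Set.mem_insert_of_mem _ hy)
            exact ⟨a, ha, h1.mn fun _ _ h => .inl h⟩
        · rintro y z (rfl | hy) (h1 | ⟨h1, h2⟩)
          · exact (hi _).1 h1
          · exact hwu h1.symm
          · exact h.lk.noOut (Set.mem_insert_of_mem _ hy) h1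
          · exact hwY (h1 ▸ hy)
      · intro z hz hzn x
        have h1 := h.i1 z hz (fun h => hzn h.up) x
        refine ⟨?_, ?_⟩
        · rintro (h2 | ⟨rfl, rfl⟩)
          exacts [h1.1 h2, hzn hw.up]
        · rintro (h2 | ⟨rfl, rfl⟩)
          exacts [h1.2 h2, hzn (.new hw hg ho)]
      · intro a b h1 h2; exact .inl (h.i2 a b h1 fun h => h2 h.up)
      · rintro a b (h1 | ⟨rfl, rfl⟩)
        · refine (h.i3 a b h1).imp ?_ ?_
          · rintro ⟨a, ha, h1⟩; exact ⟨a, ha, h1.mn fun _ _ h => .inl h⟩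
          · exact fun h1 => h1.mn fun _ _ h => .inl h
        · obtain ⟨a', ha, h1⟩ := h.lk.tgt (Set.mem_insert _ _)
          exact .inl ⟨a', ha, h1.mn fun _ _ h => .inl h⟩
    | @back _ x _ hx hm =>
      obtain ⟨M', h⟩ := ih x hx
      have hm' := h.i2 _ _ hm hun
      have hxs : ∀ z, ¬ M' x z := fun z => h.lk.noOut (Set.mem_insert _ _)
      have hxY := hx.notMem hM
      refine ⟨fun a b => M' a b ∧ ¬ (a = u ∧ b = x), ⟨?_, ?_, ?_, ?_⟩⟩
      · refine h.lk.subM (fun _ _ h => h.1) ?_ ?_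
        · rintro y (rfl | hy)
          · obtain ⟨a, ha, h1⟩ := h.lk.tgt (Set.mem_insert _ _)
            rcases h1.cases_tail with rfl | ⟨w, h2, h3⟩
            · exact absurd ha (h.lk.inA hm')
            · obtain rfl := h.lk.inj hm' h3
              refine ⟨a, ha, ?_⟩
              exact (rtg_split (w := y) (x := x) h2).elim id And.left
          · obtain ⟨a, ha, h1⟩ := h.lk.tgt (Set.mem_insert_of_mem _ hy)
            refine ⟨a, ha, ?_⟩
            rcases rtg_split (w := u) (x := x) h1 with h2 | ⟨_, h2⟩
            · exact h2
            · rcases h2.cases_head with rfl | ⟨c, h3, _⟩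
              · exact absurd hy hxY
              · exact absurd h3.1 (hxs _)
        · rintro y (rfl | hy) z ⟨h1, h2⟩
          · exact h2 ⟨rfl, h.lk.fn h1 hm'⟩
          · exact h.lk.noOut (Set.mem_insert_of_mem _ hy) h1
      · intro z hz hzn b
        have h1 := h.i1 z hz (fun h => hzn h.up) b
        exact ⟨fun h => h1.1 h.1, fun h => h1.2 h.1⟩
      · intro a b h1 h2
        refine ⟨h.i2 a b h1 fun h => h2 h.up, ?_⟩
        rintro ⟨rfl, rfl⟩; exact h2 (.back hx hm)
      · rintro a b ⟨h1, h2⟩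
        have hxa : ∀ {N : V → V → Prop}, (∀ p q, N p q → M' p q) → ¬ ReflTransGen N x a := by
          intro N hN h3
          rcases h3.cases_head with rfl | ⟨c, h3, _⟩
          · exact hxs _ h1
          · exact hxs _ (hN _ _ h3)
        rcases h.i3 a b h1 with ⟨a', ha', h3⟩ | h3
        · rcases rtg_split (w := u) (x := x) h3 with h3 | ⟨_, h3⟩
          · exact .inl ⟨a', ha', h3⟩
          · exact (hxa (fun _ _ h => h.1) h3).elim
        · rcases rtg_split (w := u) (x := x) h3 with h3 | ⟨_, h3⟩
          · exact .inr h3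
          · exact (hxa (fun _ _ h => h.1) h3).elim
    | @cut _ w x _ hw hg hm =>
      obtain ⟨M', h⟩ := ih w hw
      have hm' := h.i2 _ _ hm hun
      have hws : ∀ z, ¬ M' w z := fun z => h.lk.noOut (Set.mem_insert _ _)
      have hwY := hw.notMem hM
      have hwu : w ≠ u := by rintro rfl; exact hun hw
      obtain ⟨a0, ha0, hr0⟩ := h.lk.tgt (Set.mem_insert w Y)
      set N : V → V → Prop := fun a b => M' a b ∧ ¬ (a = u ∧ b = x) with hN
      have hwN : ∀ {z}, ReflTransGen N w z → z = w := by
        intro z hz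
        rcases hz.cases_head with rfl | ⟨c, h3, _⟩
        · rfl
        · exact absurd h3.1 (hws _)
      have ftN : ∀ {a b c}, ReflTransGen N a b → ReflTransGen N a c →
          ReflTransGen N b c ∨ ReflTransGen N c b := fun h1 h2 =>
        ReflTransGen.total_of_right_unique (fun _ _ _ a b => h.lk.fn a.1 b.1) h1 h2
      let P : V → V → Prop := fun a b => N a b ∨ (a = w ∧ b = x)
      have NP : ∀ {a b}, ReflTransGen N a b → ReflTransGen P a b :=
        fun h => h.mn fun _ _ h => .inl h
      have wx : ReflTransGen P w x := .single (.inr ⟨rfl, rfl⟩)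
      have s0 := rtg_split (w := u) (x := x) hr0
      refine ⟨P, ⟨?_, ?_, ?_, ?_⟩⟩
      · refine ⟨?_, ?_, ?_, ?_, ?_, ?_⟩
        · rintro a b (h1 | ⟨rfl, rfl⟩)
          exacts [h.lk.sub h1.1, hg]
        · rintro a b (h1 | ⟨rfl, rfl⟩)
          exacts [h.lk.inA h1.1, h.lk.inA hm']
        · rintro a b c (h1 | ⟨rfl, rfl⟩) (h2 | ⟨rfl, h2⟩)
          · exact h.lk.inj h1.1 h2.1
          · subst h2; exact (h1.2 ⟨h.lk.inj h1.1 hm', rfl⟩).elim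
          · exact (h2.2 ⟨h.lk.inj h2.1 hm', rfl⟩).elim
          · rfl
        · rintro a b c (h1 | ⟨rfl, rfl⟩) (h2 | ⟨h2, h3⟩)
          · exact h.lk.fn h1.1 h2.1
          · subst h2; exact (hws _ h1.1).elim
          · exact (hws _ h2.1).elim
          · exact h3.symm
        · rintro y (rfl | hy)
          · rcases h.i3 _ _ hm' with ⟨a, ha, h1⟩ | h1
            · refine ⟨a, ha, NP ?_⟩
              exact (rtg_split (w := y) (x := x) h1).elim id And.left
            · have h2 : ReflTransGen N x y := (rtg_split (w := y) (x := x) h1).elim id And.right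
              rcases s0 with s0 | ⟨s0, _⟩
              · exact ⟨a0, ha0, ((NP s0).trans wx).trans (NP h2)⟩
              · exact ⟨a0, ha0, NP s0⟩
          · obtain ⟨a, ha, h1⟩ := h.lk.tgt (Set.mem_insert_of_mem _ hy)
            rcases rtg_split (w := u) (x := x) h1 with h1 | ⟨_, h1⟩
            · exact ⟨a, ha, NP h1⟩
            · rcases s0 with s0 | ⟨_, s0⟩
              · exact ⟨a0, ha0, ((NP s0).trans wx).trans (NP h1)⟩
              · exfalso
                rcases ftN h1 s0 with h2 | h2
                · rcases h2.cases_head with rfl | ⟨c, h3, _⟩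
                  · exact hwY hy
                  · exact h.lk.noOut (Set.mem_insert_of_mem _ hy) h3.1
                · exact hwY (hwN h2 ▸ hy)
        · rintro y z (rfl | hy) (h1 | ⟨h1, h2⟩)
          · exact h1.2 ⟨rfl, h.lk.fn h1.1 hm'⟩
          · exact hwu h1.symm
          · exact h.lk.noOut (Set.mem_insert_of_mem _ hy) h1.1
          · exact hwY (h1 ▸ hy)
      · intro z hz hzn b
        have h1 := h.i1 z hz (fun h => hzn h.up) b
        refine ⟨?_, ?_⟩
        · rintro (h2 | ⟨rfl, rfl⟩)
          exacts [h1.1 h2.1, hzn hw.up]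
        · rintro (h2 | ⟨rfl, rfl⟩)
          exacts [h1.2 h2.1, hz (hM.on_succ (hp _ _ hm) hm)]
      · intro a b h1 h2
        refine .inl ⟨h.i2 a b h1 fun h => h2 h.up, ?_⟩
        rintro ⟨rfl, rfl⟩; exact h2 (.cut hw hg hm)
      · rintro a b (h1 | ⟨rfl, rfl⟩)
        · have key : ReflTransGen N x a → (∃ a' ∈ A, ReflTransGen P a' a) ∨ ReflTransGen P b a := by
            intro h3
            rcases s0 with s0 | ⟨_, s0⟩
            · exact .inl ⟨a0, ha0, ((NP s0).trans wx).trans (NP h3)⟩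
            · rcases ftN h3 s0 with h4 | h4
              · rcases h4.cases_head with rfl | ⟨c, h5, h6⟩
                · exact absurd h1.1 (hws _)
                · obtain rfl := h.lk.fn h1.1 h5.1
                  exact .inr (((NP h6).trans wx).trans (NP h3))
              · have := hwN h4; subst this; exact absurd h1.1 (hws _)
          rcases h.i3 a b h1.1 with ⟨a', ha', h3⟩ | h3
          · rcases rtg_split (w := u) (x := x) h3 with h3 | ⟨_, h3⟩
            · exact .inl ⟨a', ha', NP h3⟩
            · exact key h3
          · rcases rtg_split (w := u) (x := x) h3 with h3 | ⟨_, h3⟩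
            · exact .inr (NP h3)
            · exact key h3
        · rcases s0 with s0 | ⟨_, s0⟩
          · exact .inl ⟨a0, ha0, NP s0⟩
          · exact .inr (NP s0)

end FL

/-! Part 3 -/
namespace FL
open Relation

/-- `Y` is linkable from `A`. -/
def Lkb (G : V → V → Prop) (A Y : Set V) : Prop := ∃ M, Lk G A Y M

theorem Lkb.subset {G : V → V → Prop} {A Y Y' : Set V} (h : Lkb G A Y) (hY : Y' ⊆ Y) :
    Lkb G A Y' := h.imp fun _ h => h.subset hY

theorem Lk.on_prune {G : V → V → Prop} {A Y : Set V} {M : V → V → Prop} (h : Lk G A Y M) {z : V} :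
    On A Y (fun x y => M x y ∧ On A Y M x) z ↔ On A Y M z := by
  constructor
  · rintro ⟨⟨a, ha, h1⟩, y, hy, h2⟩
    exact ⟨⟨a, ha, h1.mn fun _ _ h => h.1⟩, y, hy, h2.mn fun _ _ h => h.1⟩
  · intro hz
    obtain ⟨⟨a, ha, h1⟩, y, hy, h2⟩ := id hz
    constructor
    · refine ⟨a, ha, ?_⟩
      clear h2
      induction h1 with
      | refl => exact .refl
      | tail _ h3 ih => exact (ih (h.on_pred hz h3)).tail ⟨h3, h.on_pred hz h3⟩
    · refine ⟨y, hy, ?_⟩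
      clear h1
      induction h2 using ReflTransGen.head_induction_on with
      | refl => exact .refl
      | head h3 _ ih => exact .head ⟨h3, hz⟩ (ih (h.on_succ hz h3))

theorem augSet {G : V → V → Prop} {A Y : Set V} {M : V → V → Prop} (h : Lk G A Y M) :
    ∃ O, Cl G A Y M O ∧ ∀ u, O u → Lkb G A (insert u Y) := by
  have hp := h.prune
  have c := Aug.cl hp
  refine ⟨_, ⟨?_, ?_, ?_, ?_, c.c5⟩, ?_⟩
  · intro a ha h1; exact c.c1 a ha (by rwa [h.on_prune])
  · intro w x h1 h2 h3; exact c.c2 w x h1 h2 (by rwa [h.on_prune])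
  · intro w x w' h1 h2 h3 h4
    exact c.c3 w x w' h1 h2 (by rwa [h.on_prune]) ⟨h4, h.on_pred h3 h4⟩
  · intro x w' h1 h3 h4
    exact c.c4 x w' h1 (by rwa [h.on_prune]) ⟨h4, h.on_pred h3 h4⟩
  · rintro u ⟨n, hu⟩
    obtain ⟨M', h'⟩ := Aug.inv hp (fun x y hxy => h.on_prune.2 hxy.2) n u hu
    exact ⟨M', h'.lk⟩

/-- `U` meets every path of the linkage exactly once, and separates `Y` from `A`. -/
structure Orth (G : V → V → Prop) (A Y : Set V) (M : V → V → Prop) (U : Set V) : Prop where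
  lk : Lk G A U (fun x y => M x y ∧ Rc G A U x)
  on : ∀ u ∈ U, On A Y M u
  hit : ∀ y ∈ Y, ∃ u ∈ U, ReflTransGen M u y
  anti : ∀ u ∈ U, ∀ u' ∈ U, ¬ TransGen M u u'
  blk : ∀ y ∈ Y, ¬ Rc G A U y

theorem Lk.rc_rtg {G : V → V → Prop} {A Y X : Set V} {M : V → V → Prop} (h : Lk G A Y M)
    {a z : V} (ha : a ∈ A) (h1 : ReflTransGen M a z)
    (hX : ∀ w w', ReflTransGen M a w → M w w' → ReflTransGen M w' z → w ∉ X) :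
    ReflTransGen (fun x y => M x y ∧ Rc G A X x) a z := by
  induction h1 with
  | refl => exact .refl
  | @tail b c h2 h3 ih =>
    refine (ih fun w w' h4 h5 h6 => hX w w' h4 h5 (h6.tail h3)).tail ⟨h3, h.rc_path ha h2 ?_⟩
    intro w h4 h5
    rcases h5.cases_head with rfl | ⟨w', h6, h7⟩
    · exact hX _ _ h4 h3 .refl
    · exact hX _ _ h4 h6 (h7.tail h3)

theorem Cl.orth {G : V → V → Prop} {A Y : Set V} {M : V → V → Prop} {O : V → Prop}
    (h : Lk G A Y M) (c : Cl G A Y M O) : Orth G A Y M (fst A Y M O) where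
  lk := h.subM (fun _ _ h => h.1)
    (fun u hu => by
      obtain ⟨a, ha, h1⟩ := ((c.lk h).pruneRc).tgt hu
      exact ⟨a, ha, h1.mn fun _ _ h => ⟨h.1.1, h.2⟩⟩)
    (fun u hu z h => h.2.notMem hu)
  on u hu := hu.1
  hit y hy := c.reached h (h.on_tgt hy) (c.c5 y hy)
  anti u hu u' hu' := c.anti h hu hu'
  blk y hy hr := c.c5 y hy (c.rc h hr)

/-- Augment or separate. -/
theorem AL {G : V → V → Prop} {A Y : Set V} {M : V → V → Prop} (h : Lk G A Y M) (Qs : Set V) :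
    (∃ q ∈ Qs, Lkb G A (insert q Y)) ∨
    ∃ U, Orth G A Y M U ∧ ∀ q ∈ Qs, ¬ Rc G A U q := by
  obtain ⟨O, c, hO⟩ := augSet h
  by_cases hq : ∃ q ∈ Qs, O q
  · obtain ⟨q, hq, h1⟩ := hq
    exact .inl ⟨q, hq, hO q h1⟩
  · exact .inr ⟨_, c.orth h, fun q hqQ hr => hq ⟨q, hqQ, c.rc h hr⟩⟩

theorem exchange1 {G : V → V → Prop} {A B : Set V} {g f1 f2 : V} (hg : Lkb G A (insert g B))
    (hf : Lkb G A (insert f1 (insert f2 B))) (h12 : f1 ≠ f2) (h1B : f1 ∉ B) (h2B : f2 ∉ B) :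
    Lkb G A (insert g (insert f1 B)) ∨ Lkb G A (insert g (insert f2 B)) := by
  obtain ⟨M, hM⟩ := hf
  have s1 : insert f1 B ⊆ insert f1 (insert f2 B) := by intro x; simp; tauto
  have s2 : insert f2 B ⊆ insert f1 (insert f2 B) := by intro x; simp; tauto
  have s0 : B ⊆ insert f1 (insert f2 B) := by intro x; simp; tauto
  have m1 : f1 ∈ insert f1 (insert f2 B) := by simp
  have m2 : f2 ∈ insert f1 (insert f2 B) := by simp
  obtain ⟨O1, c1, a1⟩ := augSet (hM.subset s1)
  obtain ⟨O2, c2, a2⟩ := augSet (hM.subset s2)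
  by_cases hg1 : O1 g
  · exact .inl (a1 g hg1)
  by_cases hg2 : O2 g
  · exact .inr (a2 g hg2)
  have on01 : ∀ {x}, On A B M x → On A (insert f1 B) M x := fun h =>
    ⟨h.1, h.2.imp fun y h => ⟨.inr h.1, h.2⟩⟩
  have on02 : ∀ {x}, On A B M x → On A (insert f2 B) M x := fun h =>
    ⟨h.1, h.2.imp fun y h => ⟨.inr h.1, h.2⟩⟩
  have p1 : ∀ {x}, (∃ a ∈ A, ReflTransGen M a x) → ReflTransGen M x f1 → O2 x := by
    rintro x ⟨a, ha, h1⟩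
    have no : ∀ {x}, ReflTransGen M x f1 → ¬ On A (insert f2 B) M x := by
      rintro x h1 ⟨-, y, hy, h2⟩
      have := hM.tgt_unique m1 (s2 hy) h1 h2
      subst this
      rcases hy with rfl | hy
      exacts [h12 rfl, h1B hy]
    induction h1 with
    | refl => intro h2; exact c2.c1 _ ha (no h2)
    | tail _ h3 ih => intro h2; exact c2.c2 _ _ (ih (.head h3 h2)) (hM.sub h3) (no h2)
  have p2 : ∀ {x}, (∃ a ∈ A, ReflTransGen M a x) → ReflTransGen M x f2 → O1 x := by
    rintro x ⟨a, ha, h1⟩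
    have no : ∀ {x}, ReflTransGen M x f2 → ¬ On A (insert f1 B) M x := by
      rintro x h1 ⟨-, y, hy, h2⟩
      have := hM.tgt_unique m2 (s1 hy) h1 h2
      subst this
      rcases hy with rfl | hy
      exacts [h12 rfl, h2B hy]
    induction h1 with
    | refl => intro h2; exact c1.c1 _ ha (no h2)
    | tail _ h3 ih => intro h2; exact c1.c2 _ _ (ih (.head h3 h2)) (hM.sub h3) (no h2)
  have q1 : ∀ {x}, On A (insert f1 B) M x → ¬ On A B M x → O2 x := by
    rintro x ⟨h1, y, hy, h2⟩ h3
    rcases hy with rfl | hy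
    · exact p1 h1 h2
    · exact absurd ⟨h1, y, hy, h2⟩ h3
  have c : Cl G A B M (fun x => O1 x ∨ O2 x) := by
    refine ⟨?_, ?_, ?_, ?_, ?_⟩
    · intro a ha h1
      by_cases h2 : On A (insert f1 B) M a
      · exact .inr (q1 h2 h1)
      · exact .inl (c1.c1 a ha h2)
    · rintro w x hw h1 h2
      by_cases h3 : On A (insert f1 B) M x
      · exact .inr (q1 h3 h2)
      · rcases hw with hw | hw
        · exact .inl (c1.c2 w x hw h1 h3)
        · by_cases h4 : On A (insert f2 B) M x
          · obtain ⟨h5, y, hy, h6⟩ := h4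
            rcases hy with rfl | hy
            · exact .inl (p2 h5 h6)
            · exact absurd ⟨h5, y, hy, h6⟩ h2
          · exact .inr (c2.c2 w x hw h1 h4)
    · rintro w x w' hw h1 h2 h3
      exact hw.imp (fun hw => c1.c3 w x w' hw h1 (on01 h2) h3)
        (fun hw => c2.c3 w x w' hw h1 (on02 h2) h3)
    · rintro x w' hw h2 h3
      exact hw.imp (fun hw => c1.c4 x w' hw (on01 h2) h3)
        (fun hw => c2.c4 x w' hw (on02 h2) h3)
    · rintro y hy (h | h)
      exacts [c1.c5 y (.inr hy) h, c2.c5 y (.inr hy) h]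
  have ho := c.orth (hM.subset s0)
  obtain ⟨U, hU⟩ : ∃ U, U = fst A B M (fun x => O1 x ∨ O2 x) := ⟨_, rfl⟩
  have hrc : ∀ z, Rc G A U z → O1 z ∨ O2 z := by rw [hU]; exact fun z => c.rc (hM.subset s0)
  rw [← hU] at ho
  obtain ⟨N, hN⟩ := hg
  have hN' := hN.cut' (T := U) (by
    rintro y (rfl | hy) hr
    · exact (hrc _ hr).elim hg1 hg2
    · exact ho.blk y hy hr)
  have avoid : ∀ f, f ∈ insert f1 (insert f2 B) → f ∉ B → ∀ w, ReflTransGen M w f → w ∉ U := by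
    intro f hf hfB w h1 h2
    obtain ⟨-, y, hy, h3⟩ := ho.on w h2
    exact hfB (hM.tgt_unique hf (s0 hy) h1 h3 ▸ hy)
  have hM' : Lk G A (U ∪ {f1, f2}) (fun x y => M x y ∧ Rc G A U x) := by
    refine hM.subM (fun _ _ h => h.1) ?_ ?_
    · have : ∀ f, f ∈ insert f1 (insert f2 B) → f ∉ B →
          ∃ a ∈ A, ReflTransGen (fun x y => M x y ∧ Rc G A U x) a f := by
        intro f hf hfB
        obtain ⟨a, ha, h1⟩ := hM.tgt hf
        exact ⟨a, ha, hM.rc_rtg ha h1 fun w w' h2 h3 h4 => avoid f hf hfB w (.head h3 h4)⟩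
      rintro y (hy | rfl | rfl)
      · exact ho.lk.tgt hy
      · exact this _ m1 h1B
      · exact this _ m2 h2B
    · rintro y (hy | rfl | rfl) z h
      · exact h.2.notMem hy
      · exact hM.noOut m1 h.1
      · exact hM.noOut m2 h.1
  have hW : ∀ f, f ∈ insert f1 (insert f2 B) → f ∉ B → Rc G A U f := by
    intro f hf hfB
    obtain ⟨a, ha, h1⟩ := hM.tgt hf
    exact hM.rc_path ha h1 fun w h2 h3 => avoid f hf hfB w h3
  have := hM'.comp hN' (by rintro w (rfl | rfl); exacts [hW _ m1 h1B, hW _ m2 h2B])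
  exact .inl ⟨_, this.subset (by intro x; simp; tauto)⟩

theorem exchange {G : V → V → Prop} {A : Set V} : ∀ (n : ℕ) {B1 B2 : Set V}, Lkb G A B1 →
    Lkb G A B2 → (B1 \ B2).Finite → (B1 \ B2).ncard = n → (n + 1 : ℕ∞) ≤ (B2 \ B1).encard →
    ∃ f ∈ B2 \ B1, Lkb G A (insert f B1) := by
  intro n
  induction n with
  | zero =>
    intro B1 B2 h1 h2 hf hn hc
    have he : B1 \ B2 = ∅ := by rwa [Set.ncard_eq_zero hf] at hn
    have hs : B1 ⊆ B2 := Set.diff_eq_empty.1 he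
    obtain ⟨f, hf⟩ : (B2 \ B1).Nonempty := by
      rw [← Set.encard_pos]; exact lt_of_lt_of_le (by simp) hc
    exact ⟨f, hf, h2.subset (Set.insert_subset hf.1 hs)⟩
  | succ n ih =>
    intro B1 B2 h1 h2 hf hn hc
    obtain ⟨g, hg⟩ : (B1 \ B2).Nonempty := by
      rw [← Set.ncard_pos hf]; omega
    have e1 : (B1 \ {g}) \ B2 = (B1 \ B2) \ {g} := by ext x; simp; tauto
    have e2 : B2 \ (B1 \ {g}) = B2 \ B1 := by
      ext x; simp only [Set.mem_diff, Set.mem_singleton_iff]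
      constructor
      · rintro ⟨h3, h4⟩
        refine ⟨h3, fun h5 => h4 ⟨h5, ?_⟩⟩
        rintro rfl; exact hg.2 h3
      · rintro ⟨h3, h4⟩; exact ⟨h3, fun h5 => h4 h5.1⟩
    have n1 : ((B1 \ B2) \ {g}).ncard = n := by
      rw [Set.ncard_diff_singleton_of_mem hg, hn]; rfl
    obtain ⟨f1, hf1, hl1⟩ := ih (B1 := B1 \ {g}) (B2 := B2) (h1.subset Set.diff_subset) h2
      (by rw [e1]; exact hf.diff) (by rw [e1]; exact n1)
      (by rw [e2]; refine le_trans ?_ hc; push_cast; exact le_self_add)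
    rw [e2] at hf1
    have e3 : (insert f1 (B1 \ {g})) \ B2 = (B1 \ B2) \ {g} := by
      rw [← e1]; ext x; simp only [Set.mem_diff, Set.mem_insert_iff, Set.mem_singleton_iff]
      constructor
      · rintro ⟨rfl | h, h3⟩
        exacts [absurd hf1.1 h3, ⟨h, h3⟩]
      · rintro ⟨h, h3⟩; exact ⟨.inr h, h3⟩
    have e4 : B2 \ (insert f1 (B1 \ {g})) = (B2 \ B1) \ {f1} := by
      rw [← e2]; ext x; simp; tauto
    obtain ⟨f2, hf2, hl2⟩ := ih (B1 := insert f1 (B1 \ {g})) (B2 := B2) hl1 h2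
      (by rw [e3]; exact hf.diff) (by rw [e3]; exact n1) (by
        rw [e4]
        have := Set.encard_diff_singleton_add_one hf1
        rw [← this] at hc
        push_cast at hc
        exact (ENat.add_le_add_iff_right (by simp)).1 hc)
    rw [e4] at hf2
    have eg : insert g (B1 \ {g}) = B1 := by rw [Set.insert_diff_singleton, Set.insert_eq_of_mem hg.1]
    rcases exchange1 (g := g) (f1 := f2) (f2 := f1) (B := B1 \ {g}) (by rwa [eg]) hl2 hf2.2
      (fun h => hf2.1.2 h.1) (fun h => hf1.2 h.1) with h | h
    · exact ⟨f2, hf2.1, by rwa [Set.insert_comm, eg] at h⟩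
    · exact ⟨f1, hf1, by rwa [Set.insert_comm, eg] at h⟩

end FL

/-! Part 4 -/
namespace FL
open Relation

/-- `Y` separates `B` from `A` (i.e. nothing in `B` is strictly before `Y`). -/
def Blk (G : V → V → Prop) (A Y B : Set V) : Prop := ∀ b ∈ B, ¬ Rc G A Y b

def Loose (G : V → V → Prop) (A B : Set V) : Prop :=
  ∀ Y, Lkb G A Y → Blk G A Y B → A ⊆ Y

def Unh (G : V → V → Prop) (A B : Set V) : Prop :=
  ∀ Y M, Lk G A Y M → Blk G A Y B → ∀ a ∈ A, ∃ y ∈ Y, ReflTransGen M a y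

theorem Lk.sub_of_sup {G : V → V → Prop} {A Y : Set V} {M : V → V → Prop} (h : Lk G A Y M)
    (hA : A ⊆ Y) : Y ⊆ A := by
  intro y hy
  obtain ⟨a, ha, h1⟩ := h.tgt hy
  rcases h1.cases_head with rfl | ⟨c, h2, _⟩
  · exact ha
  · exact (h.noOut (hA ha) h2).elim

/-- Waves. -/
structure Wave (G : V → V → Prop) (A B Y : Set V) (M : V → V → Prop) : Prop where
  lk : Lk G A Y M
  blk : Blk G A Y B
  pr : ∀ x y, M x y → Rc G A Y x

theorem Lk.wave {G : V → V → Prop} {A B Y : Set V} {M : V → V → Prop} (h : Lk G A Y M)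
    (hb : Blk G A Y B) : Wave G A B Y (fun x y => M x y ∧ Rc G A Y x) :=
  ⟨h.pruneRc, hb, fun _ _ h => h.2⟩

theorem Wave.triv (G : V → V → Prop) (A B : Set V) : Wave G A B A (fun _ _ => False) := by
  refine ⟨⟨False.elim, False.elim, False.elim, False.elim, fun h => ⟨_, h, .refl⟩, fun _ => id⟩,
    fun b _ h => ?_, fun _ _ => False.elim⟩
  have : ∀ z, ¬ Rc G A A z := by
    intro z hz
    induction hz with
    | base h1 h2 => exact h2 h1
    | step _ _ _ ih => exact ih
  exact this b h

theorem Wave.tgt_reach {G : V → V → Prop} {A B Y : Set V} {M : V → V → Prop}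
    (h : Wave G A B Y M) {y : V} (hy : y ∈ Y) : y ∈ A ∨ ∃ w, Rc G A Y w ∧ G w y := by
  obtain ⟨a, ha, h1⟩ := h.lk.tgt hy
  rcases h1.cases_tail with rfl | ⟨w, _, h2⟩
  · exact .inl ha
  · exact .inr ⟨w, h.pr _ _ h2, h.lk.sub h2⟩

theorem rc_sub {G : V → V → Prop} {A Y Y' : Set V} (hd : ∀ y ∈ Y', ¬ Rc G A Y y) {z : V}
    (h : Rc G A Y z) : Rc G A Y' z := h.anti fun z hz hzY => hd z hzY hz

/-- Reachability past a wave. -/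
theorem Wave.rc_iff {G : V → V → Prop} {A B Y Y' : Set V} {M : V → V → Prop}
    (h : Wave G A B Y M) (hd : ∀ y ∈ Y', ¬ Rc G A Y y) {z : V} :
    Rc G A Y' z ↔ Rc G A Y z ∨ Rc (Gb G (Rc G A Y)) Y Y' z := by
  constructor
  · intro hz
    induction hz with
    | @base a ha hx => exact (Rc.start ha).imp id fun h => .base h hx
    | @step x y h1 h2 h3 ih =>
      by_cases hy : Rc G A Y y
      · exact .inl hy
      by_cases hx : Rc G A Y x
      · exact (hx.next h2).imp id fun h => .base h h3
      · exact .inr (.step (ih.resolve_left hx) ⟨h2, hx, hy⟩ h3)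
  · rintro (hz | hz)
    · exact rc_sub hd hz
    · induction hz with
      | @base a ha hx =>
        rcases h.tgt_reach ha with h1 | ⟨w, h1, h2⟩
        · exact .base h1 hx
        · exact .step (rc_sub hd h1) h2 hx
      | step _ h2 h3 ih => exact .step ih h2.1 h3

theorem Lk.notR {G : V → V → Prop} {R : V → Prop} {A Y : Set V} {N : V → V → Prop}
    (h : Lk (Gb G R) A Y N) (hA : ∀ a ∈ A, ¬ R a) : ∀ y ∈ Y, ¬ R y := by
  intro y hy
  obtain ⟨a, ha, h1⟩ := h.tgt hy
  rcases h1.cases_tail with rfl | ⟨w, _, h2⟩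
  · exact hA _ ha
  · exact (h.sub h2).2.2

/-- Extending a wave by a wave beyond. -/
theorem Wave.ext {G : V → V → Prop} {A B Y Y' : Set V} {M N : V → V → Prop}
    (h : Wave G A B Y M) (h' : Wave (Gb G (Rc G A Y)) Y B Y' N) :
    Wave G A B Y' (fun x y => M x y ∨ N x y) ∧ ∀ y ∈ Y', ¬ Rc G A Y y := by
  have hd : ∀ y ∈ Y', ¬ Rc G A Y y := h'.lk.notR fun y hy h => h.notMem hy
  refine ⟨⟨?_, ?_, ?_⟩, hd⟩
  · have := Lk.compose (W := ∅) (R := Rc G A Y) (by simpa using h.lk) h'.lk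
      (fun _ ha => Rc.start ha) (fun x y h1 => ⟨h.pr x y h1, (h.pr x y h1).next (h.lk.sub h1)⟩)
      (by simp)
    simpa using this
  · intro b hb hr
    rcases (h.rc_iff hd).1 hr with h1 | h1
    · exact h.blk b hb h1
    · exact h'.blk b hb h1
  · rintro x y (h1 | h1)
    · exact rc_sub hd (h.pr x y h1)
    · exact (h.rc_iff hd).2 (.inr (h'.pr x y h1))

/-- The order on waves. -/
def wle (G : V → V → Prop) (A : Set V) (p q : Set V × (V → V → Prop)) : Prop :=
  (∀ x y, p.2 x y → q.2 x y) ∧ ∀ y ∈ q.1, ¬ Rc G A p.1 y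

theorem wave_chain {G : V → V → Prop} {A B : Set V} (c : Set (Set V × (V → V → Prop)))
    (hw : ∀ p ∈ c, Wave G A B p.1 p.2) (hd : ∀ p ∈ c, ∀ q ∈ c, ∃ s ∈ c, wle G A p s ∧ wle G A q s)
    (hne : c.Nonempty) :
    Wave G A B {y | ∃ p ∈ c, ∀ q ∈ c, wle G A p q → y ∈ q.1} (fun x y => ∃ p ∈ c, p.2 x y) ∧
    ∀ p ∈ c, wle G A p ({y | ∃ p ∈ c, ∀ q ∈ c, wle G A p q → y ∈ q.1},
      (fun x y => ∃ p ∈ c, p.2 x y)) := by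
  set Y : Set V := {y | ∃ p ∈ c, ∀ q ∈ c, wle G A p q → y ∈ q.1} with hY
  have hdis : ∀ p ∈ c, ∀ y ∈ Y, ¬ Rc G A p.1 y := by
    rintro p hp y ⟨q, hq, h1⟩ h2
    obtain ⟨s, hs, h3, h4⟩ := hd p hp q hq
    exact h3.2 y (h1 s hs h4) h2
  have hrc : ∀ z, Rc G A Y z → ∃ p ∈ c, Rc G A p.1 z := by
    intro z hz
    have out : ∀ y, y ∉ Y → ∀ p ∈ c, ∃ q ∈ c, wle G A p q ∧ y ∉ q.1 := by
      intro y hy p hp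
      by_contra hcon
      push Not at hcon
      exact hy ⟨p, hp, hcon⟩
    induction hz with
    | @base a ha hx =>
      obtain ⟨p, hp⟩ := hne
      obtain ⟨q, hq, _, h2⟩ := out a hx p hp
      exact ⟨q, hq, .base ha h2⟩
    | @step x y _ h2 h3 ih =>
      obtain ⟨p, hp, h4⟩ := ih
      obtain ⟨q, hq, h5, h6⟩ := out y h3 p hp
      exact ⟨q, hq, .step (rc_sub h5.2 h4) h2 h6⟩
  refine ⟨⟨⟨?_, ?_, ?_, ?_, ?_, ?_⟩, ?_, ?_⟩, ?_⟩
  · rintro x y ⟨p, hp, h⟩; exact (hw p hp).lk.sub h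
  · rintro x y ⟨p, hp, h⟩; exact (hw p hp).lk.inA h
  · rintro x y z ⟨p, hp, h⟩ ⟨q, hq, h'⟩
    obtain ⟨s, hs, h3, h4⟩ := hd p hp q hq
    exact (hw s hs).lk.inj (h3.1 _ _ h) (h4.1 _ _ h')
  · rintro x y z ⟨p, hp, h⟩ ⟨q, hq, h'⟩
    obtain ⟨s, hs, h3, h4⟩ := hd p hp q hq
    exact (hw s hs).lk.fn (h3.1 _ _ h) (h4.1 _ _ h')
  · rintro y ⟨p, hp, h⟩
    obtain ⟨s, hs, h3, _⟩ := hd p hp p hp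
    obtain ⟨a, ha, h1⟩ := (hw s hs).lk.tgt (h s hs h3)
    exact ⟨a, ha, h1.mn fun _ _ h => ⟨s, hs, h⟩⟩
  · rintro y z ⟨p, hp, h⟩ ⟨q, hq, h'⟩
    obtain ⟨s, hs, h3, h4⟩ := hd p hp q hq
    exact (hw s hs).lk.noOut (h s hs h3) (h4.1 _ _ h')
  · intro b hb h
    obtain ⟨p, hp, h1⟩ := hrc b h
    exact (hw p hp).blk b hb h1
  · rintro x y ⟨p, hp, h⟩
    exact rc_sub (hdis p hp) ((hw p hp).pr x y h)
  · intro p hp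
    exact ⟨fun x y h => ⟨p, hp, h⟩, hdis p hp⟩

/-- Maximal waves. -/
theorem maxWave {G : V → V → Prop} {A B Y0 : Set V} {M0 : V → V → Prop}
    (h0 : Wave G A B Y0 M0) :
    ∃ X M, Wave G A B X M ∧ Loose (Gb G (Rc G A X)) X B ∧ (∀ x y, M0 x y → M x y) ∧
      ∀ x ∈ X, ¬ Rc G A Y0 x := by
  have htr : ∀ p q s : Set V × (V → V → Prop), wle G A p q → wle G A q s → wle G A p s :=
    fun p q s h1 h2 => ⟨fun x y h => h2.1 _ _ (h1.1 _ _ h), fun y hy h =>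
      h2.2 y hy (rc_sub h1.2 h)⟩
  let α := {p : Set V × (V → V → Prop) // Wave G A B p.1 p.2 ∧ wle G A (Y0, M0) p}
  have w00 : wle G A (Y0, M0) (Y0, M0) := ⟨fun _ _ h => h, fun y hy h => h.notMem hy⟩
  obtain ⟨⟨⟨X, M⟩, hm⟩, hmax⟩ := exists_maximal_of_chains_bounded
    (r := fun p q : α => wle G A p.1 q.1) (by
      intro c hc
      by_cases hne : c.Nonempty
      · obtain ⟨hw, hu⟩ := wave_chain (G := G) (A := A) (B := B) (Subtype.val '' c)
          (by rintro _ ⟨p, _, rfl⟩; exact p.2.1)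
          (by
            rintro _ ⟨p, hp, rfl⟩ _ ⟨q, hq, rfl⟩
            have refl : ∀ p : α, wle G A p.1 p.1 := fun p =>
              ⟨fun _ _ h => h, fun y hy h => h.notMem hy⟩
            by_cases hpq : p = q
            · subst hpq; exact ⟨_, ⟨p, hp, rfl⟩, refl p, refl p⟩
            rcases hc hp hq hpq with h | h
            · exact ⟨_, ⟨q, hq, rfl⟩, h, refl q⟩
            · exact ⟨_, ⟨p, hp, rfl⟩, refl p, h⟩)
          (hne.image _)
        obtain ⟨p, hp⟩ := hne
        refine ⟨⟨_, hw, htr _ _ _ p.2.2 (hu _ ⟨p, hp, rfl⟩)⟩, fun q hq => hu _ ⟨q, hq, rfl⟩⟩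
      · exact ⟨⟨(Y0, M0), h0, w00⟩, fun a ha => (hne ⟨a, ha⟩).elim⟩)
    (fun {p q s} h1 h2 => htr _ _ _ h1 h2)
  refine ⟨X, M, hm.1, ?_, hm.2.1, hm.2.2⟩
  rintro Y' ⟨N, hN⟩ hb x hx
  by_contra hxY
  obtain ⟨hw, hd⟩ := hm.1.ext (hN.wave hb)
  have := hmax ⟨(Y', _), hw, htr _ _ _ hm.2 ⟨fun _ _ h => .inl h, hd⟩⟩ ⟨fun _ _ h => .inl h, hd⟩
  exact this.2 x hx ((hm.1.rc_iff hd).2 (.inr (.base hx hxY)))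

/-- Joining a maximal wave with any wave. -/
theorem wave_join {G : V → V → Prop} {A B X Y : Set V} (hl : Loose (Gb G (Rc G A X)) X B)
    (hY : Lkb G A Y) (hb : Blk G A Y B) :
    (∀ y ∈ Y, ¬ Rc G A X y → y ∈ X) ∧ ∀ x ∈ X, ¬ Rc G A Y x := by
  obtain ⟨N, hN⟩ := hY
  have hN' := hN.pruneRc
  have hc := (hN'.subset (Y' := {y | y ∈ Y ∧ ¬ Rc G A X y}) (fun y hy => hy.1)).cut' (T := X)
    (fun y hy => hy.2)
  have hlk : Lk (Gb G (Rc G A X)) X ({x | x ∈ X ∧ ¬ Rc G A Y x} ∪ {y | y ∈ Y ∧ ¬ Rc G A X y})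
      (fun x y => (N x y ∧ Rc G A Y x) ∧ ¬ Rc G A X x ∧ ¬ Rc G A X y ∧ y ∉ X) := by
    refine ⟨hc.sub, hc.inA, hc.inj, hc.fn, ?_, ?_⟩
    · rintro y (hy | hy)
      · exact ⟨y, hy.1, .refl⟩
      · exact hc.tgt hy
    · rintro y z (hy | hy) h
      · exact hy.2 h.1.2
      · exact hc.noOut hy h
  have hbl : Blk (Gb G (Rc G A X)) X ({x | x ∈ X ∧ ¬ Rc G A Y x} ∪ {y | y ∈ Y ∧ ¬ Rc G A X y}) B := by
    intro b hbB hr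
    refine hb b hbB ?_
    clear hbB
    induction hr with
    | @base x hx h1 =>
      by_contra h2; exact h1 (.inl ⟨hx, h2⟩)
    | @step x y _ h2 h3 ih =>
      rcases ih.next h2.1 with h4 | h4
      · exact h4
      · exact (h3 (.inr ⟨h4, h2.2.2⟩)).elim
  have hX := hl _ ⟨_, hlk⟩ hbl
  refine ⟨fun y hy h => hlk.sub_of_sup hX (.inr ⟨hy, h⟩), fun x hx h => ?_⟩
  rcases hX hx with h1 | h1
  · exact h1.2 h
  · exact h.notMem h1.1

/-- `G` without the vertices in `Z`. -/
def Gm (G : V → V → Prop) (Z : Set V) (x y : V) : Prop := G x y ∧ x ∉ Z ∧ y ∉ Z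

theorem Rc.mono2 {G G' : V → V → Prop} {A A' X X' : Set V} (hA : ∀ a ∈ A, Rc G A X a → a ∈ A')
    (hG : ∀ x y, Rc G A X x → Rc G A X y → G x y → G' x y)
    (hX : ∀ z, Rc G A X z → z ∉ X') {z : V} (h : Rc G A X z) : Rc G' A' X' z := by
  induction h with
  | base ha hx => exact .base (hA _ ha (.base ha hx)) (hX _ (.base ha hx))
  | step h1 h2 h3 ih =>
    exact .step ih (hG _ _ h1 (.step h1 h2 h3) h2) (hX _ (.step h1 h2 h3))

theorem unh_delete {G : V → V → Prop} {A B X : Set V} (hu : Unh G A B)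
    (hl : Loose (Gb G (Rc G A X)) X B) {q : V} (hq : ¬ Rc G A X q) (hqX : q ∉ X) :
    Unh (Gm G {q}) A B := by
  intro Y N hN hb a ha
  have hNG : Lk G A Y N := hN.monoG fun _ _ _ h => h.1
  rcases AL hNG {q} with ⟨q', hq', h⟩ | ⟨U, hU, hUq⟩
  · obtain rfl : q' = q := hq'
    exfalso
    refine hqX ((wave_join hl h ?_).1 _ (Set.mem_insert _ _) hq)
    intro b hbB hr
    refine hb b hbB (hr.mono2 (fun _ h _ => h) ?_ ?_)
    · intro x y h1 h2 h3
      exact ⟨h3, fun h => h1.notMem (.inl h), fun h => h2.notMem (.inl h)⟩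
    · intro z h1 h2; exact h1.notMem (.inr h2)
  · have hUb : Blk G A U B := by
      intro b hbB hr
      refine hb b hbB (hr.mono2 (fun _ h _ => h) ?_ ?_)
      · intro x y h1 h2 h3
        refine ⟨h3, ?_, ?_⟩
        · rintro rfl; exact hUq _ rfl h1
        · rintro rfl; exact hUq _ rfl h2
      · intro z h1 h2; exact hU.blk z h2 h1
    obtain ⟨u, hu1, h1⟩ := hu U _ hU.lk hUb a ha
    obtain ⟨-, y, hy, h2⟩ := hU.on u hu1
    exact ⟨y, hy, (h1.mn fun _ _ h => h.1).trans h2⟩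

theorem unh_start {G : V → V → Prop} {A B : Set V} (hu : Unh G A B) {a : V} (ha : a ∈ A) :
    Unh (Gm G {a}) (A \ {a}) B := by
  intro Y N hN hb a' ha'
  have hN0 : ∀ {x y}, N x y → x ≠ a ∧ y ≠ a := fun h => ⟨(hN.sub h).2.1, (hN.sub h).2.2⟩
  have hY : a ∉ Y := by
    intro hy
    obtain ⟨c, hc, h1⟩ := hN.tgt hy
    rcases h1.cases_tail with rfl | ⟨w, _, h2⟩
    · exact hc.2 rfl
    · exact (hN0 h2).2 rfl
  have hl : Lk G A (insert a Y) N := by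
    refine ⟨fun h => (hN.sub h).1, ?_, hN.inj, hN.fn, ?_, ?_⟩
    · intro x y h1 h2; exact hN.inA h1 ⟨h2, (hN0 h1).2⟩
    · rintro y (rfl | hy)
      · exact ⟨_, ha, .refl⟩
      · obtain ⟨c, hc, h⟩ := hN.tgt hy
        exact ⟨c, hc.1, h⟩
    · rintro y z (rfl | hy) h
      · exact (hN0 h).1 rfl
      · exact hN.noOut hy h
  obtain ⟨y, hy, h1⟩ := hu _ _ hl (by
    intro b hbB hr
    refine hb b hbB (hr.mono2 ?_ ?_ ?_)
    · intro c hc h; exact ⟨hc, fun h' => h.notMem (.inl h')⟩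
    · intro x y h1 h2 h3
      exact ⟨h3, fun h => h1.notMem (.inl h), fun h => h2.notMem (.inl h)⟩
    · intro z h1 h2; exact h1.notMem (.inr h2)) a' ha'.1
  rcases hy with rfl | hy
  · exfalso
    rcases h1.cases_tail with rfl | ⟨w, _, h2⟩
    · exact ha'.2 rfl
    · exact (hN0 h2).2 rfl
  · exact ⟨y, hy, h1⟩

theorem Gm_Gm (G : V → V → Prop) (Z : Set V) (q : V) : Gm (Gm G Z) {q} = Gm G (insert q Z) := by
  funext x y; simp [Gm]; tauto

/-- State in the construction of a safe path. -/
structure ES (G : V → V → Prop) (A B : Set V) (a : V) where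
  Z : Set V
  X : Set V
  M : V → V → Prop
  ha : a ∈ Z
  hA : ∀ z ∈ Z, z ∈ A → z = a
  hr : ∀ z ∈ Z, ReflTransGen (fun x y => G x y ∧ x ∈ Z ∧ y ∈ Z) a z
  hu : Unh (Gm G Z) (A \ {a}) B
  hw : Wave (Gm G Z) (A \ {a}) B X M
  hl : Loose (Gb (Gm G Z) (Rc (Gm G Z) (A \ {a}) X)) X B

theorem ES.notZ {G : V → V → Prop} {A B : Set V} {a : V} (s : ES G A B a) {z : V}
    (h : Rc (Gm G s.Z) (A \ {a}) s.X z) : z ∉ s.Z := by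
  cases h with
  | base h1 h2 => exact fun h => h1.2 (s.hA _ h h1.1)
  | step h1 h2 h3 => exact h2.2.2

/-- One step towards a given vertex `q`. -/
theorem ES.next {G : V → V → Prop} {A B : Set V} {a : V} (s : ES G A B a) (q : V) :
    ∃ t : ES G A B a, s.Z ⊆ t.Z ∧ (∀ z ∈ t.Z, ¬ Rc (Gm G s.Z) (A \ {a}) s.X z) ∧
      (∀ x y, s.M x y → t.M x y) ∧ (∀ x ∈ t.X, ¬ Rc (Gm G s.Z) (A \ {a}) s.X x) ∧
      (∀ x, Rc (Gm G s.Z) (A \ {a}) s.X x → Rc (Gm G t.Z) (A \ {a}) t.X x) ∧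
      ((∃ z ∈ s.Z, G z q) → q ∈ t.Z ∨ Rc (Gm G s.Z) (A \ {a}) s.X q ∨ q ∈ s.X) := by
  by_cases hq : (∃ z ∈ s.Z, G z q) ∧ ¬ Rc (Gm G s.Z) (A \ {a}) s.X q ∧ q ∉ s.X ∧ q ∉ s.Z
  · obtain ⟨⟨z, hz, hzq⟩, hqR, hqX, hqZ⟩ := hq
    have hu' := unh_delete s.hu s.hl hqR hqX
    rw [Gm_Gm] at hu'
    have eqR : ∀ X, (∀ z, Rc (Gm G s.Z) (A \ {a}) X z → z ≠ q) → ∀ x,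
        Rc (Gm G s.Z) (A \ {a}) X x → Rc (Gm G (insert q s.Z)) (A \ {a}) X x := by
      intro X hX x hx
      refine hx.mono2 (fun _ h _ => h) ?_ (fun z h => h.notMem)
      intro x y h1 h2 h3
      refine ⟨h3.1, ?_, ?_⟩
      · rintro (h | h)
        exacts [hX _ h1 h, h3.2.1 h]
      · rintro (h | h)
        exacts [hX _ h2 h, h3.2.2 h]
    have eqR' : ∀ X, ∀ x, Rc (Gm G (insert q s.Z)) (A \ {a}) X x →
        Rc (Gm G s.Z) (A \ {a}) X x := by
      intro X x hx
      refine hx.mono2 (fun _ h _ => h) ?_ (fun z h => h.notMem)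
      intro x y h1 h2 h3
      exact ⟨h3.1, fun h => h3.2.1 (.inr h), fun h => h3.2.2 (.inr h)⟩
    have hRq : ∀ z, Rc (Gm G s.Z) (A \ {a}) s.X z → z ≠ q := by rintro z h rfl; exact hqR h
    have hw' : Wave (Gm G (insert q s.Z)) (A \ {a}) B s.X s.M := by
      refine ⟨s.hw.lk.monoG ?_, fun b hb h => s.hw.blk b hb (eqR' _ _ h),
        fun x y h => eqR _ hRq _ (s.hw.pr x y h)⟩
      intro x y h1 h2
      refine ⟨h2.1, ?_, ?_⟩
      · rintro (h | h)
        exacts [hRq _ (s.hw.pr _ _ h1) h, h2.2.1 h]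
      · rintro (rfl | h)
        · exact ((s.hw.pr _ _ h1).next (s.hw.lk.sub h1)).elim hqR hqX
        · exact h2.2.2 h
    obtain ⟨X, M, h1, h2, h3, h4⟩ := maxWave hw'
    have h4' : ∀ x ∈ X, ¬ Rc (Gm G s.Z) (A \ {a}) s.X x := fun x hx h => h4 x hx (eqR _ hRq _ h)
    refine ⟨⟨insert q s.Z, X, M, .inr s.ha, ?_, ?_, hu', h1, h2⟩, Set.subset_insert _ _, ?_, h3,
      h4', ?_, fun _ => .inl (.inl rfl)⟩
    · rintro z (rfl | hz) hA
      · by_contra hne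
        exact (Rc.start (G := Gm G s.Z) (X := s.X) (show z ∈ A \ {a} from ⟨hA, hne⟩)).elim hqR hqX
      · exact s.hA z hz hA
    · have hold : ∀ z ∈ s.Z, ReflTransGen
          (fun x y => G x y ∧ x ∈ insert q s.Z ∧ y ∈ insert q s.Z) a z := fun z hz =>
        (s.hr z hz).mn fun _ _ h => ⟨h.1, .inr h.2.1, .inr h.2.2⟩
      rintro z' (rfl | hz')
      · exact (hold z hz).tail ⟨hzq, .inr hz, .inl rfl⟩
      · exact hold _ hz'
    · rintro z (rfl | hz) h
      · exact hqR h
      · exact s.notZ h hz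
    · intro x hx
      refine rc_sub (fun y hy h => h4 y hy h) (eqR _ hRq _ hx)
  · refine ⟨s, subset_rfl, fun z hz h => s.notZ h hz, fun _ _ h => h, fun x hx h => h.notMem hx,
      fun _ h => h, fun h => ?_⟩
    by_contra hcon
    push Not at hcon
    exact hq ⟨h, hcon.2.1, hcon.2.2, hcon.1⟩

/-- A set with a path from `a` to `B`, whose deletion leaves an unhindered rest. -/
theorem safe_path [Countable V] {G : V → V → Prop} {A B : Set V} (hu : Unh G A B) {a : V}
    (ha : a ∈ A) : ∃ Z : Set V, a ∈ Z ∧ (∀ z ∈ Z, z ∈ A → z = a) ∧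
      (∀ z ∈ Z, ReflTransGen (fun x y => G x y ∧ x ∈ Z ∧ y ∈ Z) a z) ∧
      Unh (Gm G Z) (A \ {a}) B ∧ ∃ b ∈ Z, b ∈ B := by
  by_contra hcon
  have hZB : ∀ s : ES G A B a, ∀ z ∈ s.Z, z ∉ B := fun s z hz hb =>
    hcon ⟨s.Z, s.ha, s.hA, s.hr, s.hu, z, hz, hb⟩
  obtain ⟨s0⟩ : Nonempty (ES G A B a) := by
    obtain ⟨X, M, h1, h2, _, _⟩ := maxWave (Wave.triv (Gm G {a}) (A \ {a}) B)
    exact ⟨⟨{a}, X, M, rfl, fun z hz _ => hz, by rintro z rfl; exact .refl,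
      unh_start hu ha, h1, h2⟩⟩
  have : Nonempty V := ⟨a⟩
  obtain ⟨e, he⟩ := exists_surjective_nat V
  let nx : ℕ → ES G A B a → ES G A B a := fun n s => (s.next (e n.unpair.1)).choose
  let s : ℕ → ES G A B a := fun n => Nat.rec s0 nx n
  have hs : ∀ n, _ := fun n => ((s n).next (e n.unpair.1)).choose_spec
  have hsn : ∀ n, ((s n).next (e n.unpair.1)).choose = s (n+1) := fun n => rfl
  let R : ℕ → V → Prop := fun n => Rc (Gm G (s n).Z) (A \ {a}) (s n).X
  have hZ1 : ∀ n, (s n).Z ⊆ (s (n+1)).Z := fun n => (hs n).1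
  have hZ2 : ∀ n, ∀ z ∈ (s (n+1)).Z, ¬ R n z := fun n => (hs n).2.1
  have hM : ∀ n x y, (s n).M x y → (s (n+1)).M x y := fun n => (hs n).2.2.1
  have hX : ∀ n, ∀ x ∈ (s (n+1)).X, ¬ R n x := fun n => (hs n).2.2.2.1
  have hR : ∀ n x, R n x → R (n+1) x := fun n => (hs n).2.2.2.2.1
  have hF : ∀ n, (∃ z ∈ (s n).Z, G z (e n.unpair.1)) → e n.unpair.1 ∈ (s (n+1)).Z ∨
    R n (e n.unpair.1) ∨ e n.unpair.1 ∈ (s n).X := fun n => (hs n).2.2.2.2.2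
  have mZ : ∀ {n m}, n ≤ m → (s n).Z ⊆ (s m).Z := fun h => monotone_nat_of_le_succ hZ1 h
  have mM : ∀ {n m}, n ≤ m → ∀ x y, (s n).M x y → (s m).M x y := by
    intro n m h x y
    induction h with
    | refl => exact id
    | step _ ih => exact fun h => hM _ _ _ (ih h)
  have mR : ∀ {n m}, n ≤ m → ∀ x, R n x → R m x := by
    intro n m h x
    induction h with
    | refl => exact id
    | step _ ih => exact fun h => hR _ _ (ih h)
  have mX : ∀ {n m}, n ≤ m → ∀ x ∈ (s m).X, ¬ R n x := by
    intro n m h x hx hr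
    exact (mR h x hr).notMem hx
  have RZ : ∀ n m x, R n x → x ∉ (s m).Z := by
    intro n m x hr hz
    have h1 := mR (le_max_left n m) x hr
    exact (s (max n m)).notZ h1 (mZ (le_max_right n m) hz)
  let Y : Set V := {y | ∃ n, ∀ m, n ≤ m → y ∈ (s m).X}
  let M : V → V → Prop := fun x y => ∃ n, (s n).M x y
  have notA : ∀ n x y, (s n).M x y → y ≠ a := by
    rintro n x y h rfl
    exact ((s n).hw.lk.sub h).2.2 (s n).ha
  have hlk : Lk G A Y M := by
    refine ⟨?_, ?_, ?_, ?_, ?_, ?_⟩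
    · rintro x y ⟨n, h⟩; exact ((s n).hw.lk.sub h).1
    · rintro x y ⟨n, h⟩ hA; exact (s n).hw.lk.inA h ⟨hA, notA n x y h⟩
    · rintro x y z ⟨n, h⟩ ⟨m, h'⟩
      exact (s (max n m)).hw.lk.inj (mM (le_max_left n m) _ _ h) (mM (le_max_right n m) _ _ h')
    · rintro x y z ⟨n, h⟩ ⟨m, h'⟩
      exact (s (max n m)).hw.lk.fn (mM (le_max_left n m) _ _ h) (mM (le_max_right n m) _ _ h')
    · rintro y ⟨n, h⟩
      obtain ⟨c, hc, h1⟩ := (s n).hw.lk.tgt (h n le_rfl)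
      exact ⟨c, hc.1, h1.mn fun _ _ h => ⟨n, h⟩⟩
    · rintro y z ⟨n, h⟩ ⟨m, h'⟩
      exact (s (max n m)).hw.lk.noOut (h _ (le_max_left n m)) (mM (le_max_right n m) _ _ h')
  have out : ∀ y, y ∉ Y → ∀ n, ∃ m, n ≤ m ∧ y ∉ (s m).X := by
    intro y hy n
    by_contra hc
    push Not at hc
    exact hy ⟨n, hc⟩
  have hblk : Blk G A Y B := by
    intro b hb hr
    have key : ∀ z, Rc G A Y z → (∃ n, z ∈ (s n).Z) ∨ ∃ n, R n z := by
      intro z hz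
      induction hz with
      | @base c hc h1 =>
        by_cases hca : c = a
        · subst hca; exact .inl ⟨0, (s 0).ha⟩
        · obtain ⟨m, _, h2⟩ := out c h1 0
          exact .inr ⟨m, .base ⟨hc, hca⟩ h2⟩
      | @step x y _ h2 h3 ih =>
        by_cases hyZ : ∃ n, y ∈ (s n).Z
        · exact .inl hyZ
        push Not at hyZ
        refine .inr ?_
        rcases ih with ⟨n, hn⟩ | ⟨n, hn⟩
        · obtain ⟨k, rfl⟩ := he y
          have := hF (Nat.pair k n) ⟨x, mZ (Nat.right_le_pair k n) hn, by simpa using h2⟩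
          simp only [Nat.unpair_pair] at this
          rcases this with h | h | h
          · exact (hyZ (Nat.pair k n + 1) h).elim
          · exact ⟨_, h⟩
          · obtain ⟨m, hm, h4⟩ := out _ h3 (Nat.pair k n)
            refine ⟨m, ?_⟩
            -- the vertex was on the wave, so it is strictly inside later
            have hall : ∀ m, Nat.pair k n ≤ m → R m (e k) ∨ e k ∈ (s m).X := by
              intro m hm
              induction hm with
              | refl => exact .inr h
              | @step m hm ih =>
                rcases ih with h5 | h5
                · exact .inl (hR _ _ h5)
                · rcases (s m).hw.tgt_reach h5 with h6 | ⟨w, h6, h7⟩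
                  · exact Rc.start h6
                  · exact (hR _ _ h6).next ⟨h7.1, fun h => RZ m (m+1) w h6 h, hyZ (m+1)⟩
            exact (hall m hm).resolve_right h4
        · obtain ⟨m, hm, h4⟩ := out y h3 n
          exact ⟨m, .step (mR hm _ hn) ⟨h2, RZ n m x hn, hyZ m⟩ h4⟩
    rcases key b hr with ⟨n, hn⟩ | ⟨n, hn⟩
    · exact hZB (s n) b hn hb
    · exact (s n).hw.blk b hb hn
  obtain ⟨y, ⟨n, hy⟩, h1⟩ := hu Y M hlk hblk a ha
  rcases h1.cases_head with rfl | ⟨c, ⟨m, h2⟩, _⟩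
  · obtain ⟨c, hc, h3⟩ := (s n).hw.lk.tgt (hy n le_rfl)
    rcases h3.cases_tail with rfl | ⟨w, _, h4⟩
    · exact hc.2 rfl
    · exact notA n _ _ h4 rfl
  · exact ((s m).hw.lk.sub h2).2.1 (s m).ha

end FL

/-! Part 5 -/
namespace FL
open Relation

/-- A walk contains a path. -/
theorem pathLk {G : V → V → Prop} {a b : V} (h : ReflTransGen G a b) : Lkb G {a} {b} := by
  have h0 : Lk G {a} ∅ (fun _ _ => False) :=
    ⟨False.elim, False.elim, False.elim, False.elim, fun h => h.elim, fun h => h.elim⟩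
  rcases AL h0 {b} with ⟨q, hq, h1⟩ | ⟨U, hU, h1⟩
  · obtain rfl : q = b := hq
    simpa using h1
  · exfalso
    have hU0 : U = ∅ := by
      ext u; simp only [Set.mem_empty_iff_false, iff_false]
      intro hu; obtain ⟨-, y, hy, _⟩ := hU.on u hu; exact hy
    subst hU0
    refine h1 b rfl ?_
    clear h1
    induction h with
    | refl => exact .base rfl (by simp)
    | tail _ h2 ih => exact .step ih h2 (by simp)

theorem em_step [Countable V] {G : V → V → Prop} {A B : Set V} (a : V)
    (s : {Z : Set V // Unh (Gm G Z) (A \ Z) B}) :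
    ∃ t : {Z : Set V // Unh (Gm G Z) (A \ Z) B}, s.1 ⊆ t.1 ∧
      (¬ (a ∈ A ∧ a ∉ s.1) → t = s) ∧
      ((a ∈ A ∧ a ∉ s.1) → a ∈ t.1 \ s.1 ∧ (∀ z ∈ t.1 \ s.1, z ∈ A → z = a) ∧
        ∃ b ∈ B, b ∈ t.1 \ s.1 ∧ Lkb (fun x y => G x y ∧ x ∈ t.1 \ s.1 ∧ y ∈ t.1 \ s.1) {a} {b}) := by
  by_cases ha : a ∈ A ∧ a ∉ s.1
  · obtain ⟨Z, h1, h2, h3, h4, b, h5, h6⟩ := safe_path s.2 (a := a) ha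
    have hd : ∀ z ∈ Z, z ∉ s.1 := by
      intro z hz
      rcases (h3 z hz).cases_tail with rfl | ⟨w, _, h7⟩
      · exact ha.2
      · exact h7.1.2.2
    have e1 : (s.1 ∪ Z) \ s.1 = Z := by
      ext z; simp only [Set.mem_sdiff, Set.mem_union]
      constructor
      · rintro ⟨h | h, h'⟩
        exacts [absurd h h', h]
      · exact fun h => ⟨.inr h, hd z h⟩
    have e2 : Gm (Gm G s.1) Z = Gm G (s.1 ∪ Z) := by
      funext x y; simp [Gm]; tauto
    have e3 : (A \ s.1) \ {a} = A \ (s.1 ∪ Z) := by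
      ext z; simp only [Set.mem_sdiff, Set.mem_union, Set.mem_singleton_iff]
      constructor
      · rintro ⟨⟨h7, h8⟩, h9⟩
        exact ⟨h7, fun h => h.elim h8 fun h => h9 (h2 z h ⟨h7, h8⟩)⟩
      · rintro ⟨h7, h8⟩
        refine ⟨⟨h7, fun h => h8 (.inl h)⟩, ?_⟩
        rintro rfl; exact h8 (.inr h1)
    rw [e2, e3] at h4
    refine ⟨⟨s.1 ∪ Z, h4⟩, Set.subset_union_left, fun h => absurd ha h, fun _ => ?_⟩
    simp only [e1]
    refine ⟨h1, fun z hz hA => h2 z hz ⟨hA, hd z hz⟩, b, h6, h5, pathLk ?_⟩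
    exact (h3 b h5).mn fun _ _ h => ⟨h.1.1, h.2⟩
  · exact ⟨s, subset_rfl, fun _ => rfl, fun h => absurd h ha⟩

/-- An unhindered web has a linkage (countable Erdős–Menger). -/
theorem em_linkage [Countable V] {G : V → V → Prop} {A B : Set V} (hu : Unh G A B) :
    ∃ Y M, Lk G A Y M ∧ Y ⊆ B ∧ ∀ a ∈ A, ∃ y ∈ Y, ReflTransGen M a y := by
  by_cases hV : Nonempty V
  swap
  · refine ⟨∅, fun _ _ => False, ⟨False.elim, False.elim, False.elim, False.elim, fun h => h.elim,
      fun h => h.elim⟩, by simp, fun a => (hV ⟨a⟩).elim⟩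
  obtain ⟨e, he⟩ := exists_surjective_nat V
  let St := {Z : Set V // Unh (Gm G Z) (A \ Z) B}
  obtain ⟨s0, hs0⟩ : ∃ s0 : St, s0.1 = ∅ := ⟨⟨∅, by
    have : Gm G ∅ = G := by funext x y; simp [Gm]
    rw [this, Set.sdiff_empty]; exact hu⟩, rfl⟩
  obtain ⟨s, hs00, hs⟩ : ∃ s : ℕ → St, (s 0).1 = ∅ ∧ ∀ n, (s n).1 ⊆ (s (n+1)).1 ∧
      (¬ (e n ∈ A ∧ e n ∉ (s n).1) → s (n+1) = s n) ∧
      ((e n ∈ A ∧ e n ∉ (s n).1) → e n ∈ (s (n+1)).1 \ (s n).1 ∧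
        (∀ z ∈ (s (n+1)).1 \ (s n).1, z ∈ A → z = e n) ∧
        ∃ b ∈ B, b ∈ (s (n+1)).1 \ (s n).1 ∧
        Lkb (fun x y => G x y ∧ x ∈ (s (n+1)).1 \ (s n).1 ∧ y ∈ (s (n+1)).1 \ (s n).1) {e n} {b}) :=
    ⟨fun n => Nat.rec s0 (fun n s => (em_step (e n) s).choose) n, hs0,
      fun n => (em_step (e n) _).choose_spec⟩
  let act : ℕ → Prop := fun n => e n ∈ A ∧ e n ∉ (s n).1
  let D : ℕ → Set V := fun n => (s (n+1)).1 \ (s n).1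
  have mono : ∀ {n m}, n ≤ m → (s n).1 ⊆ (s m).1 := fun h =>
    monotone_nat_of_le_succ (f := fun n => (s n).1) (fun n => (hs n).1) h
  have dis : ∀ n m x, x ∈ D n → x ∈ D m → n = m := by
    intro n m x h1 h2
    rcases lt_trichotomy n m with h | h | h
    · exact (h2.2 (mono h h1.1)).elim
    · exact h
    · exact (h1.2 (mono h h2.1)).elim
  have hsp : ∀ n, ∃ b M, act n → b ∈ B ∧ b ∈ D n ∧
      Lk (fun x y => G x y ∧ x ∈ D n ∧ y ∈ D n) {e n} {b} M := by
    intro n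
    by_cases h : act n
    · obtain ⟨-, -, b, h1, h2, M, h3⟩ := (hs n).2.2 h
      exact ⟨b, M, fun _ => ⟨h1, h2, h3⟩⟩
    · exact ⟨e n, fun _ _ => False, fun h' => absurd h' h⟩
  choose b M hbM using hsp
  have hD : ∀ n, act n → ∀ z ∈ D n, z ∈ A → z = e n := fun n h => ((hs n).2.2 h).2.1
  have hDM : ∀ n x y, act n → M n x y → x ∈ D n ∧ y ∈ D n := fun n x y h h' =>
    ((hbM n h).2.2.sub h').2
  refine ⟨{y | ∃ n, act n ∧ y = b n}, fun x y => ∃ n, act n ∧ M n x y, ⟨?_, ?_, ?_, ?_, ?_, ?_⟩,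
    ?_, ?_⟩
  · rintro x y ⟨n, hn, h⟩; exact ((hbM n hn).2.2.sub h).1
  · rintro x y ⟨n, hn, h⟩ hA
    exact (hbM n hn).2.2.inA h (hD n hn y (hDM n x y hn h).2 hA)
  · rintro x y z ⟨n, hn, h⟩ ⟨m, hm, h'⟩
    obtain rfl := dis n m z (hDM _ _ _ hn h).2 (hDM _ _ _ hm h').2
    exact (hbM n hn).2.2.inj h h'
  · rintro x y z ⟨n, hn, h⟩ ⟨m, hm, h'⟩
    obtain rfl := dis n m x (hDM _ _ _ hn h).1 (hDM _ _ _ hm h').1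
    exact (hbM n hn).2.2.fn h h'
  · rintro y ⟨n, hn, rfl⟩
    obtain ⟨c, rfl, h1⟩ := (hbM n hn).2.2.tgt rfl
    exact ⟨_, hn.1, h1.mn fun _ _ h => ⟨n, hn, h⟩⟩
  · rintro y z ⟨n, hn, rfl⟩ ⟨m, hm, h'⟩
    obtain rfl := dis n m _ (hbM n hn).2.1 (hDM _ _ _ hm h').1
    exact (hbM n hn).2.2.noOut rfl h'
  · rintro y ⟨n, hn, rfl⟩; exact (hbM n hn).1
  · intro a ha
    have key : ∀ n, a ∈ (s n).1 → (∃ m, act m ∧ e m = a) ∨ a ∈ (s 0).1 := by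
      intro n
      induction n with
      | zero => exact .inr
      | succ n ih =>
        intro h
        by_cases h1 : a ∈ (s n).1
        · exact ih h1
        · by_cases h2 : act n
          · exact .inl ⟨n, h2, (hD n h2 a ⟨h, h1⟩ ha).symm⟩
          · rw [(hs n).2.1 h2] at h; exact absurd h h1
    rw [hs00] at key
    obtain ⟨m, hm, rfl⟩ : ∃ m, act m ∧ e m = a := by
      obtain ⟨k, rfl⟩ := he a
      by_cases hk : act k
      · exact ⟨k, hk, rfl⟩
      · have : e k ∈ (s k).1 := by by_contra h; exact hk ⟨ha, h⟩
        exact (key k this).resolve_right (by simp)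
    obtain ⟨c, rfl, h1⟩ := (hbM m hm).2.2.tgt rfl
    exact ⟨b m, ⟨m, hm, rfl⟩, h1.mn fun _ _ h => ⟨m, hm, h⟩⟩

end FL

/-! Part 6 -/
namespace FL
open Relation

/-- The digraph in which paths to `z` are considered: `z` deleted, no edges into `A`. -/
def Gz (A : Set V) (Q : V → V → Prop) (z x y : V) : Prop := Q x y ∧ x ≠ z ∧ y ≠ z ∧ y ∉ A

/-- Reversed relation. -/
def rv (G : V → V → Prop) (x y : V) : Prop := G y x

theorem rv_rtg {G : V → V → Prop} {x y : V} (h : ReflTransGen G x y) :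
    ReflTransGen (fun a b => G b a) y x := by
  induction h with
  | refl => exact .refl
  | tail _ h2 ih => exact ih.head h2

/-- `x → z` is spanned in `L`. -/
def Sp (A : Set V) (L : V → V → Prop) (x z : V) : Prop :=
  ∃ S X0 : Set V, ∃ K : V → V → Prop, (∀ x0 ∈ X0, L x0 z) ∧ (∀ a b, K a b → Gz A L z a b) ∧
    (∀ a b c, K a c → K b c → a = b) ∧ (∀ a b c, K a b → K a c → b = c) ∧
    (∀ s ∈ S, ∃ x0 ∈ X0, ReflTransGen K s x0) ∧ (∀ a s, s ∈ S → ¬ K a s) ∧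
    (∀ x0 ∈ X0, ¬ Rc (Gz A L z) (A \ {z}) S x0) ∧ ¬ Rc (Gz A L z) (A \ {z}) S x

theorem Gz.rc_ne {A : Set V} {Q : V → V → Prop} {z : V} {T : Set V} {x : V}
    (h : Rc (Gz A Q z) (A \ {z}) T x) : x ≠ z := by
  cases h with
  | base h _ => exact h.2
  | step _ h _ => exact h.2.2.1

theorem uncross {A : Set V} {L : V → V → Prop} {z : V} {T : Set V} {x z' : V}
    (hb : Blk (rv (Gz A L z)) {w | L w z} T (A \ {z}))
    (hl : Loose (Gb (rv (Gz A L z)) (Rc (rv (Gz A L z)) {w | L w z} T)) T (A \ {z}))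
    (hx : Rc (Gz A L z) (A \ {z}) T x) (hs : Sp A L x z')
    (hz' : z' = z ∨ (¬ Rc (Gz A L z) (A \ {z}) T z' ∧ z' ∉ T)) : False := by
  obtain ⟨S, X0, K, hX0, hK, hinj, hfn, hr, hin, hbX, hbx⟩ := hs
  set AT := Rc (Gz A L z) (A \ {z}) T with hAT
  set BT := Rc (rv (Gz A L z)) {w | L w z} T with hBT
  set RS := Rc (Gz A L z') (A \ {z'}) S with hRS
  have disj : ∀ w, AT w → ¬ BT w := by
    intro w h
    induction h with
    | base h _ => exact hb _ h
    | step h1 h2 h3 ih => exact fun h => ih (h.step h2 h1.notMem)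
  have ATz : ∀ w, AT w → ¬ L w z := fun w h h' => disj w h (.base h' h.notMem)
  have ATn : ∀ w y, AT w → L w y → y ∉ A → AT y ∨ y ∈ T := fun w y h h1 h2 =>
    h.next ⟨h1, Gz.rc_ne h, fun h3 => ATz w h (h3 ▸ h1), h2⟩
  have ATz' : ∀ w, AT w → w ≠ z' := by
    rintro w h rfl
    rcases hz' with h' | h'
    · exact Gz.rc_ne h h'
    · exact h'.1 h
  have hX0' : ∀ w ∈ X0, ¬ AT w := by
    intro w hw h
    have h1 := hX0 w hw
    rcases hz' with rfl | h'
    · exact ATz w h h1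
    · have hne : z' ≠ z := fun h2 => ATz w h (h2 ▸ h1)
      by_cases hA : z' ∈ A
      · rcases Rc.start (G := Gz A L z) (A := A \ {z}) (X := T) ⟨hA, hne⟩ with h2 | h2
        exacts [h'.1 h2, h'.2 h2]
      · rcases ATn w z' h h1 hA with h2 | h2
        exacts [h'.1 h2, h'.2 h2]
  have hne : ∃ s ∈ S, AT s := by
    by_contra hc
    push Not at hc
    have : Rc (Gz A L z') (A \ {z'}) S x :=
      Rc.mono2 (G := Gz A L z) (A := A \ {z}) (X := T) (G' := Gz A L z')
        (A' := A \ {z'}) (X' := S) (fun a ha h => ⟨ha.1, ATz' a h⟩)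
      (fun x y h1 h2 h => ⟨h.1, ATz' x h1, ATz' y h2, h.2.2.2⟩) (fun z h1 h2 => hc z h2 h1) hx
    exact hbx this
  let T' : Set V := {w | (w ∈ S ∧ AT w) ∨ (w ∈ T ∧ (RS w ∨ w ∈ S))}
  have hKS : ∀ a b, K a b → (∃ x0 ∈ X0, ReflTransGen K b x0) → ¬ RS b ∧ b ∉ S := by
    rintro a b h ⟨x0, hx0, h1⟩
    refine ⟨?_, fun h2 => hin _ _ h2 h⟩
    clear h
    induction h1 using ReflTransGen.head_induction_on with
    | refl => exact hbX _ hx0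
    | head h2 _ ih => exact fun h => ih (h.step (hK _ _ h2) fun h3 => hin _ _ h3 h2)
  let M' : V → V → Prop := fun a b => K b a ∧ AT b ∧ ∃ x0 ∈ X0, ReflTransGen K a x0
  have hlk : Lk (Gb (rv (Gz A L z)) BT) T T' M' := by
    refine ⟨?_, ?_, ?_, ?_, ?_, ?_⟩
    · rintro a b ⟨h1, h2, h3⟩
      have h4 := hK _ _ h1
      have h5 : Gz A L z b a :=
        ⟨h4.1, Gz.rc_ne h2, fun h3 => ATz b h2 (h3 ▸ h4.1), h4.2.2.2⟩
      exact ⟨h5, fun h => disj b h2 (h.step h5 h2.notMem), disj b h2⟩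
    · rintro a b ⟨h1, h2, h3⟩; exact h2.notMem
    · rintro a b c ⟨h1, -⟩ ⟨h2, -⟩; exact hfn _ _ _ h1 h2
    · rintro a b c ⟨h1, -⟩ ⟨h2, -⟩; exact hinj _ _ _ h1 h2
    · rintro y (⟨h1, h2⟩ | ⟨h1, -⟩)
      · obtain ⟨x0, hx0, h3⟩ := hr y h1
        induction h3 using ReflTransGen.head_induction_on with
        | refl => exact absurd h2 (hX0' _ hx0)
        | @head a c h4 h5 ih =>
          have : ∀ w, ReflTransGen K w x0 → AT w → ∃ t ∈ T, ReflTransGen M' t w := by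
            intro w hw
            induction hw using ReflTransGen.head_induction_on with
            | refl => exact fun h => absurd h (hX0' _ hx0)
            | @head a c h6 h7 ih2 =>
              intro ha
              have hM : M' c a := ⟨h6, ha, x0, hx0, h7⟩
              rcases ATn a c ha (hK _ _ h6).1 (hK _ _ h6).2.2.2 with h8 | h8
              · obtain ⟨t, ht, h9⟩ := ih2 h8
                exact ⟨t, ht, h9.tail hM⟩
              · exact ⟨c, h8, .single hM⟩
          exact this a (h5.head h4) h2
      · exact ⟨y, h1, .refl⟩
    · rintro y w (⟨h1, h2⟩ | ⟨h1, h2⟩) ⟨h3, h4, h5⟩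
      · exact hin _ _ h1 h3
      · have := hKS _ _ h3 h5
        exact h2.elim this.1 this.2
  have hblk : Blk (Gb (rv (Gz A L z)) BT) T T' (A \ {z}) := by
    have inv : ∀ w, Rc (Gb (rv (Gz A L z)) BT) T T' w → AT w ∨ w ∈ T → ¬ RS w ∧ w ∉ S := by
      intro w hw
      induction hw with
      | base h1 h2 => exact fun _ => ⟨fun h => h2 (.inr ⟨h1, .inl h⟩), fun h => h2 (.inr ⟨h1, .inr h⟩)⟩
      | @step x y h1 h2 h3 ih =>
        rintro (h4 | h4)
        · have hyS : y ∉ S := fun h => h3 (.inl ⟨h, h4⟩)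
          refine ⟨fun h5 => ?_, hyS⟩
          have h6 : Gz A L z y x := h2.1
          have h7 : AT x ∨ x ∈ T := h4.next h6
          have hxz : x ≠ z' := by
            rintro rfl
            rcases hz' with h' | h'
            · exact h6.2.2.1 h'
            · exact h7.elim h'.1 h'.2
          have h8 : RS x ∨ x ∈ S := h5.next ⟨h6.1, ATz' y h4, hxz, h6.2.2.2⟩
          exact h8.elim (ih h7).1 (ih h7).2
        · exact ⟨fun h => h3 (.inr ⟨h4, .inl h⟩), fun h => h3 (.inr ⟨h4, .inr h⟩)⟩
    intro a ha h
    have h1 : AT a ∨ a ∈ T := Rc.start ha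
    have haz : a ≠ z' := by
      rintro rfl
      rcases hz' with h' | h'
      · exact ha.2 h'
      · exact h1.elim h'.1 h'.2
    have h2 : RS a ∨ a ∈ S := Rc.start ⟨ha.1, haz⟩
    exact h2.elim (inv a h h1).1 (inv a h h1).2
  have h1 := hl T' ⟨M', hlk⟩ hblk
  obtain ⟨s, hs, hs'⟩ := hne
  exact hs'.notMem (hlk.sub_of_sup h1 (.inl ⟨hs, hs'⟩))

/-- Largeness lemma. -/
theorem LL [Countable V] {A : Set V} {L D : V → V → Prop} (hsp : ∀ x z, D x z → ¬ L x z → Sp A L x z)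
    (z : V) : ∃ (T D0 : Set V) (M1 M2 : V → V → Prop),
      (∀ x, D x z → ¬ Rc (Gz A D z) (A \ {z}) T x) ∧
      Lk (Gz A L z) (A \ {z}) T M1 ∧ (∀ d ∈ D0, L d z) ∧
      Lk (Gb (Gz A L z) (Rc (Gz A L z) (A \ {z}) T)) T D0 M2 ∧
      (∀ t ∈ T, ∃ y ∈ D0, ReflTransGen M2 t y) := by
  obtain ⟨T, M, hw, hl, -, -⟩ := maxWave (Wave.triv (rv (Gz A L z)) {w | L w z} (A \ {z}))
  have hu : Unh (Gb (rv (Gz A L z)) (Rc (rv (Gz A L z)) {w | L w z} T)) T (A \ {z}) := by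
    intro Y M h1 h2 a ha
    exact ⟨a, hl Y ⟨M, h1⟩ h2 ha, .refl⟩
  obtain ⟨Y, N, h1, hY, h2⟩ := em_linkage hu
  have disj : ∀ w, Rc (Gz A L z) (A \ {z}) T w → ¬ Rc (rv (Gz A L z)) {w | L w z} T w := by
    intro w h
    induction h with
    | base h _ => exact hw.blk _ h
    | step h1 h2 h3 ih => exact fun h => ih (h.step h2 h1.notMem)
  refine ⟨T, {n | L n z ∧ ∃ t ∈ T, ReflTransGen M n t}, rv N, rv M, ?_, ?_, fun d h => h.1, ?_, ?_⟩
  · have key : ∀ x z', Rc (Gz A L z) (A \ {z}) T x → D x z' →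
        (z' = z ∨ (¬ Rc (Gz A L z) (A \ {z}) T z' ∧ z' ∉ T ∧ z' ∉ A)) → False := by
      intro x z' h3 h4 h5
      by_cases h6 : L x z'
      · rcases h5 with rfl | ⟨h5, h7, h8⟩
        · exact disj x h3 (.base h6 h3.notMem)
        · by_cases h9 : z' = z
          · subst h9
            exact disj x h3 (.base h6 h3.notMem)
          · exact h5 (h3.step ⟨h6, Gz.rc_ne h3, h9, h8⟩ h7)
      · exact uncross hw.blk hl h3 (hsp _ _ h4 h6) (h5.imp_right fun h => ⟨h.1, h.2.1⟩)
    have sub : ∀ x, Rc (Gz A D z) (A \ {z}) T x → Rc (Gz A L z) (A \ {z}) T x := by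
      intro x h
      induction h with
      | base h h' => exact .base h h'
      | @step x y h3 h4 h5 ih =>
        by_contra hc
        exact key x y ih h4.1 (.inr ⟨hc, h5, h4.2.2.2⟩)
    exact fun x h3 h4 => key x z (sub x h4) h3 (.inl rfl)
  · refine ⟨fun h => (h1.sub h).1, fun h h' => (h1.sub h).1.2.2.2 h'.1, fun h h' => h1.fn h h',
      fun h h' => h1.inj h h', fun h => ?_, fun h h' => h1.inA h' h⟩
    obtain ⟨y, hy, h3⟩ := h2 _ h
    exact ⟨y, hY hy, rv_rtg h3⟩
  · have hst : ∀ x y, M x y → Rc (rv (Gz A L z)) {w | L w z} T x ∧ (Rc (rv (Gz A L z)) {w | L w z} T y ∨ y ∈ T) :=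
      fun x y h => ⟨hw.pr _ _ h, (hw.pr _ _ h).next (hw.lk.sub h)⟩
    refine ⟨fun {x y} h => ?_, fun {x y} h h' => ?_, fun h h' => hw.lk.fn h h',
      fun h h' => hw.lk.inj h h', fun h => ?_, fun h h' => hw.lk.inA h' h.1⟩
    · have h3 := hst _ _ h
      refine ⟨hw.lk.sub h, fun h4 => ?_, fun h4 => disj _ h4 h3.1⟩
      exact h3.2.elim (disj _ h4) h4.notMem
    · exact (hst _ _ h).1.notMem h'
    · obtain ⟨-, t, ht, h3⟩ := h
      exact ⟨t, ht, rv_rtg h3⟩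
  · intro t ht
    obtain ⟨n, hn, h3⟩ := hw.lk.tgt ht
    exact ⟨n, ⟨hn, t, ht, h3⟩, rv_rtg h3⟩

end FL

/-! Part 7 -/
namespace FL
open Relation

def Ln (A : Set V) (Q : V → V → Prop) (z : V) (X : Set V) : Prop := Lkb (Gz A Q z) (A \ {z}) X

theorem Lkb.mono {G G' : V → V → Prop} {A Y : Set V} (h : Lkb G A Y) (hG : ∀ x y, G x y → G' x y) :
    Lkb G' A Y := h.imp fun _ h => h.monoG fun _ _ _ => hG _ _

theorem Ln.mono {A : Set V} {Q Q' : V → V → Prop} {z : V} {X : Set V} (h : Ln A Q z X)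
    (hQ : ∀ x y, y ≠ z → Q x y → Q' x y) : Ln A Q' z X :=
  Lkb.mono h fun x y h => ⟨hQ x y h.2.2.1 h.1, h.2⟩

theorem Ln.subset {A : Set V} {Q : V → V → Prop} {z : V} {X X' : Set V} (h : Ln A Q z X)
    (hX : X' ⊆ X) : Ln A Q z X' := Lkb.subset h hX

theorem Sp_of_fail {A : Set V} {Q : V → V → Prop} {x z : V} {X : Set V} (hX : ∀ y ∈ X, Q y z)
    (h : Ln A Q z X) (hn : ¬ Ln A Q z (insert x X)) : Sp A Q x z := by
  obtain ⟨M, hM⟩ := h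
  rcases AL hM {x} with ⟨q, rfl, hq⟩ | ⟨U, hU, hx⟩
  · exact absurd hq hn
  · refine ⟨U, X, fun a b => M a b ∧ ∃ s ∈ U, ReflTransGen M s a, hX, fun a b h => hM.sub h.1,
      fun a b c h h' => hM.inj h.1 h'.1, fun a b c h h' => hM.fn h.1 h'.1, ?_, ?_, hU.blk, hx x rfl⟩
    · intro s hs
      obtain ⟨-, y, hy, h⟩ := hU.on s hs
      refine ⟨y, hy, ?_⟩
      clear hy
      induction h with
      | refl => exact .refl
      | tail h1 h2 ih => exact ih.tail ⟨h2, s, hs, h1⟩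
    · rintro a s hs ⟨h1, s', hs', h2⟩
      exact hU.anti s' hs' s hs (TransGen.tail' h2 h1)

/-- `F`-quasi-flames. -/
def QF (A : Set V) (F Q : V → V → Prop) : Prop :=
  F ≤ Q ∧ ∀ z X, (∀ x ∈ X, Q x z) → (X \ {x | F x z}).Finite → Ln A Q z X

theorem QF.max {A : Set V} {F Q0 D : V → V → Prop} (h : QF A F Q0) (hD : Q0 ≤ D) :
    ∃ Q, Q0 ≤ Q ∧ Q ≤ D ∧ QF A F Q ∧ ∀ x z, D x z → ¬ Q x z → Sp A Q x z := by
  obtain ⟨Q, hQ0, hm⟩ := zorn_le_nonempty₀ {Q | Q ≤ D ∧ QF A F Q} (by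
    rintro c hc hch Q1 hQ1
    refine ⟨fun x y => ∃ Q ∈ c, Q x y, ⟨?_, ?_, ?_⟩, ?_⟩
    · rintro x y ⟨Q, hQ, h⟩; exact (hc hQ).1 x y h
    · intro x y h; exact ⟨Q1, hQ1, (hc hQ1).2.1 x y h⟩
    · intro z X hX hf
      obtain ⟨Q, hQ, h1⟩ : ∃ Q ∈ c, ∀ x ∈ X \ {x | F x z}, Q x z := by
        have : ∀ X' : Set V, X'.Finite → X' ⊆ X → ∃ Q ∈ c, ∀ x ∈ X', Q x z := by
          intro X' hf'
          induction X', hf' using Set.Finite.induction_on with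
          | empty => exact fun _ => ⟨Q1, hQ1, by simp⟩
          | @insert a s _ _ ih =>
            intro hs
            obtain ⟨Q, hQ, h1⟩ := ih fun x hx => hs (.inr hx)
            obtain ⟨Q', hQ', h2⟩ := hX a (hs (.inl rfl))
            rcases hch.total hQ hQ' with h3 | h3
            · refine ⟨Q', hQ', ?_⟩
              rintro x (rfl | hx)
              exacts [h2, h3 _ _ (h1 x hx)]
            · refine ⟨Q, hQ, ?_⟩
              rintro x (rfl | hx)
              exacts [h3 _ _ h2, h1 x hx]
        exact this _ hf Set.sdiff_subset
      have h2 : Ln A Q z X := (hc hQ).2.2 z X (fun x hx => by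
        by_cases hF : F x z
        · exact (hc hQ).2.1 _ _ hF
        · exact h1 x ⟨hx, hF⟩) hf
      exact h2.mono fun x y _ h => ⟨Q, hQ, h⟩
    · intro Q hQ x y h; exact ⟨Q, hQ, h⟩) Q0 ⟨hD, h⟩
  refine ⟨Q, hQ0, hm.prop.1, hm.prop.2, ?_⟩
  intro x z hxz hn
  let Q' : V → V → Prop := fun a b => Q a b ∨ (a = x ∧ b = z)
  have hle : Q ≤ Q' := fun a b h => .inl h
  have hnot : ¬ QF A F Q' := by
    intro hq
    refine hn (hm.le_of_ge (y := Q') ⟨?_, hq⟩ hle x z (.inr ⟨rfl, rfl⟩))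
    rintro a b (h | ⟨rfl, rfl⟩)
    exacts [hm.prop.1 _ _ h, hxz]
  have hnot2 : ∃ z' X, (∀ x ∈ X, Q' x z') ∧ (X \ {x | F x z'}).Finite ∧ ¬ Ln A Q' z' X := by
    by_contra hc; push Not at hc
    exact hnot ⟨hm.prop.2.1.trans hle, hc⟩
  obtain ⟨z', X, h1, h2, h3⟩ := hnot2
  have h4 : ¬ Ln A Q z' X := fun h => h3 (h.mono fun _ _ _ h => .inl h)
  have h5 : ¬ ∀ y ∈ X, Q y z' := fun h => h4 (hm.prop.2.2 z' X h h2)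
  push Not at h5
  obtain ⟨y, hy, h6⟩ := h5
  obtain ⟨rfl, rfl⟩ : y = x ∧ z' = z := (h1 y hy).resolve_left h6
  have h7 : ∀ w ∈ X \ {y}, Q w z' := fun w hw => (h1 w hw.1).resolve_right fun h => hw.2 h.1
  refine Sp_of_fail (X := X \ {y}) h7 (hm.prop.2.2 _ _ h7 (h2.subset fun w hw => ⟨hw.1.1, hw.2⟩)) ?_
  rwa [Set.insert_sdiff_singleton, Set.insert_eq_of_mem hy]

end FL

/-! Part 8 -/
namespace FL
open Relation

/-- Delete the edge `(u,v)`. -/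
def dl (Γ : V → V → Prop) (u v a b : V) : Prop := Γ a b ∧ ¬ (a = u ∧ b = v)

/-- A linkage that becomes impossible without `(u,v)` uses `(u,v)`. -/
theorem uses {A : Set V} {Γ : V → V → Prop} {u v y : V} {J : Set V} {M : V → V → Prop}
    (hM : Lk (Gz A Γ y) (A \ {y}) J M) (hn : ¬ Ln A (dl Γ u v) y J) :
    M u v ∧ v ∉ A ∧ u ≠ y ∧ v ≠ y ∧ (∃ f ∈ J, ReflTransGen M v f) ∧ (∃ a ∈ A \ {y}, ReflTransGen M a u) := by
  have h1 : M u v ∧ On (A \ {y}) J M u := by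
    by_contra hc
    refine hn ⟨_, hM.prune.monoG fun x y h h' => ⟨⟨h'.1, ?_⟩, h'.2⟩⟩
    rintro ⟨rfl, rfl⟩
    exact hc h
  have h2 := hM.sub h1.1
  obtain ⟨f, hf, h3⟩ := (hM.on_succ h1.2 h1.1).2
  exact ⟨h1.1, h2.2.2.2, h2.2.1, h2.2.2.1, ⟨f, hf, h3⟩, h1.2.1⟩

theorem rtg_dl {G : V → V → Prop} {A Y : Set V} {M : V → V → Prop} (hM : Lk G A Y M) {u v a p q : V}
    (huv : M u v) (ha : a ∈ A) (hau : ReflTransGen M a u) (h : ReflTransGen M p q)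
    (hc : ReflTransGen M v p ∨ ReflTransGen M q u) :
    ReflTransGen (dl M u v) p q := by
  rcases rtg_split (w := u) (x := v) h with h1 | ⟨h1, h2⟩
  · exact h1
  · exfalso
    have h3 := h1.mn (N := M) fun _ _ h => h.1
    have h4 := h2.mn (N := M) fun _ _ h => h.1
    rcases hc with hc | hc
    · exact hM.acyc ha hau (TransGen.head' huv (hc.trans h3))
    · exact hM.acyc ha hau (TransGen.head' huv (h4.trans hc))

theorem ess1 {A : Set V} {Γ : V → V → Prop} {u v y : V} {J : Set V}
    (hJ : Ln A Γ y J) (hn : ¬ Ln A (dl Γ u v) y J) :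
    v ∉ A ∧ u ≠ y ∧ ∃ X M,
      Wave (Gm (Gz A (dl Γ u v) y) {v}) (A \ {y}) (J ∪ {u} ∪ {w | dl Γ u v w v}) X M ∧
      Loose (Gb (Gm (Gz A (dl Γ u v) y) {v}) (Rc (Gm (Gz A (dl Γ u v) y) {v}) (A \ {y}) X)) X
        (J ∪ {u} ∪ {w | dl Γ u v w v}) ∧ u ∈ X ∧
      ∀ w, w ∈ J ∨ dl Γ u v w v → ¬ Rc (Gm (Gz A (dl Γ u v) y) {v}) (A \ {y}) (X \ {u}) w := by
  obtain ⟨M, hM⟩ := hJ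
  obtain ⟨huv, hvA, huy, hvy, ⟨f, hf, hvf⟩, a, ha, hau⟩ := uses hM hn
  refine ⟨hvA, huy, ?_⟩
  set G' := Gz A (dl Γ u v) y with hG'
  set G2 := Gm G' {v} with hG2
  have hR : Lk G' (A \ {y}) (J \ {f}) (dl M u v) := by
    refine ⟨fun h => ⟨⟨(hM.sub h.1).1, h.2⟩, (hM.sub h.1).2⟩, fun h => hM.inA h.1, fun h h' => hM.inj h.1 h'.1,
      fun h h' => hM.fn h.1 h'.1, fun {j} hj => ?_, fun h h' => hM.noOut h.1 h'.1⟩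
    obtain ⟨b, hb, h1⟩ := hM.tgt hj.1
    refine ⟨b, hb, ?_⟩
    rcases rtg_split (w := u) (x := v) h1 with h1 | ⟨h1, h2⟩
    · exact h1
    · exact absurd (hM.tgt_unique hj.1 hf (h2.mn fun _ _ h => h.1) hvf) hj.2
  rcases AL hR {f} with ⟨q, rfl, hq⟩ | ⟨U, hU, hUf⟩
  · rw [Set.insert_sdiff_singleton, Set.insert_eq_of_mem hf] at hq
    exact absurd hq hn
  have hvf' : ReflTransGen (dl M u v) v f := rtg_dl hM huv ha hau hvf (.inl .refl)
  have hau' : ReflTransGen (dl M u v) a u := rtg_dl hM huv ha hau hau (.inr .refl)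
  have hUnf : ∀ w ∈ U, ¬ ReflTransGen M w f := by
    intro w hw h
    obtain ⟨-, j, hj, h1⟩ := hU.on w hw
    exact hj.2 (hM.tgt_unique hj.1 hf (h1.mn fun _ _ h => h.1) h)
  have hvU : v ∉ U := fun h => hUnf v h hvf
  have hvR : ¬ Rc G' (A \ {y}) U v := by
    intro h
    refine hUf f rfl ?_
    have : ∀ w, ReflTransGen (dl M u v) v w → ReflTransGen M w f → Rc G' (A \ {y}) U w := by
      intro w h1
      induction h1 with
      | refl => exact fun _ => h
      | tail h2 h3 ih => exact fun h4 => (ih (h4.head h3.1)).step (hR.sub h3) fun h5 => hUnf _ h5 h4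
    exact this f hvf' .refl
  have hRJ : ∀ j ∈ J, ¬ Rc G' (A \ {y}) U j := by
    intro j hj
    by_cases h : j = f
    · subst h; exact hUf j rfl
    · exact hU.blk j ⟨hj, h⟩
  have hRv : ∀ w, dl Γ u v w v → ¬ Rc G' (A \ {y}) U w := by
    intro w h h1
    exact (h1.next ⟨h, Gz.rc_ne h1, hvy, hvA⟩).elim hvR hvU
  have hsub : ∀ {U'} w, U ⊆ U' → Rc G2 (A \ {y}) U' w → Rc G' (A \ {y}) U w := fun w h1 h =>
    Rc.mono' (G' := G') (A' := A \ {y}) (X' := U) subset_rfl (fun _ _ _ h => h.1) (fun z hz h => hz.notMem (h1 h)) h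
  have hau2 : ∀ w, ReflTransGen (dl M u v) a w → ReflTransGen M w u →
      ReflTransGen (fun p q => dl M u v p q ∧ Rc G' (A \ {y}) U p) a w ∧ Rc G' (A \ {y}) U w := by
    intro w h
    have hnot : ∀ w, ReflTransGen M w u → w ∉ U := fun w h h1 => hUnf w h1 ((h.tail huv).trans hvf)
    induction h with
    | refl => exact fun h => ⟨.refl, .base ha (hnot _ h)⟩
    | tail h1 h2 ih =>
      intro h3
      have := ih (h3.head h2.1)
      exact ⟨this.1.tail ⟨h2, this.2⟩, this.2.step (hR.sub h2) (hnot _ h3)⟩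
  obtain ⟨hau3, huR⟩ := hau2 u hau' .refl
  let M0 : V → V → Prop := fun p q => dl M u v p q ∧ Rc G' (A \ {y}) U p
  have hM0 : Lk G2 (A \ {y}) (insert u U) M0 := by
    have : Lk G' (A \ {y}) (insert u U) M0 := by
      refine hR.subM (fun _ _ h => h.1) ?_ ?_
      · rintro w (rfl | hw)
        · exact ⟨a, ha, hau3⟩
        · exact hU.lk.tgt hw
      · rintro w (rfl | hw) z ⟨h1, h2⟩
        · exact h1.2 ⟨rfl, hM.fn h1.1 huv⟩
        · exact h2.notMem hw
    refine this.monoG fun p q h h' => ⟨h', ?_, ?_⟩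
    · rintro rfl; exact hvR h.2
    · rintro rfl; exact h.1.2 ⟨hM.inj h.1.1 huv, rfl⟩
  have hblk : Blk G2 (A \ {y}) (insert u U) (J ∪ {u} ∪ {w | dl Γ u v w v}) := by
    rintro w ((hw | rfl) | hw) h
    · exact hRJ w hw (hsub w (Set.subset_insert _ _) h)
    · exact h.notMem (.inl rfl)
    · exact hRv w hw (hsub w (Set.subset_insert _ _) h)
  obtain ⟨X, N, hX, hl, hMN, hXU⟩ := maxWave (hM0.wave hblk)
  have hmem : ∀ w ∈ insert u U, Rc G2 (A \ {y}) X w ∨ w ∈ X := by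
    intro w hw
    rcases (hM0.wave hblk).lk.tgt hw with ⟨b, hb, h1⟩
    rcases h1.cases_tail with rfl | ⟨c, -, h2⟩
    · exact Rc.start hb
    · exact (hX.pr _ _ (hMN _ _ h2)).next (hX.lk.sub (hMN _ _ h2))
  have huX : u ∈ X := (hmem u (.inl rfl)).resolve_left (hX.blk u (.inl (.inr rfl)))
  have huR2 : Rc G2 (A \ {y}) U u := by
    have : ∀ w, ReflTransGen M0 a w → (w ∉ U) → Rc G2 (A \ {y}) U w := by
      intro w h
      induction h with
      | refl => exact fun h => .base ha h
      | tail h1 h2 ih => exact fun h3 => (ih h2.2.notMem).step (hM0.sub h2) h3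
    exact this u hau3 huR.notMem
  refine ⟨X, N, hX, hl, huX, ?_⟩
  have key : ∀ w, Rc G2 (A \ {y}) (X \ {u}) w → Rc G2 (A \ {y}) X w ∨ Rc G2 (A \ {y}) U w := by
    intro w h
    have aux : ∀ w, w ∉ X \ {u} → w ∈ X → Rc G2 (A \ {y}) U w := by
      intro w h1 h2
      have : w = u := by by_contra h; exact h1 ⟨h2, h⟩
      rw [this]; exact huR2
    induction h with
    | base h1 h2 =>
      rcases Rc.start h1 with h3 | h3
      · exact .inl h3
      · exact .inr (aux _ h2 h3)
    | step h1 h2 h3 ih =>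
      rcases ih with ih | ih
      · rcases ih.next h2 with h4 | h4
        · exact .inl h4
        · exact .inr (aux _ h3 h4)
      · rcases ih.next h2 with h4 | h4
        · exact .inr h4
        · rcases hmem _ (.inr h4) with h5 | h5
          · exact .inl h5
          · exact .inr (aux _ h3 h5)
  intro w hw h
  rcases key w h with h1 | h1
  · exact hX.blk w (hw.elim (fun h => .inl (.inl h)) fun h => .inr h) h1
  · have := hsub w subset_rfl h1
    exact hw.elim (fun h => hRJ w h this) fun h => hRv w h this

/-- The key lemma on essential edges. -/
theorem ess {A : Set V} {Γ : V → V → Prop} {u v y : V} {J : Set V} (huv : Γ u v) (hvy : v ≠ y)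
    (hJ : Ln A Γ y J) (hn : ¬ Ln A (dl Γ u v) y J)
    (hz : ∀ z, Γ z y → Ln A Γ y (insert z J)) :
    ∃ W, Lkb (Gz A Γ v) (A \ {v}) W ∧ u ∈ W ∧
      ∀ x, Γ x v → x ≠ u → ¬ Rc (Gz A Γ v) (A \ {v}) (W \ {u}) x := by
  obtain ⟨hvA, huy, X, M, hX, hl, huX, hb⟩ := ess1 hJ hn
  have hAv : A \ {v} = A := Set.sdiff_singleton_eq_self hvA
  rw [hAv]
  set G' := Gz A (dl Γ u v) y with hG'
  set G2 := Gm G' {v} with hG2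
  -- blocking in the cases where `y` is added
  have blk1 : ∀ x, Γ x v → x ≠ u → ¬ Rc (Gz A Γ v) A (insert y X \ {u}) x := by
    intro x h1 h2 h3
    have hny : ∀ w, Rc (Gz A Γ v) A (insert y X \ {u}) w → w ≠ y := by
      rintro w h rfl
      exact h.notMem ⟨.inl rfl, fun h => huy h.symm⟩
    refine hb x (.inr ⟨h1, fun h => h2 h.1⟩) ?_
    refine Rc.mono2 (G := Gz A Γ v) (A := A) (X := insert y X \ {u}) (G' := G2) (A' := A \ {y})
      (X' := X \ {u}) (fun a ha h => ⟨ha, hny a h⟩)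
      (fun p q h4 h5 h6 => ?_) (fun w h4 h5 => h4.notMem ⟨.inr h5.1, h5.2⟩) h3
    exact ⟨⟨⟨h6.1, fun h => h6.2.2.1 h.2⟩, hny p h4, hny q h5, h6.2.2.2⟩, h6.2.1, h6.2.2.1⟩
  by_cases hyA : y ∈ A
  · refine ⟨insert y X, ⟨M, ?_, ?_, hX.lk.inj, hX.lk.fn, ?_, ?_⟩, .inr huX, blk1⟩
    · intro p q h
      have h' := hX.lk.sub h
      exact ⟨h'.1.1.1, h'.2.1, h'.2.2, h'.1.2.2.2⟩
    · intro p q h; exact (hX.lk.sub h).1.2.2.2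
    · rintro w (rfl | hw)
      · exact ⟨w, hyA, .refl⟩
      · obtain ⟨a, ha, h⟩ := hX.lk.tgt hw
        exact ⟨a, ha.1, h⟩
    · rintro w q (rfl | hw) h
      · exact (hX.lk.sub h).1.2.1 rfl
      · exact hX.lk.noOut hw h
  have hAy : A \ {y} = A := Set.sdiff_singleton_eq_self hyA
  by_cases hc : ∀ z, Γ z y → z ≠ v → ¬ Rc G2 (A \ {y}) (X \ {u}) z
  · refine ⟨X, ⟨M, ?_⟩, huX, ?_⟩
    · have := hX.lk
      rw [hAy] at this
      exact this.monoG fun p q _ h' => ⟨h'.1.1.1, h'.2.1, h'.2.2, h'.1.2.2.2⟩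
    · intro x h1 h2 h3
      refine hb x (.inr ⟨h1, fun h => h2 h.1⟩) ?_
      have : ∀ w, Rc (Gz A Γ v) A (X \ {u}) w → Rc G2 (A \ {y}) (X \ {u}) w := by
        intro w hw
        induction hw with
        | base h h' => exact .base (by rw [hAy]; exact h) h'
        | @step p q h4 h5 h6 ih =>
          refine ih.step ⟨⟨⟨h5.1, fun h => h5.2.2.1 h.2⟩, Gz.rc_ne (ih.mono' (G' := G') (X' := X \ {u}) subset_rfl (fun _ _ _ h => h.1) (fun _ h => h.notMem)), ?_, h5.2.2.2⟩,
            h5.2.1, h5.2.2.1⟩ h6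
          rintro rfl
          exact hc p h5.1 h5.2.1 ih
      exact this x h3
  push Not at hc
  obtain ⟨z, hzy, hzv, hzR⟩ := hc
  have hzJ : z ∉ J := fun h => hb z (.inl h) hzR
  have hzny : z ≠ y := Gz.rc_ne (hzR.mono' (G' := G') (X' := X \ {u}) subset_rfl (fun _ _ _ h => h.1) (fun _ h => h.notMem))
  obtain ⟨P, hP⟩ := hz z hzy
  have hn' : ¬ Ln A (dl Γ u v) y (insert z J) := fun h => hn (h.subset (Set.subset_insert _ _))
  obtain ⟨hPuv, -, -, -, ⟨f, hf, hvf⟩, a0, ha0, hau⟩ := uses hP hn'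
  have hPJ : Lk (Gz A Γ y) (A \ {y}) J P := hP.subset (Set.subset_insert _ _)
  have hzu : z ≠ u := fun h => hP.noOut (y := z) (.inl rfl) (h ▸ hPuv)
  have hzX : z ∉ X := fun h => hzR.notMem ⟨h, hzu⟩
  -- `f ≠ z`
  have hfJ : f ∈ J := by
    refine hf.resolve_left ?_
    rintro rfl
    obtain ⟨-, -, -, -, ⟨f', hf', hvf'⟩, -⟩ := uses hPJ hn
    have := hP.tgt_unique (.inl rfl) (.inr hf') hvf hvf'
    exact hzJ (this ▸ hf')
  set RX := Rc G2 (A \ {y}) X with hRX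
  have hvRX : ¬ RX v := by
    intro h
    cases h with
    | base h _ => exact hvA h.1
    | step _ h _ => exact h.2.2 rfl
  have hvX : v ∉ X := by
    intro h
    obtain ⟨b, hb, h1⟩ := hX.lk.tgt h
    rcases h1.cases_tail with rfl | ⟨c, -, h2⟩
    · exact hvA hb.1
    · exact (hX.lk.sub h2).2.2 rfl
  have hdisj : ∀ w ∈ X, ¬ RX w := fun w h h' => h'.notMem h
  have huRX : ¬ RX u := hdisj u huX
  have hJRX : ∀ j ∈ J, ¬ RX j := fun j hj => hX.blk j (.inl (.inl hj))
  let N : V → V → Prop := fun p q => P p q ∧ ¬ RX p ∧ ¬ RX q ∧ q ∉ X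
  have hN : Lk (Gb (Gz A Γ y) RX) X J N := by
    refine hPJ.cut (fun a ha => Rc.start ha) ?_ hJRX
    intro p q h1 h2
    have hpv : p ≠ v := fun h => hvRX (h ▸ h1)
    have hqv : q ≠ v := by
      rintro rfl
      exact huRX (hP.inj h2 hPuv ▸ h1)
    have h3 := hP.sub h2
    exact h1.next ⟨⟨⟨h3.1, fun h => hqv h.2⟩, h3.2⟩, hpv, hqv⟩
  let N2 : V → V → Prop := fun p q => N p q ∧ p ≠ v ∧ q ≠ v
  have hN2N : ∀ p q, N2 p q → N p q := fun p q h => h.1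
  have hNP : ∀ p q, N p q → P p q := fun p q h => h.1
  -- paths of `N` from `X` either avoid `v` or pass through `v`
  have split : ∀ x ∈ X, ∀ w, ReflTransGen N x w → ReflTransGen N2 x w ∨ ReflTransGen N v w := by
    intro x hx w h
    induction h with
    | refl => exact .inl .refl
    | @tail b c h1 h2 ih =>
      rcases ih with ih | ih
      · by_cases hcv : c = v
        · subst hcv; exact .inr .refl
        · refine .inl (ih.tail ⟨h2, ?_, hcv⟩)
          rintro rfl
          rcases ih.cases_tail with rfl | ⟨d, -, h3⟩
          · exact hvX hx
          · exact h3.2.2 rfl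
      · exact .inr (ih.tail h2)
  have hN2sub : ∀ p q, N2 p q → Gb G2 RX p q := by
    rintro p q ⟨h1, h2, h3⟩
    have h4 := (hN.sub h1).1
    exact ⟨⟨⟨⟨h4.1, fun h => h3 h.2⟩, h4.2⟩, h2, h3⟩, h1.2.1, h1.2.2.1⟩
  have hN2lk : ∀ Y : Set V, (∀ w ∈ Y, w ∈ J ∨ w = u) → (∀ w ∈ Y, ∃ x ∈ X, ReflTransGen N2 x w) →
      Lk (Gb G2 RX) X Y N2 := by
    intro Y h1 h2
    refine ⟨fun h => hN2sub _ _ h, fun h => h.1.2.2.2, fun h h' => hN.inj h.1 h'.1,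
      fun h h' => hN.fn h.1 h'.1, fun h => h2 _ h, fun {w q} h h' => ?_⟩
    rcases h1 w h with h3 | rfl
    · exact hN.noOut h3 h'.1
    · exact h'.2.2 (hP.fn h'.1.1 hPuv)
  have hGG : ∀ p q, G2 p q → G' p q := fun p q h => h.1
  have hMR : ∀ p q, M p q → RX p ∧ (RX q ∨ q ∈ X) := fun p q h =>
    ⟨hX.pr _ _ h, (hX.pr _ _ h).next (hX.lk.sub h)⟩
  -- no linkage of `J` from `X` beyond `X`
  have nol : ¬ Lkb (Gb G' RX) X J := by
    rintro ⟨K, hK⟩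
    refine hn ⟨fun p q => M p q ∨ K p q, ?_⟩
    have h1 : Lk G' (A \ {y}) (X ∪ ∅) M := by
      rw [Set.union_empty]
      exact hX.lk.monoG fun p q _ h => hGG p q h
    have := h1.compose hK (fun a ha => Rc.start ha) hMR (by simp)
    rw [Set.union_empty] at this
    exact this
  have hJ2 : ∀ j ∈ J, j ≠ f → ∃ x ∈ X, ReflTransGen N2 x j := by
    intro j hj hjf
    obtain ⟨x, hx, h⟩ := hN.tgt hj
    refine ⟨x, hx, (split x hx j h).resolve_right fun h => hjf ?_⟩
    exact hPJ.tgt_unique hj hfJ (h.mn hNP) hvf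
  have hvfN : ReflTransGen N v f := by
    by_contra hc
    refine nol ⟨N2, (hN2lk J (fun w h => .inl h) fun w hw => ?_).monoG
      fun p q _ h => ⟨hGG p q h.1, h.2⟩⟩
    by_cases hwf : w = f
    · subst hwf
      obtain ⟨x, hx, h⟩ := hN.tgt hw
      exact ⟨x, hx, (split x hx w h).resolve_right hc⟩
    · exact hJ2 w hw hwf
  have huN : N u v := ⟨hPuv, huRX, hvRX, hvX⟩
  -- every vertex of `X \ {u}` is the start of a path
  have hcov : ∀ s ∈ X, ∃ j ∈ J, ReflTransGen N s j := by
    intro s hs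
    by_cases hsu : s = u
    · subst hsu; exact ⟨f, hfJ, hvfN.head huN⟩
    have hY : Lk (Gb G2 RX) X (insert u (J \ {f})) N2 := by
      refine hN2lk _ ?_ ?_
      · rintro w (rfl | hw)
        exacts [.inr rfl, .inl hw.1]
      · rintro w (rfl | hw)
        · exact ⟨w, huX, .refl⟩
        · exact hJ2 w hw.1 hw.2
    have hY' : Lk (Gb G' RX) X (insert u (J \ {f})) N2 :=
      hY.monoG fun p q _ h => ⟨hGG p q h.1, h.2⟩
    rcases AL hY' {f} with ⟨q, rfl, hq⟩ | ⟨U, hU, hUf⟩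
    · refine (nol (hq.subset fun j hj => ?_)).elim
      by_cases h : j = q
      · exact .inl h
      · exact .inr (.inr ⟨hj, h⟩)
    have hUt : ∀ w ∈ U, ReflTransGen N v w → ¬ ReflTransGen N w f := by
      intro w hw h1 h2
      obtain ⟨-, j, hj, h3⟩ := hU.on w hw
      have h4 : ReflTransGen P w j := h3.mn fun p q h => h.1.1
      rcases hj with rfl | hj
      · exact hP.acyc ha0 hau (TransGen.head' hPuv ((h1.mn hNP).trans h4))
      · exact hj.2 (hPJ.tgt_unique hj.1 hfJ h4 (h2.mn hNP))
    have hvR2 : ¬ Rc (Gb G' RX) X U v := by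
      intro h
      have : ∀ w, ReflTransGen N v w → ReflTransGen N w f → Rc (Gb G' RX) X U w := by
        intro w h1
        induction h1 with
        | refl => exact fun _ => h
        | @tail b c h2 h3 ih =>
          intro h4
          refine (ih (h4.head h3)).step ?_ fun h5 => hUt _ h5 (h2.tail h3) h4
          have h6 := hN.sub h3
          refine ⟨⟨⟨h6.1.1, ?_⟩, h6.1.2⟩, h6.2⟩
          rintro ⟨rfl, rfl⟩
          exact hP.acyc ha0 hau (TransGen.head' hPuv (h2.mn hNP))
      exact hUf f rfl (this f hvfN .refl)
    have hvU : v ∉ U := fun h => hUt v h .refl hvfN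
    have hsubR : ∀ w, Rc (Gb G2 RX) X U w → Rc (Gb G' RX) X U w := fun w h =>
      h.mono' subset_rfl (fun p q _ h => ⟨hGG p q h.1, h.2⟩) fun _ h => h.notMem
    have hRn : ∀ w, Rc (Gb G' RX) X U w → ¬ RX w := by
      intro w h
      cases h with
      | base h _ => exact hdisj w h
      | step _ h _ => exact h.2.2
    have hUlk : Lkb (Gb G2 RX) X U := by
      exact ⟨_, hU.lk.monoG fun p q h _ => hN2sub p q h.1⟩
    have hUb : Blk (Gb G2 RX) X U (J ∪ {u} ∪ {w | dl Γ u v w v}) := by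
      rintro w ((hw | rfl) | hw) h
      · by_cases hwf : w = f
        · subst hwf; exact hUf w rfl (hsubR w h)
        · exact hU.blk w (.inr ⟨hw, hwf⟩) (hsubR w h)
      · exact hU.blk w (.inl rfl) (hsubR w h)
      · have h1 := hsubR w h
        have hwy : w ≠ y := by
          cases h with
          | base h _ =>
            obtain ⟨b, hb, h2⟩ := hX.lk.tgt h
            rcases h2.cases_tail with rfl | ⟨c, -, h3⟩
            · exact hb.2
            · exact (hX.lk.sub h3).1.2.2.1
          | step _ h _ => exact h.1.1.2.2.1
        rcases h1.next (y := v) ⟨⟨hw, hwy, hvy, hvA⟩, hRn w h1, hvRX⟩ with h2 | h2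
        exacts [hvR2 h2, hvU h2]
    have hsU := hl U hUlk hUb hs
    obtain ⟨-, j, hj, h⟩ := hU.on s hsU
    rcases hj with rfl | hj
    · rcases h.cases_tail with h1 | ⟨c, -, h1⟩
      · exact absurd h1.symm hsu
      · exact absurd huX h1.1.2.2.2
    · exact ⟨j, hj.1, h.mn hN2N⟩
  have hanti : ∀ s j, ReflTransGen N s j → j ∈ J → ∀ w, TransGen P s w → w ∉ X := by
    intro s j h hj
    induction h using ReflTransGen.head_induction_on with
    | refl =>
      intro w hw
      obtain ⟨c, h1, -⟩ := TransGen.head'_iff.1 hw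
      exact (hPJ.noOut hj h1).elim
    | @head s c h1 h2 ih =>
      intro w hw
      obtain ⟨d, h3, h4⟩ := TransGen.head'_iff.1 hw
      obtain rfl := hP.fn h1.1 h3
      rcases reflTransGen_iff_eq_or_transGen.1 h4 with rfl | h5
      · exact h1.2.2.2
      · exact ih w h5
  have hanti2 : ∀ s ∈ insert z X, ∀ w ∈ insert z X, ¬ TransGen P s w := by
    rintro s (rfl | hs) w hw h
    · obtain ⟨d, h3, h4⟩ := TransGen.head'_iff.1 h
      exact hP.noOut (.inl rfl) h3
    · obtain ⟨j, hj, h1⟩ := hcov s hs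
      rcases hw with rfl | hw
      · have := hP.tgt_unique (.inl rfl) (.inr hj) h.to_reflTransGen (h1.mn hNP)
        exact hzJ (this ▸ hj)
      · exact hanti s j h1 hj w h hw
  let P3 : V → V → Prop := fun p q => (P p q ∧ ¬ ∃ s ∈ insert z X, ReflTransGen P s p) ∨ (p = z ∧ q = y)
  have hreach : ∀ w ∈ insert z X, ∀ c, ReflTransGen P c w → ReflTransGen P3 c w := by
    intro w hw c h
    induction h using ReflTransGen.head_induction_on with
    | refl => exact .refl
    | @head p q h1 h2 ih =>
      refine ih.head (.inl ⟨h1, ?_⟩)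
      rintro ⟨s, hs, h3⟩
      exact hanti2 s hs w hw (TransGen.trans_right h3 (TransGen.head' h1 h2))
  have hsrc : ∀ w ∈ insert z X, ∃ b ∈ A, ReflTransGen P b w := by
    rintro w (rfl | hw)
    · obtain ⟨b, hb, h⟩ := hP.tgt (y := w) (.inl rfl)
      exact ⟨b, hb.1, h⟩
    · obtain ⟨j, hj, h1⟩ := hcov w hw
      obtain ⟨b, hb, h⟩ := hPJ.tgt hj
      refine ⟨b, hb.1, ?_⟩
      rcases hP.btotal h (h1.mn hNP) with h2 | h2
      · exact h2
      · rw [hP.eq_of_src hb h2]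
  refine ⟨insert y X, ⟨P3, ?_, ?_, ?_, ?_, ?_, ?_⟩, .inr huX, blk1⟩
  · rintro p q (⟨h1, h2⟩ | ⟨rfl, rfl⟩)
    · have h3 := hP.sub h1
      refine ⟨h3.1, ?_, ?_, h3.2.2.2⟩
      · rintro rfl; exact h2 ⟨u, .inr huX, .single hPuv⟩
      · rintro rfl; exact h2 ⟨u, .inr huX, by rw [hP.inj h1 hPuv]⟩
    · exact ⟨hzy, hzv, hvy.symm, hyA⟩
  · rintro p q (⟨h1, h2⟩ | ⟨rfl, rfl⟩)
    · exact (hP.sub h1).2.2.2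
    · exact hyA
  · rintro p q w (⟨h1, h2⟩ | ⟨h1, h2⟩) (⟨h3, h4⟩ | ⟨h3, h4⟩)
    · exact hP.inj h1 h3
    · exact ((hP.sub h1).2.2.1 h4).elim
    · exact ((hP.sub h3).2.2.1 h2).elim
    · rw [h1, h3]
  · rintro p q w (⟨h1, h2⟩ | ⟨h1, h2⟩) (⟨h3, h4⟩ | ⟨h3, h4⟩)
    · exact hP.fn h1 h3
    · exact (h2 ⟨_, .inl h3, .refl⟩).elim
    · exact (h4 ⟨_, .inl h1, .refl⟩).elim
    · rw [h2, h4]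
  · rintro w (rfl | hw)
    · obtain ⟨b, hb, h⟩ := hsrc z (.inl rfl)
      exact ⟨b, hb, (hreach z (.inl rfl) b h).tail (.inr ⟨rfl, rfl⟩)⟩
    · obtain ⟨b, hb, h⟩ := hsrc w (.inr hw)
      exact ⟨b, hb, hreach w (.inr hw) b h⟩
  · rintro w q hw (⟨h1, h2⟩ | ⟨rfl, rfl⟩)
    · rcases hw with rfl | hw
      · exact (hP.sub h1).2.1 rfl
      · exact h2 ⟨w, .inr hw, .refl⟩
    · rcases hw with rfl | hw
      · exact hzny rfl
      · exact hzX hw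

end FL

/-! Part 9 -/
namespace FL
open Relation

theorem rtg_off {M : V → V → Prop} {S : Set V} {a b : V} (h : ReflTransGen M a b)
    (hS : ∀ w ∈ S, ¬ ReflTransGen M w b) : ReflTransGen (fun x y => M x y ∧ x ∉ S ∧ y ∉ S) a b := by
  induction h using ReflTransGen.head_induction_on with
  | refl => exact .refl
  | head h3 h4 ih =>
    exact ih.head ⟨h3, fun h => hS _ h (h4.head h3), fun h => hS _ h h4⟩

theorem rtg_fin {M : V → V → Prop} {a b : V} (h : ReflTransGen M a b) :
    ∃ D : Set V, D.Finite ∧ a ∈ D ∧ b ∈ D ∧ (∀ w ∈ D, ReflTransGen M a w ∧ ReflTransGen M w b) ∧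
      ReflTransGen (fun x y => M x y ∧ x ∈ D ∧ y ∈ D) a b := by
  induction h with
  | refl => exact ⟨{a}, Set.finite_singleton a, rfl, rfl, by rintro w rfl; exact ⟨.refl, .refl⟩, .refl⟩
  | @tail b c h1 h2 ih =>
    obtain ⟨D, h3, h4, h5, h6, h7⟩ := ih
    refine ⟨insert c D, h3.insert c, .inr h4, .inl rfl, ?_, ?_⟩
    · rintro w (rfl | hw)
      · exact ⟨h1.tail h2, .refl⟩
      · exact ⟨(h6 w hw).1, (h6 w hw).2.tail h2⟩
    · exact (h7.mn fun x y h => ⟨h.1, .inr h.2.1, .inr h.2.2⟩).tail ⟨h2, .inr h5, .inl rfl⟩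

theorem cb_pick {G : V → V → Prop} {As B Nq : Set V}
    (hq : ∀ K : Set V, K.Finite → K ⊆ Nq → Lkb G As (B ∪ K)) {Z : Set V} (hZ : Z.Finite)
    (hB : Lkb (Gm G Z) (As \ Z) (B \ Z)) {E : Set V} (hE : E ⊆ Nq) (hi : E.Infinite)
    (hd : ∀ e ∈ E, e ∉ B) : ∃ e ∈ E, e ∉ Z ∧ Lkb (Gm G Z) (As \ Z) (insert e (B \ Z)) := by
  obtain ⟨K, hKE, hKf, hKc⟩ := (hi.sdiff hZ).exists_subset_ncard_eq (2 * Z.ncard + 1)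
  obtain ⟨M, hM⟩ := hq K hKf fun x hx => hE (hKE hx).1
  let W : Set V := {b | b ∈ B ∪ K ∧ ∃ w ∈ Z, ReflTransGen M w b}
  have hch : ∀ b : V, ∃ w, b ∈ W → w ∈ Z ∧ ReflTransGen M w b := by
    intro b
    by_cases h : b ∈ W
    · obtain ⟨-, w, hw, h1⟩ := h; exact ⟨w, fun _ => ⟨hw, h1⟩⟩
    · exact ⟨b, fun h' => absurd h' h⟩
  choose φ hφ using hch
  have hinj : Set.InjOn φ W := by
    intro b hb b' hb' h
    have h1 := (hφ b hb).2
    rw [h] at h1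
    exact hM.tgt_unique hb.1 hb'.1 h1 (hφ b' hb').2
  have hmaps : Set.MapsTo φ W Z := fun b hb => (hφ b hb).1
  have hWf : W.Finite := Set.Finite.of_injOn hmaps hinj hZ
  have hWc : W.ncard ≤ Z.ncard := Set.ncard_le_ncard_of_injOn φ hmaps hinj hZ
  let B2 : Set V := {b | b ∈ B ∪ K ∧ ¬ ∃ w ∈ Z, ReflTransGen M w b}
  have hB2 : Lkb (Gm G Z) (As \ Z) B2 := by
    refine ⟨fun x y => M x y ∧ x ∉ Z ∧ y ∉ Z, fun h => ⟨hM.sub h.1, h.2⟩, fun h h' => hM.inA h.1 h'.1,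
      fun h h' => hM.inj h.1 h'.1, fun h h' => hM.fn h.1 h'.1, fun {b} h => ?_, fun h h' => hM.noOut h.1 h'.1⟩
    obtain ⟨a, ha, h1⟩ := hM.tgt h.1
    have h2 := h.2
    push Not at h2
    refine ⟨a, ⟨ha, fun h3 => h2 a h3 h1⟩, ?_⟩
    exact rtg_off h1 h2
  have h12 : (B \ Z) \ B2 ⊆ W := by
    rintro b ⟨hb, hb2⟩
    refine ⟨.inl hb.1, ?_⟩
    by_contra hc
    exact hb2 ⟨.inl hb.1, hc⟩
  have h21 : K \ W ⊆ B2 \ (B \ Z) := by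
    rintro b ⟨hb, hbW⟩
    exact ⟨⟨.inr hb, fun h => hbW ⟨.inr hb, h⟩⟩, fun h => hd b (hKE hb).1 h.1⟩
  have hn : ((B \ Z) \ B2).ncard ≤ Z.ncard := (Set.ncard_le_ncard h12 hWf).trans hWc
  have hk : Z.ncard + 1 ≤ (K \ W).ncard := by
    have := Set.le_ncard_sdiff W K hWf
    omega
  obtain ⟨f, hf, h⟩ := exchange _ hB hB2 (hWf.subset h12) rfl (by
    refine le_trans ?_ (Set.encard_le_encard h21)
    rw [← (hKf.subset Set.sdiff_subset).cast_ncard_eq]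
    exact_mod_cast (by omega : ((B \ Z) \ B2).ncard + 1 ≤ (K \ W).ncard))
  have hfZ : f ∉ Z := fun h => hf.1.2 ⟨f, h, .refl⟩
  have hfK : f ∈ K := hf.1.1.resolve_left fun h => hf.2 ⟨h, hfZ⟩
  exact ⟨f, (hKE hfK).1, hfZ, h⟩

theorem cb_step {G : V → V → Prop} {As B Nq : Set V}
    (hq : ∀ K : Set V, K.Finite → K ⊆ Nq → Lkb G As (B ∪ K)) (E : Set V) (hE : E ⊆ Nq)
    (s : {Z : Set V // Z.Finite ∧ Lkb (Gm G Z) (As \ Z) (B \ Z)}) :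
    ∃ t : {Z : Set V // Z.Finite ∧ Lkb (Gm G Z) (As \ Z) (B \ Z)}, s.1 ⊆ t.1 ∧
      (¬ ((∃ e ∈ E, e ∈ B ∧ e ∉ s.1) ∨ (E.Infinite ∧ ∀ e ∈ E, e ∉ B)) → t = s) ∧
      (((∃ e ∈ E, e ∈ B ∧ e ∉ s.1) ∨ (E.Infinite ∧ ∀ e ∈ E, e ∉ B)) →
        ∃ e ∈ E, e ∈ t.1 \ s.1 ∧ (∀ z ∈ t.1 \ s.1, z ∈ B → z = e) ∧ ∃ a ∈ As,
          Lkb (fun x y => G x y ∧ x ∈ t.1 \ s.1 ∧ y ∈ t.1 \ s.1) {a} {e}) := by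
  by_cases hact : ((∃ e ∈ E, e ∈ B ∧ e ∉ s.1) ∨ (E.Infinite ∧ ∀ e ∈ E, e ∉ B))
  swap
  · exact ⟨s, subset_rfl, fun _ => rfl, fun h => absurd h hact⟩
  obtain ⟨Z, hZ, hB⟩ := s
  obtain ⟨e, heE, heZ, M, hM⟩ : ∃ e ∈ E, e ∉ Z ∧ Lkb (Gm G Z) (As \ Z) (insert e (B \ Z)) := by
    rcases hact with ⟨e, h1, h2, h3⟩ | ⟨h1, h2⟩
    · refine ⟨e, h1, h3, ?_⟩
      rw [Set.insert_eq_of_mem (show e ∈ B \ Z from ⟨h2, h3⟩)]; exact hB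
    · exact cb_pick hq hZ hB hE h1 h2
  obtain ⟨a, ha, h1⟩ := hM.tgt (Set.mem_insert _ _)
  obtain ⟨D, hDf, haD, heD, hDp, hDr⟩ := rtg_fin h1
  have hd : ∀ z ∈ D, z ∉ Z := by
    intro z hz
    rcases ((hDp z hz).1).cases_tail with h | ⟨w, _, h7⟩
    · rw [h]; exact ha.2
    · exact (hM.sub h7).2.2
  have e1 : (Z ∪ D) \ Z = D := by
    ext z; simp only [Set.mem_sdiff, Set.mem_union]
    constructor
    · rintro ⟨h | h, h'⟩
      exacts [absurd h h', h]
    · exact fun h => ⟨.inr h, hd z h⟩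
  have key : ∀ z ∈ B, z ∉ Z → ∀ w ∈ D, ReflTransGen M w z → z = e := fun z hz hzZ w hw h =>
    hM.tgt_unique (.inr ⟨hz, hzZ⟩) (.inl rfl) h (hDp w hw).2
  have hB' : Lkb (Gm G (Z ∪ D)) (As \ (Z ∪ D)) (B \ (Z ∪ D)) := by
    refine ⟨fun x y => M x y ∧ x ∉ D ∧ y ∉ D, fun h => ⟨(hM.sub h.1).1, ?_, ?_⟩,
      fun h h' => hM.inA h.1 ⟨h'.1, fun h => h'.2 (.inl h)⟩,
      fun h h' => hM.inj h.1 h'.1, fun h h' => hM.fn h.1 h'.1, fun {b} h => ?_,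
      fun h h' => hM.noOut (.inr ⟨h.1, fun h2 => h.2 (.inl h2)⟩) h'.1⟩
    · exact fun h2 => h2.elim (hM.sub h.1).2.1 h.2.1
    · exact fun h2 => h2.elim (hM.sub h.1).2.2 h.2.2
    · have hbZ : b ∉ Z := fun h2 => h.2 (.inl h2)
      have hbD : b ∉ D := fun h2 => h.2 (.inr h2)
      obtain ⟨a', ha', h2⟩ := hM.tgt (.inr ⟨h.1, hbZ⟩)
      have h3 : ∀ w ∈ D, ¬ ReflTransGen M w b := by
        intro w hw h3
        have := key b h.1 hbZ w hw h3
        exact hbD (this ▸ heD)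
      exact ⟨a', ⟨ha'.1, fun h4 => h4.elim ha'.2 fun h5 => h3 a' h5 h2⟩, rtg_off h2 h3⟩
  refine ⟨⟨Z ∪ D, hZ.union hDf, hB'⟩, Set.subset_union_left, fun h => absurd hact h, fun _ => ?_⟩
  simp only [e1]
  refine ⟨e, heE, heD, fun z hz hzB => key z hzB (hd z hz) z hz .refl, a, ha.1, pathLk ?_⟩
  exact hDr.mn fun x y h => ⟨(hM.sub h.1).1, h.2⟩

/-- Extending `B` to a linkable set hitting all infinite sets of a countable family. -/
theorem c_build [Countable V] {ι : Type*} [Countable ι] {G : V → V → Prop} {As B Nq : Set V}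
    (hAs : ∀ x y, G x y → y ∉ As) (hBN : B ⊆ Nq)
    (hq : ∀ K : Set V, K.Finite → K ⊆ Nq → Lkb G As (B ∪ K)) (T : ι → Set V)
    (hT : ∀ i, T i ⊆ Nq) :
    ∃ Y, Lkb G As Y ∧ B ⊆ Y ∧ Y ⊆ Nq ∧ ∀ i, (T i).Infinite → (T i ∩ Y).Nonempty := by
  obtain ⟨f, hf⟩ := exists_surjective_nat (Option (V ⊕ ι))
  let tk : Option (V ⊕ ι) → Set V := fun o => match o with
    | none => ∅
    | some (.inl b) => {b} ∩ Nq
    | some (.inr i) => T i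
  have htk : ∀ o, tk o ⊆ Nq := by
    rintro (_ | b | i)
    · exact Set.empty_subset _
    · exact Set.inter_subset_right
    · exact hT i
  let E : ℕ → Set V := fun n => tk (f n)
  let St := {Z : Set V // Z.Finite ∧ Lkb (Gm G Z) (As \ Z) (B \ Z)}
  obtain ⟨s0, hs0⟩ : ∃ s0 : St, s0.1 = ∅ := ⟨⟨∅, Set.finite_empty, by
    have : Gm G ∅ = G := by funext x y; simp [Gm]
    rw [this, Set.sdiff_empty, Set.sdiff_empty]
    simpa using hq ∅ Set.finite_empty (Set.empty_subset _)⟩, rfl⟩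
  obtain ⟨s, hs00, hs⟩ : ∃ s : ℕ → St, (s 0).1 = ∅ ∧ ∀ n, (s n).1 ⊆ (s (n+1)).1 ∧
      (¬ ((∃ e ∈ E n, e ∈ B ∧ e ∉ (s n).1) ∨ ((E n).Infinite ∧ ∀ e ∈ E n, e ∉ B)) →
        s (n+1) = s n) ∧
      (((∃ e ∈ E n, e ∈ B ∧ e ∉ (s n).1) ∨ ((E n).Infinite ∧ ∀ e ∈ E n, e ∉ B)) →
        ∃ e ∈ E n, e ∈ (s (n+1)).1 \ (s n).1 ∧ (∀ z ∈ (s (n+1)).1 \ (s n).1, z ∈ B → z = e) ∧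
          ∃ a ∈ As, Lkb (fun x y => G x y ∧ x ∈ (s (n+1)).1 \ (s n).1 ∧
            y ∈ (s (n+1)).1 \ (s n).1) {a} {e}) :=
    ⟨fun n => Nat.rec s0 (fun n s => (cb_step hq (E n) (htk _) s).choose) n, hs0,
      fun n => (cb_step hq (E n) (htk _) _).choose_spec⟩
  let act : ℕ → Prop := fun n =>
    (∃ e ∈ E n, e ∈ B ∧ e ∉ (s n).1) ∨ ((E n).Infinite ∧ ∀ e ∈ E n, e ∉ B)
  let D : ℕ → Set V := fun n => (s (n+1)).1 \ (s n).1
  have mono : ∀ {n m}, n ≤ m → (s n).1 ⊆ (s m).1 := fun h =>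
    monotone_nat_of_le_succ (f := fun n => (s n).1) (fun n => (hs n).1) h
  have dis : ∀ n m x, x ∈ D n → x ∈ D m → n = m := by
    intro n m x h1 h2
    rcases lt_trichotomy n m with h | h | h
    · exact (h2.2 (mono h h1.1)).elim
    · exact h
    · exact (h1.2 (mono h h2.1)).elim
  have hsp : ∀ n, ∃ (b : Option V) (a : Option V) (M : V → V → Prop), act n → ∃ b' a', b = some b' ∧
      a = some a' ∧ b' ∈ E n ∧ b' ∈ D n ∧ (∀ z ∈ D n, z ∈ B → z = b') ∧ a' ∈ As ∧
      Lk (fun x y => G x y ∧ x ∈ D n ∧ y ∈ D n) {a'} {b'} M := by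
    intro n
    by_cases h : act n
    · obtain ⟨b, h1, h2, h3, a, h4, M, h5⟩ := (hs n).2.2 h
      exact ⟨some b, some a, M, fun _ => ⟨b, a, rfl, rfl, h1, h2, h3, h4, h5⟩⟩
    · exact ⟨none, none, fun _ _ => False, fun h' => absurd h' h⟩
  choose b a M hbM using hsp
  have hDM : ∀ n x y, act n → M n x y → x ∈ D n ∧ y ∈ D n := by
    intro n x y h h'
    obtain ⟨b', a', -, -, -, -, -, -, h5⟩ := hbM n h
    exact (h5.sub h').2
  have hcov : ∀ n z, z ∈ B → z ∈ (s n).1 → ∃ m, act m ∧ b m = some z := by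
    intro n z hz
    induction n with
    | zero => intro h; rw [hs00] at h; exact h.elim
    | succ n ih =>
      intro h
      by_cases h1 : z ∈ (s n).1
      · exact ih h1
      · by_cases h2 : act n
        · obtain ⟨b', a', h3, -, -, -, h6, -, h5⟩ := hbM n h2
          exact ⟨n, h2, by rw [h3, h6 z ⟨h, h1⟩ hz]⟩
        · rw [(hs n).2.1 h2] at h; exact absurd h h1
  have hBY : B ⊆ {y | ∃ n, act n ∧ b n = some y} := by
    intro z hz
    obtain ⟨n, hn⟩ := hf (some (.inl z))
    have hE : E n = {z} ∩ Nq := by simp only [E, hn, tk]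
    refine hcov (n+1) z hz ?_
    by_cases h : z ∈ (s n).1
    · exact (hs n).1 h
    · have : act n := .inl ⟨z, by rw [hE]; exact ⟨rfl, hBN hz⟩, hz, h⟩
      obtain ⟨b', h1, h2, -⟩ := (hs n).2.2 this
      rw [hE] at h1
      obtain rfl : b' = z := h1.1
      exact h2.1
  refine ⟨{y | ∃ n, act n ∧ b n = some y}, ⟨fun x y => ∃ n, act n ∧ M n x y, ⟨?_, ?_, ?_, ?_, ?_, ?_⟩⟩,
    hBY, ?_, ?_⟩
  · rintro x y ⟨n, hn, h⟩
    obtain ⟨b', a', -, -, -, -, -, -, h5⟩ := hbM n hn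
    exact (h5.sub h).1
  · rintro x y ⟨n, hn, h⟩
    obtain ⟨b', a', -, -, -, -, -, -, h5⟩ := hbM n hn
    exact hAs _ _ (h5.sub h).1
  · rintro x y z ⟨n, hn, h⟩ ⟨m, hm, h'⟩
    obtain rfl := dis n m z (hDM _ _ _ hn h).2 (hDM _ _ _ hm h').2
    obtain ⟨b', a', -, -, -, -, -, -, h5⟩ := hbM n hn
    exact h5.inj h h'
  · rintro x y z ⟨n, hn, h⟩ ⟨m, hm, h'⟩
    obtain rfl := dis n m x (hDM _ _ _ hn h).1 (hDM _ _ _ hm h').1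
    obtain ⟨b', a', -, -, -, -, -, -, h5⟩ := hbM n hn
    exact h5.fn h h'
  · rintro y ⟨n, hn, hb⟩
    obtain ⟨b', a', h1, -, -, -, -, h6, h5⟩ := hbM n hn
    obtain rfl : y = b' := by rw [hb] at h1; exact Option.some.inj h1
    obtain ⟨c, hc, h1⟩ := h5.tgt rfl
    obtain rfl : c = a' := hc
    exact ⟨c, h6, h1.mn fun _ _ h => ⟨n, hn, h⟩⟩
  · rintro y z ⟨n, hn, hb⟩ ⟨m, hm, h'⟩
    obtain ⟨b', a', h1, -, -, h7, -, h6, h5⟩ := hbM n hn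
    obtain rfl : y = b' := by rw [hb] at h1; exact Option.some.inj h1
    obtain rfl := dis n m _ h7 (hDM _ _ _ hm h').1
    exact h5.noOut rfl h'
  · rintro y ⟨n, hn, hb⟩
    obtain ⟨b', a', h1, -, h2, -⟩ := hbM n hn
    obtain rfl : y = b' := by rw [hb] at h1; exact Option.some.inj h1
    exact htk _ h2
  · intro i hi
    by_cases hc : ∃ e ∈ T i, e ∈ B
    · obtain ⟨e, h1, h2⟩ := hc
      exact ⟨e, h1, hBY h2⟩
    · push Not at hc
      obtain ⟨n, hn⟩ := hf (some (.inr i))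
      have hE : E n = T i := by simp only [E, hn, tk]
      have : act n := .inr (by rw [hE]; exact ⟨hi, hc⟩)
      obtain ⟨b', a', h1, -, h2, -⟩ := hbM n this
      exact ⟨b', hE ▸ h2, n, this, h1⟩

/-- Minimal hitting sets of families of finite sets. -/
theorem minHit (S : Set (Set V)) (hS : ∀ E ∈ S, E.Finite ∧ E.Nonempty) :
    ∃ H : Set V, H ⊆ ⋃₀ S ∧ (∀ E ∈ S, (E ∩ H).Nonempty) ∧ ∀ e ∈ H, ∃ E ∈ S, E ∩ H = {e} := by
  obtain ⟨H, -, hH⟩ := zorn_superset_nonempty {H : Set V | H ⊆ ⋃₀ S ∧ ∀ E ∈ S, (E ∩ H).Nonempty} (by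
    intro c hc hch hne
    refine ⟨⋂₀ c, ⟨?_, ?_⟩, fun s hs => Set.sInter_subset_of_mem hs⟩
    · obtain ⟨h0, h0c⟩ := hne
      exact (Set.sInter_subset_of_mem h0c).trans (hc h0c).1
    · intro E hE
      by_contra hcon
      have h1 : ∀ e ∈ E, ∃ H ∈ c, e ∉ H := by
        intro e he
        by_contra h2
        push Not at h2
        exact hcon ⟨e, he, fun H hH => h2 H hH⟩
      have h2 : ∀ K : Set V, K.Finite → K ⊆ E → ∃ H ∈ c, ∀ e ∈ K, e ∉ H := by
        intro K hK
        induction K, hK using Set.Finite.induction_on with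
        | empty => intro _; obtain ⟨h0, h0c⟩ := hne; exact ⟨h0, h0c, by simp⟩
        | @insert a s _ _ ih =>
          intro hs
          obtain ⟨H1, h3, h4⟩ := ih ((Set.subset_insert _ _).trans hs)
          obtain ⟨H2, h5, h6⟩ := h1 a (hs (.inl rfl))
          rcases hch.total h3 h5 with h | h
          · refine ⟨H1, h3, ?_⟩
            rintro e (rfl | he)
            · exact fun h7 => h6 (h h7)
            · exact h4 e he
          · refine ⟨H2, h5, ?_⟩
            rintro e (rfl | he)
            · exact h6
            · exact fun h7 => h4 e he (h h7)
      obtain ⟨H, h3, h4⟩ := h2 E (hS E hE).1 subset_rfl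
      obtain ⟨e, h5, h6⟩ := (hc h3).2 E hE
      exact h4 e h5 h6) (⋃₀ S) ⟨subset_rfl, fun E hE => by
        obtain ⟨e, he⟩ := (hS E hE).2
        exact ⟨e, he, E, hE, he⟩⟩
  refine ⟨H, hH.1.1, hH.1.2, fun e he => ?_⟩
  by_contra hcon
  push Not at hcon
  have : H ⊆ H \ {e} := hH.2 ⟨Set.sdiff_subset.trans hH.1.1, fun E hE => by
    obtain ⟨x, hx⟩ := hH.1.2 E hE
    by_contra hn
    refine hcon E hE (Set.eq_singleton_iff_unique_mem.2 ?_)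
    have hxe : ∀ x ∈ E ∩ H, x = e := by
      intro x hx
      by_contra hxe
      exact hn ⟨x, hx.1, hx.2, hxe⟩
    exact ⟨hxe x hx ▸ hx, hxe⟩⟩ Set.sdiff_subset
  exact (this he).2 rfl

end FL

/-! Part 10 -/
namespace FL
open Relation

/-- Restrict the in-edges of `v` to those from `I`. -/
def rs (Q : V → V → Prop) (v : V) (I : Set V) (a b : V) : Prop := Q a b ∧ (b = v → a ∈ I)

theorem rs_one {A : Set V} {Q : V → V → Prop} {v y : V} {I J : Set V} (h : Ln A (rs Q v I) y J) :
    Ln A (rs Q v ∅) y J ∨ ∃ u ∈ I, Q u v ∧ Ln A (rs Q v {u}) y J := by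
  obtain ⟨M, hM⟩ := h
  by_cases hu : ∃ u, M u v
  · obtain ⟨u, hu⟩ := hu
    have h1 := (hM.sub hu).1
    refine .inr ⟨u, h1.2 rfl, h1.1, M, hM.monoG fun x y h h2 => ⟨⟨h2.1.1, ?_⟩, h2.2⟩⟩
    intro e; rw [e] at h; exact hM.inj h hu
  · refine .inl ⟨M, hM.monoG fun x y h h2 => ⟨⟨h2.1.1, ?_⟩, h2.2⟩⟩
    intro e; rw [e] at h; exact (hu ⟨x, h⟩).elim

theorem rs_mono {A : Set V} {Q : V → V → Prop} {v y : V} {I I' J : Set V} (h : Ln A (rs Q v I) y J)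
    (hI : I ⊆ I') : Ln A (rs Q v I') y J :=
  h.mono fun _ _ _ h => ⟨h.1, fun e => hI (h.2 e)⟩

/-- Joining: the sets `W e` force `H ⊆ X`. -/
theorem lemX_join [Countable V] {G : V → V → Prop} {As Y H : Set V} (hY : Lkb G As Y)
    (hd : ∀ e ∈ H, e ∉ Y)
    (hW : ∀ e ∈ H, ∃ W, Lkb G As W ∧ e ∈ W ∧ ∀ x ∈ Y ∪ H, x ≠ e → ¬ Rc G As (W \ {e}) x) :
    Lkb G As (Y ∪ H) := by
  obtain ⟨X, M, hw, hl, -, -⟩ := maxWave (Wave.triv G As (Y ∪ H))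
  obtain ⟨N, hN⟩ := hY
  have hc := (hN.cut' (T := X) (fun y hy => hw.blk y (.inl hy)))
  have hp := hc.prune
  have key : ∀ e ∈ H, e ∈ X ∧ ∀ y ∈ Y, ¬ ReflTransGen
      (fun x y => N x y ∧ ¬ Rc G As X x ∧ ¬ Rc G As X y ∧ y ∉ X) e y := by
    intro e he
    obtain ⟨W, hWl, heW, hWb⟩ := hW e he
    have hWB : Blk G As W (Y ∪ H) := by
      intro x hx h
      by_cases hxe : x = e
      · rw [hxe] at h; exact h.notMem heW
      · exact hWb x hx hxe (h.anti fun z hz hz' => hz.notMem hz'.1)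
    have hj := (wave_join hl hWl hWB).1
    refine ⟨hj e heW (hw.blk e (.inr he)), fun y hy h => ?_⟩
    obtain ⟨MW, hMW⟩ := hWl
    obtain ⟨a, ha, h1⟩ := hMW.tgt heW
    have h2 : Rc G As (W \ {e}) e := hMW.rc_path ha h1 fun w _ h4 h5 =>
      h5.2 (hMW.eq_of_tgt h5.1 h4).symm
    have h3 : ∀ z, ReflTransGen
      (fun x y => N x y ∧ ¬ Rc G As X x ∧ ¬ Rc G As X y ∧ y ∉ X) e z → Rc G As (W \ {e}) z := by
      intro z hz
      induction hz with
      | refl => exact h2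
      | tail _ h5 ih =>
        exact ih.step (hN.sub h5.1) fun h6 => h5.2.2.2 (hj _ h6.1 h5.2.2.1)
    refine hWb y (.inl hy) ?_ (h3 y h)
    rintro rfl; exact hd _ he hy
  have hfin : Lk (Gb G (Rc G As X)) X (Y ∪ H) _ := ⟨hp.sub, hp.inA, hp.inj, hp.fn, fun {y} hy => by
      rcases hy with hy | hy
      · exact hp.tgt hy
      · exact ⟨y, (key y hy).1, .refl⟩, fun {y z} hy h => by
      rcases hy with hy | hy
      · exact hp.noOut hy h
      · obtain ⟨-, y', hy', h'⟩ := h.2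
        exact (key y hy).2 y' hy' h'⟩
  exact ⟨_, hw.lk.comp' hfin⟩

theorem lemX [Countable V] {A : Set V} {F Q : V → V → Prop} (h : QF A F Q) (v : V) :
    ∃ I : Set V, (∀ x, F x v → x ∈ I) ∧ (∀ x ∈ I, Q x v) ∧ Ln A Q v I ∧
      ∀ y, y ≠ v → ∀ X : Set V, (∀ x ∈ X, Q x y) → (X \ {x | F x y}).Finite →
        Ln A (rs Q v I) y X := by
  let J : V × Finset V → Set V := fun r => {x | F x r.1} ∪ ↑r.2
  let E : V × Finset V → Set V := fun r => {u | Q u v ∧ Ln A (rs Q v {u}) r.1 (J r)}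
  have hJ : ∀ r, (∀ x ∈ r.2, Q x r.1) → Ln A Q r.1 (J r) := by
    intro r hr
    refine h.2 _ _ ?_ (r.2.finite_toSet.subset ?_)
    · rintro x (hx | hx)
      exacts [h.1 _ _ hx, hr x hx]
    · rintro x ⟨hx | hx, h'⟩
      exacts [absurd hx h', hx]
  have hJ1 : ∀ r, (∀ x ∈ r.2, Q x r.1) → Ln A (rs Q v ∅) r.1 (J r) ∨ (E r).Nonempty := by
    intro r hr
    have : Ln A (rs Q v Set.univ) r.1 (J r) := (hJ r hr).mono fun x y _ h => ⟨h, fun _ => trivial⟩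
    rcases rs_one this with h1 | ⟨u, -, h1⟩
    · exact .inl h1
    · exact .inr ⟨u, h1⟩
  obtain ⟨Y, hYl, hFY, hYQ, hYE⟩ := c_build (G := Gz A Q v) (As := A \ {v}) (B := {x | F x v})
    (Nq := {x | Q x v}) (fun x y h h' => h.2.2.2 h'.1) (fun x hx => h.1 _ _ hx) (by
      intro K hK hKQ
      refine h.2 v _ ?_ (hK.subset ?_)
      · rintro x (hx | hx)
        exacts [h.1 _ _ hx, hKQ hx]
      · rintro x ⟨hx | hx, h'⟩
        exacts [absurd hx h', hx]) E (fun r u hu => hu.1)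
  let bad : V × Finset V → Prop := fun r => r.1 ≠ v ∧ (∀ x ∈ r.2, Q x r.1) ∧
    ¬ Ln A (rs Q v ∅) r.1 (J r) ∧ E r ∩ Y = ∅
  obtain ⟨H, hH1, hH2, hH3⟩ := minHit {S | ∃ r, bad r ∧ S = E r} (by
    rintro S ⟨r, hr, rfl⟩
    constructor
    · by_contra hi
      obtain ⟨x, hx⟩ := hYE r hi
      rw [hr.2.2.2] at hx; exact hx
    · exact (hJ1 r hr.2.1).resolve_left hr.2.2.1)
  have hHQ : ∀ x ∈ H, Q x v ∧ x ∉ Y := by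
    intro x hx
    obtain ⟨S, ⟨r, hr, rfl⟩, hx⟩ := hH1 hx
    refine ⟨hx.1, fun hy => ?_⟩
    have : x ∈ E r ∩ Y := ⟨hx, hy⟩
    rw [hr.2.2.2] at this; exact this
  have hIQ : ∀ x ∈ Y ∪ H, Q x v := fun x hx => hx.elim (fun h => hYQ h) fun h => (hHQ x h).1
  have hsat : ∀ r : V × Finset V, r.1 ≠ v → (∀ x ∈ r.2, Q x r.1) →
      Ln A (rs Q v (Y ∪ H)) r.1 (J r) := by
    intro r hr1 hr2
    by_cases h0 : Ln A (rs Q v ∅) r.1 (J r)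
    · exact rs_mono h0 (Set.empty_subset _)
    obtain ⟨u, hu, huI⟩ : ∃ u ∈ E r, u ∈ Y ∪ H := by
      by_cases h1 : E r ∩ Y = ∅
      · obtain ⟨u, hu, hu'⟩ := hH2 (E r) ⟨r, ⟨hr1, hr2, h0, h1⟩, rfl⟩
        exact ⟨u, hu, .inr hu'⟩
      · obtain ⟨u, hu⟩ := Set.nonempty_iff_ne_empty.2 h1
        exact ⟨u, hu.1, .inl hu.2⟩
    exact rs_mono hu.2 (Set.singleton_subset_iff.2 huI)
  have hsat' : ∀ y, y ≠ v → ∀ X : Set V, (∀ x ∈ X, Q x y) → (X \ {x | F x y}).Finite →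
        Ln A (rs Q v (Y ∪ H)) y X := by
    intro y hy X hX hf
    refine (hsat (y, hf.toFinset) hy fun x hx => hX x ((hf.mem_toFinset.1 hx).1)).subset ?_
    intro x hx
    by_cases hF : F x y
    · exact .inl hF
    · exact .inr (by simpa using ⟨hx, hF⟩)
  have hGz : Gz A (rs Q v (Y ∪ H)) v = Gz A Q v := by
    funext x y
    apply propext
    exact ⟨fun h => ⟨h.1.1, h.2⟩, fun h => ⟨⟨h.1, fun e => (h.2.2.1 e).elim⟩, h.2⟩⟩
  refine ⟨Y ∪ H, fun x hx => .inl (hFY hx), hIQ, ?_, hsat'⟩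
  refine lemX_join hYl (fun e he => (hHQ e he).2) fun e he => ?_
  obtain ⟨S, ⟨r, hr, rfl⟩, hrH⟩ := hH3 e he
  have heE : e ∈ E r ∩ H := by rw [hrH]; rfl
  have := ess (A := A) (Γ := rs Q v (Y ∪ H)) (u := e) (v := v) (y := r.1) (J := J r)
    ⟨(hHQ e he).1, fun _ => .inr he⟩ hr.1.symm (hsat r hr.1 hr.2.1) (by
      intro hn
      have h1 : Ln A (rs Q v ((Y ∪ H) \ {e})) r.1 (J r) := hn.mono fun x y _ h =>
        ⟨h.1.1, fun e' => ⟨h.1.2 e', fun h' => h.2 ⟨h', e'⟩⟩⟩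
      rcases rs_one h1 with h2 | ⟨u, hu, h2, h3⟩
      · exact hr.2.2.1 h2
      · have huE : u ∈ E r := ⟨h2, h3⟩
        rcases hu.1 with h4 | h4
        · have : u ∈ E r ∩ Y := ⟨huE, h4⟩
          rw [hr.2.2.2] at this; exact this
        · have : u ∈ E r ∩ H := ⟨huE, h4⟩
          rw [hrH] at this; exact hu.2 this) (by
      intro z hz
      refine hsat' _ hr.1 _ ?_ ((r.2.finite_toSet.insert z).subset ?_)
      · rintro x (rfl | hx | hx)
        exacts [hz.1, h.1 _ _ hx, hr.2.1 x hx]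
      · rintro x ⟨rfl | hx | hx, h'⟩
        exacts [.inl rfl, absurd hx h', .inr hx])
  rw [hGz] at this
  obtain ⟨W, h1, h2, h3⟩ := this
  exact ⟨W, h1, h2, fun x hx => h3 x ⟨hIQ x hx, fun _ => hx⟩⟩

end FL

/-! Part 11 -/
namespace FL
open Relation

/-- What has been achieved at `v` : `F'` links its in-neighbours, which are separated as in `D`. -/
def Rec (A : Set V) (F' D : V → V → Prop) (v : V) : Prop :=
  Ln A F' v {x | F' x v} ∧ ∃ (T : Set V) (K : V → V → Prop),
    (∀ x, D x v → ¬ Rc (Gz A D v) (A \ {v}) T x) ∧ (∀ a b, K a b → Gz A F' v a b) ∧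
    (∀ {a b c}, K a c → K b c → a = b) ∧ (∀ {a b c}, K a b → K a c → b = c) ∧
    (∀ s ∈ T, ∃ x, F' x v ∧ ReflTransGen K s x) ∧ ∀ a s, s ∈ T → ¬ K a s

theorem vstep [Countable V] {A : Set V} {F D : V → V → Prop} (h : ∃ Q, QF A F Q ∧ Q ≤ D) (v : V) :
    ∃ F' D', F ≤ F' ∧ D' ≤ D ∧ (∃ Q, QF A F' Q ∧ Q ≤ D') ∧ (∀ x z, z ≠ v → D x z → D' x z) ∧
      (∀ x, D' x v → F' x v) ∧ Rec A F' D v := by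
  obtain ⟨Q0, hQ0, hQ0D⟩ := h
  obtain ⟨Q, -, hQD, hQ, hsp⟩ := hQ0.max hQ0D
  obtain ⟨I0, hFI, hI0Q, ⟨N, hN⟩, hI0⟩ := lemX hQ v
  obtain ⟨T, D0, M1, M2, hT, hM1, hD0, hM2, hfan⟩ := LL hsp v
  have hTQ : ∀ x, D x v → ¬ Rc (Gz A Q v) (A \ {v}) T x := fun x hx h =>
    hT x hx (h.mono' subset_rfl (fun x y _ h => ⟨hQD _ _ h.1, h.2⟩) fun z hz => hz.notMem)
  have hc := hN.cut' (T := T) fun y hy => hTQ y (hQD _ _ (hI0Q y hy))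
  obtain ⟨I, M, hM, h1, h2, h3, -⟩ := pym hM2 hc
  obtain ⟨P, hP⟩ : ∃ P, Lk (Gz A Q v) (A \ {v}) I P := ⟨_, hM1.comp' hM⟩
  have hIQ : ∀ x ∈ I, Q x v := fun x hx => (h2 hx).elim (hD0 x) (hI0Q x)
  have hF'v : ∀ x, F x v ∨ P x v ∨ M x v ∨ (v = v ∧ x ∈ I) → x ∈ I := by
    rintro x (h | h | h | h)
    exacts [h1 (hFI x h), ((hP.sub h).2.2.1 rfl).elim, ((hM.sub h).1.2.2.1 rfl).elim, h.2]
  have hPv : Ln A (rs Q v I) v I := ⟨P, hP.monoG fun x y _ h =>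
    ⟨⟨h.1, fun e => (h.2.2.1 e).elim⟩, h.2⟩⟩
  refine ⟨fun a b => F a b ∨ P a b ∨ M a b ∨ (b = v ∧ a ∈ I), rs D v I, fun a b h => .inl h,
    fun a b h => h.1, ⟨rs Q v I, ⟨?_, ?_⟩, fun a b h => ⟨hQD _ _ h.1, h.2⟩⟩,
    fun x z hz h => ⟨h, fun e => (hz e).elim⟩, fun x h => .inr (.inr (.inr ⟨rfl, h.2 rfl⟩)),
    ?_, T, M, hT, ?_, hM.inj, hM.fn, ?_, fun a s hs h => hM.inA h hs⟩
  · rintro a b (h | h | h | ⟨h, h'⟩)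
    · exact ⟨hQ.1 _ _ h, fun e => h1 (hFI a (e ▸ h))⟩
    · exact ⟨(hP.sub h).1, fun e => ((hP.sub h).2.2.1 e).elim⟩
    · exact ⟨(hM.sub h).1.1, fun e => ((hM.sub h).1.2.2.1 e).elim⟩
    · rw [h]; exact ⟨hIQ a h', fun _ => h'⟩
  · intro z X hX hf
    by_cases hz : z = v
    · rw [hz] at hX ⊢
      exact hPv.subset fun x hx => (hX x hx).2 rfl
    · refine rs_mono (hI0 z hz X (fun x hx => (hX x hx).1) ?_) h1
      have f1 : {a | P a z}.Finite := Set.Subsingleton.finite fun a ha b hb => hP.inj ha hb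
      have f2 : {a | M a z}.Finite := Set.Subsingleton.finite fun a ha b hb => hM.inj ha hb
      refine ((hf.union f1).union f2).subset ?_
      rintro x ⟨hx, hx'⟩
      by_cases hx1 : P x z
      · exact .inl (.inr hx1)
      by_cases hx2 : M x z
      · exact .inr hx2
      refine .inl (.inl ⟨hx, ?_⟩)
      rintro (h | h | h | h)
      exacts [hx' h, hx1 h, hx2 h, hz h.1]
  · refine Ln.subset (X := I) ⟨P, hP.monoG fun x y h h' => ⟨.inr (.inl h), h'.2⟩⟩ fun x hx => hF'v x hx
  · intro a b h
    exact ⟨.inr (.inr (.inl h)), (hM.sub h).1.2⟩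
  · intro s hs
    obtain ⟨y, hy, h4⟩ := hfan s hs
    obtain ⟨y', hy', h5⟩ := h3 s ⟨hs, y, hy, h4⟩
    exact ⟨y', .inr (.inr (.inr ⟨rfl, hy'⟩)), h5⟩

theorem mainAbs [Countable V] {A : Set V} {F D : V → V → Prop} (hFD : F ≤ D)
    (hF : ∀ z, Ln A F z {x | F x z}) :
    ∃ L, F ≤ L ∧ L ≤ D ∧ (∀ z, Ln A L z {x | L x z}) ∧
      ∀ z, ∃ T D0 M1 M2, (∀ x, D x z → ¬ Rc (Gz A D z) (A \ {z}) T x) ∧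
        Lk (Gz A L z) (A \ {z}) T M1 ∧ (∀ d ∈ D0, L d z) ∧
        Lk (Gb (Gz A L z) (Rc (Gz A L z) (A \ {z}) T)) T D0 M2 ∧
        ∀ t ∈ T, ∃ y ∈ D0, ReflTransGen M2 t y := by
  by_cases hV : Nonempty V
  swap
  · exact ⟨F, le_rfl, hFD, hF, fun z => (hV ⟨z⟩).elim⟩
  obtain ⟨e, he⟩ := exists_surjective_nat V
  let St := {p : (V → V → Prop) × (V → V → Prop) // ∃ Q, QF A p.1 Q ∧ Q ≤ p.2}
  have st : ∀ (s : St) (v : V), ∃ t : St, s.1.1 ≤ t.1.1 ∧ t.1.2 ≤ s.1.2 ∧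
      (∀ x z, z ≠ v → s.1.2 x z → t.1.2 x z) ∧ (∀ x, t.1.2 x v → t.1.1 x v) ∧
      Rec A t.1.1 s.1.2 v := by
    intro s v
    obtain ⟨F', D', h1, h2, h3, h4, h5, h6⟩ := vstep s.2 v
    exact ⟨⟨(F', D'), h3⟩, h1, h2, h4, h5, h6⟩
  have hs0 : ∃ Q, QF A F Q ∧ Q ≤ D := ⟨F, ⟨le_rfl, fun z X hX _ => (hF z).subset hX⟩, hFD⟩
  obtain ⟨s, hs00, hs⟩ : ∃ s : ℕ → St, (s 0).1 = (F, D) ∧ ∀ n, (s n).1.1 ≤ (s (n+1)).1.1 ∧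
      (s (n+1)).1.2 ≤ (s n).1.2 ∧
      (∀ x z, z ≠ e n → (s n).1.2 x z → (s (n+1)).1.2 x z) ∧
      (∀ x, (s (n+1)).1.2 x (e n) → (s (n+1)).1.1 x (e n)) ∧
      Rec A (s (n+1)).1.1 (s n).1.2 (e n) :=
    ⟨fun n => Nat.rec ⟨(F, D), hs0⟩ (fun n s => (st s (e n)).choose) n, rfl,
      fun n => (st _ (e n)).choose_spec⟩
  have mF : ∀ {n m}, n ≤ m → (s n).1.1 ≤ (s m).1.1 := fun h =>
    monotone_nat_of_le_succ (f := fun n => (s n).1.1) (fun n => (hs n).1) h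
  have mD : ∀ {n m}, n ≤ m → (s m).1.2 ≤ (s n).1.2 := fun h =>
    antitone_nat_of_succ_le (f := fun n => (s n).1.2) (fun n => (hs n).2.1) h
  have hFDn : ∀ n m, (s n).1.1 ≤ (s m).1.2 := by
    intro n m
    obtain ⟨Q, hQ, hQD⟩ := (s (max n m)).2
    exact ((mF (le_max_left n m)).trans (hQ.1.trans hQD)).trans (mD (le_max_right n m))
  let L : V → V → Prop := fun a b => ∃ n, (s n).1.1 a b
  have hLn : ∀ n, (s n).1.1 ≤ L := fun n a b h => ⟨n, h⟩
  have hLD : ∀ n, L ≤ (s n).1.2 := by rintro n a b ⟨m, h⟩; exact hFDn m n a b h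
  have hLv : ∀ n x, L x (e n) → (s (n+1)).1.1 x (e n) := fun n x h => (hs n).2.2.2.1 x (hLD _ _ _ h)
  have hrec : ∀ z, ∃ n, e n = z ∧ (∀ x, D x z → (s n).1.2 x z) := by
    intro z
    classical
    have hex := he z
    refine ⟨Nat.find hex, Nat.find_spec hex, fun x hx => ?_⟩
    have : ∀ k, k ≤ Nat.find hex → (s k).1.2 x z := by
      intro k
      induction k with
      | zero => intro _; rw [hs00]; exact hx
      | succ k ih =>
        intro hk
        exact (hs k).2.2.1 x z (fun h => Nat.find_min hex (Nat.lt_of_succ_le hk) h.symm)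
          (ih (Nat.le_of_succ_le hk))
    exact this _ le_rfl
  have hsp : ∀ x z, D x z → ¬ L x z → Sp A L x z := by
    intro x z hx hL
    obtain ⟨n, hn, hD⟩ := hrec z
    obtain ⟨-, T, K, h1, h2, h3, h4, h5, h6⟩ := (hs n).2.2.2.2
    rw [hn] at h1 h2 h5
    have hb : ∀ x0, (s n).1.2 x0 z → ¬ Rc (Gz A L z) (A \ {z}) T x0 := fun x0 h0 h =>
      h1 x0 h0 (h.mono' subset_rfl (fun x y _ h => ⟨hLD n _ _ h.1, h.2⟩) fun z hz => hz.notMem)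
    exact ⟨T, {x | L x z}, K, fun _ h => h, fun a b h => ⟨hLn _ _ _ (h2 a b h).1, (h2 a b h).2⟩,
      fun _ _ _ => h3, fun _ _ _ => h4, fun s hs => by
        obtain ⟨x0, h7, h8⟩ := h5 s hs
        exact ⟨x0, hLn _ _ _ h7, h8⟩, h6, fun x0 h => hb x0 (hLD _ _ _ h), hb x (hD x hx)⟩
  refine ⟨L, fun a b h => ⟨0, by rw [hs00]; exact h⟩, fun a b h => ?_, fun z => ?_, fun z => LL hsp z⟩
  · have := hLD 0 a b h; rw [hs00] at this; exact this
  · obtain ⟨n, hn⟩ := he z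
    have := (hs n).2.2.2.2.1
    rw [hn] at this
    refine Ln.mono (this.subset fun x hx => ?_) fun x y _ h => hLn _ _ _ h
    have := hLv n x (by rw [hn]; exact hx)
    rw [hn] at this; exact this

end FL

/-! Part 13 -/
namespace FL
open Relation

theorem zip_chain {R : V → V → Prop} (l : List V) : ∀ s : V,
    List.IsChain R (s :: l) ↔ ∀ e ∈ (s :: l).zip l, R e.1 e.2 := by
  induction l with
  | nil => intro s; simp
  | cons b l ih =>
    intro s
    rw [List.isChain_cons_cons, ih b, List.zip_cons_cons, List.forall_mem_cons]

theorem zip_mem (l : List V) : ∀ s a b : V, (a, b) ∈ (s :: l).zip l → a ∈ s :: l ∧ b ∈ l := by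
  intro s a b h
  exact ⟨(List.of_mem_zip h).1, (List.of_mem_zip h).2⟩

theorem zip_inj (l : List V) : ∀ s : V, (s :: l).Nodup → ∀ a b c, (a, c) ∈ (s :: l).zip l →
    (b, c) ∈ (s :: l).zip l → a = b := by
  induction l with
  | nil => intro s _ a b c h; simp at h
  | cons d l ih =>
    intro s hs a b c h1 h2
    have hd := (List.nodup_cons.1 hs).2
    rw [List.zip_cons_cons, List.mem_cons] at h1 h2
    rcases h1 with h1 | h1 <;> rcases h2 with h2 | h2
    · simp only [Prod.mk.injEq] at h1 h2; rw [h1.1, h2.1]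
    · simp only [Prod.mk.injEq] at h1
      exact absurd (h1.2 ▸ (zip_mem l _ _ _ h2).2) (List.nodup_cons.1 hd).1
    · simp only [Prod.mk.injEq] at h2
      exact absurd (h2.2 ▸ (zip_mem l _ _ _ h1).2) (List.nodup_cons.1 hd).1
    · exact ih d hd a b c h1 h2

theorem zip_fn (l : List V) : ∀ s : V, (s :: l).Nodup → ∀ a b c, (a, b) ∈ (s :: l).zip l →
    (a, c) ∈ (s :: l).zip l → b = c := by
  induction l with
  | nil => intro s _ a b c h; simp at h
  | cons d l ih =>
    intro s hs a b c h1 h2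
    have hd := (List.nodup_cons.1 hs).2
    have hs' := (List.nodup_cons.1 hs).1
    rw [List.zip_cons_cons, List.mem_cons] at h1 h2
    rcases h1 with h1 | h1 <;> rcases h2 with h2 | h2
    · simp only [Prod.mk.injEq] at h1 h2; rw [h1.2, h2.2]
    · simp only [Prod.mk.injEq] at h1
      exact absurd (h1.1 ▸ (zip_mem l _ _ _ h2).1) hs'
    · simp only [Prod.mk.injEq] at h2
      exact absurd (h2.1 ▸ (zip_mem l _ _ _ h1).1) hs'
    · exact ih d hd a b c h1 h2

theorem zip_rtg (l : List V) : ∀ s w : V, w ∈ s :: l →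
    ReflTransGen (fun a b => (a, b) ∈ (s :: l).zip l) s w := by
  induction l with
  | nil => intro s w h; simp at h; rw [h]
  | cons d l ih =>
    intro s w h
    rw [List.mem_cons] at h
    rcases h with rfl | h
    · exact .refl
    · exact ((ih d w h).mn fun a b h => by rw [List.zip_cons_cons]; exact .tail _ h).head (by simp)

theorem zip_last (l : List V) : ∀ s : V, ∀ e, ((s :: l).zip l).getLast? = some e →
    e.2 = (s :: l).getLast (List.cons_ne_nil _ _) := by
  induction l with
  | nil => intro s e h; simp at h
  | cons d l ih =>
    intro s e h
    rw [List.zip_cons_cons] at h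
    rw [List.getLast_cons_cons]
    cases l with
    | nil => simp at h; rw [← h]; rfl
    | cons c l =>
      refine ih d e ?_
      rw [List.zip_cons_cons] at h ⊢
      rwa [List.getLast?_cons_cons] at h

theorem zip_ne_last (l : List V) : ∀ s : V, (s :: l).Nodup → ∀ a b, (a, b) ∈ (s :: l).zip l →
    a ≠ (s :: l).getLast (List.cons_ne_nil _ _) := by
  induction l with
  | nil => intro s _ a b h; simp at h
  | cons d l ih =>
    intro s hs a b h
    rw [List.getLast_cons_cons]
    rw [List.zip_cons_cons, List.mem_cons] at h
    rcases h with h | h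
    · simp only [Prod.mk.injEq] at h
      rw [h.1]
      intro h'
      exact (List.nodup_cons.1 hs).1 (h' ▸ List.getLast_mem _)
    · exact ih d (List.nodup_cons.1 hs).2 a b h

/-- Edge relation of a path and its properties. -/
def Ed {E : Set (V × V)} (p : Dipath E) (a b : V) : Prop := (a, b) ∈ p.edges

section
variable {E : Set (V × V)} {p : Dipath E} {a b c : V}

theorem Ed.mem (h : Ed p a b) : (a, b) ∈ E := (zip_chain p.rest p.start).1 p.chain _ h
theorem Ed.left (h : Ed p a b) : a ∈ p.support := (zip_mem _ _ _ _ h).1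
theorem Ed.right (h : Ed p a b) : b ∈ p.support := List.mem_cons_of_mem _ (zip_mem _ _ _ _ h).2
theorem Ed.ne_start (h : Ed p a b) : b ≠ p.start := by
  intro e
  exact (List.nodup_cons.1 p.nodup).1 (e ▸ (zip_mem _ _ _ _ h).2)
theorem Ed.ne_last (h : Ed p a b) : a ≠ p.last := zip_ne_last _ _ p.nodup _ _ h
theorem Ed.inj (h : Ed p a c) (h' : Ed p b c) : a = b := zip_inj _ _ p.nodup _ _ _ h h'
theorem Ed.fn (h : Ed p a b) (h' : Ed p a c) : b = c := zip_fn _ _ p.nodup _ _ _ h h'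
theorem Ed.rtg (h : a ∈ p.support) : ReflTransGen (Ed p) p.start a := zip_rtg _ _ _ h
theorem Ed.of_last (h : p.lastEdge? = some (a, b)) : Ed p a b ∧ b = p.last :=
  ⟨List.mem_of_getLast? h, zip_last _ _ _ h⟩
theorem last_mem (p : Dipath E) : p.last ∈ p.support := List.getLast_mem _
end

/-- First bridge: from path systems to linkages. -/
theorem bridge1 {F : Set (V × V)} {r z : V} {A : Set V} (hz : z ≠ r) (hrA : r ∉ A)
    (hA : ∀ a, (r, a) ∈ F → a ≠ r → a ∈ A) (h : inEdges F z ∈ GSet F r z) :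
    Ln A (fun x y => (x, y) ∈ F ∧ x ≠ r ∧ y ≠ r) z {x | (x, z) ∈ F ∧ x ≠ r ∧ z ≠ r} := by
  obtain ⟨P, ⟨hP1, hP2⟩, hP3⟩ := h
  have same : ∀ p ∈ P, ∀ q ∈ P, ∀ x, x ∈ p.support → x ∈ q.support → x ≠ r → x ≠ z → p = q := by
    intro p hp q hq x h1 h2 h3 h4
    by_contra hne
    rcases hP2 hp hq hne ⟨h1, h2⟩ with h | h
    exacts [h3 h, h4 h]
  have hl : ∀ x ∈ {x | (x, z) ∈ F ∧ x ≠ r ∧ z ≠ r}, ∃ p ∈ P, Ed p x z ∧ x ≠ z := by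
    intro x hx
    have : (x, z) ∈ termEdges P := by rw [hP3]; exact ⟨hx.1, rfl⟩
    obtain ⟨p, hp, h1⟩ := this
    refine ⟨p, hp, (Ed.of_last h1).1, ?_⟩
    have := (Ed.of_last h1).1.ne_last
    rwa [(hP1 p hp).2] at this
  refine ⟨fun x y => (∃ p ∈ P, Ed p x y) ∧ x ≠ r ∧ y ≠ z ∧ y ∉ A, ?_, ?_, ?_, ?_, ?_, ?_⟩
  · rintro x y ⟨⟨p, hp, h1⟩, h2, h3, h4⟩
    refine ⟨⟨h1.mem, h2, ?_⟩, ?_, h3, h4⟩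
    · rw [← (hP1 p hp).1]; exact h1.ne_start
    · rw [← (hP1 p hp).2]; exact h1.ne_last
  · rintro x y h h'; exact h.2.2.2 h'.1
  · rintro x y w ⟨⟨p, hp, h1⟩, h2, h3, h4⟩ ⟨⟨q, hq, h1'⟩, -⟩
    have hwr : w ≠ r := by rw [← (hP1 p hp).1]; exact h1.ne_start
    obtain rfl := same p hp q hq w h1.right h1'.right hwr h3
    exact h1.inj h1'
  · rintro x y w ⟨⟨p, hp, h1⟩, h2, h3, h4⟩ ⟨⟨q, hq, h1'⟩, -⟩
    have hxz : x ≠ z := by rw [← (hP1 p hp).2]; exact h1.ne_last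
    obtain rfl := same p hp q hq x h1.left h1'.left h2 hxz
    exact h1.fn h1'
  · intro x hx
    obtain ⟨p, hp, h1, hxz⟩ := hl x hx
    have h2 := Ed.rtg h1.left
    rw [(hP1 p hp).1] at h2
    have hxr := hx.2.1
    clear h1 hx
    induction h2 with
    | refl => exact absurd rfl hxr
    | @tail u w h3 h4 ih =>
      by_cases hwA : w ∈ A
      · exact ⟨w, ⟨hwA, hxz⟩, .refl⟩
      · have hur : u ≠ r := by rintro rfl; exact hwA (hA w h4.mem hxr)
        have huz : u ≠ z := by rw [← (hP1 p hp).2]; exact h4.ne_last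
        obtain ⟨a, ha, h5⟩ := ih huz hur
        exact ⟨a, ha, h5.tail ⟨⟨p, hp, h4⟩, hur, hxz, hwA⟩⟩
  · rintro x w hx ⟨⟨q, hq, h1⟩, h2, h3, h4⟩
    obtain ⟨p, hp, h5, hxz⟩ := hl x hx
    obtain rfl := same p hp q hq x h5.left h1.left h2 hxz
    exact h3 (h1.fn h5)

theorem mkl {M : V → V → Prop} {a x z : V} (h : ReflTransGen M a x)
    (fn : ∀ {u v w}, M u v → M u w → v = w) (hac : ∀ w, ReflTransGen M a w → ¬ TransGen M w w)
    (hz : ∀ w, ReflTransGen M a w → w ≠ z) :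
    ∃ l : List V, (∀ e ∈ (a :: l).zip l, M e.1 e.2 ∨ e = (x, z)) ∧
      ((a :: l).zip l).getLast? = some (x, z) ∧
      (∀ w, w ∈ a :: l ↔ w = z ∨ (ReflTransGen M a w ∧ ReflTransGen M w x)) ∧ (a :: l).Nodup := by
  induction h using ReflTransGen.head_induction_on with
  | refl =>
    refine ⟨[z], by simp, by simp, fun w => ?_, by simpa using hz x .refl⟩
    simp only [List.mem_cons, List.not_mem_nil, or_false]
    constructor
    · rintro (rfl | h)
      exacts [.inr ⟨.refl, .refl⟩, .inl h]
    · rintro (h | ⟨h1, h2⟩)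
      · exact .inr h
      · by_contra hc
        push Not at hc
        have h3 := (reflTransGen_iff_eq_or_transGen.1 h1).resolve_left hc.1
        exact hac x .refl (h3.trans_left h2)
  | @head a b hab hbx ih =>
    obtain ⟨l, h1, h2, h3, h4⟩ := ih (fun w hw => hac w (hw.head hab)) fun w hw => hz w (hw.head hab)
    refine ⟨b :: l, ?_, ?_, fun w => ?_, ?_⟩
    · rw [List.zip_cons_cons, List.forall_mem_cons]
      exact ⟨.inl hab, h1⟩
    · rw [List.zip_cons_cons]
      generalize (b :: l).zip l = L at h2
      cases L with
      | nil => simp at h2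
      | cons c L => rwa [List.getLast?_cons_cons]
    · rw [List.mem_cons, h3]
      constructor
      · rintro (rfl | h | h)
        exacts [.inr ⟨.refl, hbx.head hab⟩, .inl h, .inr ⟨h.1.head hab, h.2⟩]
      · rintro (h | ⟨h, h'⟩)
        · exact .inr (.inl h)
        · rcases h.cases_head with h5 | ⟨c, h5, h6⟩
          · exact .inl h5.symm
          · rw [fn h5 hab] at h6
            exact .inr (.inr ⟨h6, h'⟩)
    · rw [List.nodup_cons]
      refine ⟨fun h => ?_, h4⟩
      rw [h3] at h
      rcases h with h | h
      · exact hz a .refl h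
      · exact hac a .refl (TransGen.head' hab h.1)

theorem sysOf {A X : Set V} {L M : V → V → Prop} {r z : V} {E : Set (V × V)}
    (hM : Lk (Gz A L z) (A \ {z}) X M) (hL : ∀ x y, L x y → x ≠ r ∧ y ≠ r) (hX : ∀ x ∈ X, L x z)
    (hLE : ∀ x y, L x y → (x, y) ∈ E) (hAE : ∀ a ∈ A \ {z}, (r, a) ∈ E) (hrA : r ∉ A) (hzr : z ≠ r)
    (x : V) (hx : x ∈ X) : ∃ p : Dipath E, p.start = r ∧ p.last = z ∧ p.lastEdge? = some (x, z) ∧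
      (∃ a ∈ A \ {z}, ReflTransGen M a x ∧ ∀ w, w ∈ p.support ↔ w = r ∨ w = z ∨
        (ReflTransGen M a w ∧ ReflTransGen M w x)) ∧
      ∀ e ∈ p.edgeSet, L e.1 e.2 ∨ (e.1 = r ∧ e.2 ∈ A) := by
  obtain ⟨a, ha, h1⟩ := hM.tgt hx
  have hne : ∀ w, ReflTransGen M a w → w ≠ z ∧ w ≠ r := by
    intro w hw
    rcases hw.cases_tail with h | ⟨u, -, h⟩
    · rw [h]; exact ⟨ha.2, fun e => hrA (e ▸ ha.1)⟩
    · exact ⟨(hM.sub h).2.2.1, (hL _ _ (hM.sub h).1).2⟩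
  obtain ⟨l, h2, h3, h4, h5⟩ := mkl h1 (fun h h' => hM.fn h h') (fun w hw => hM.acyc ha hw)
    (fun w hw => (hne w hw).1)
  have hed : ∀ e ∈ (r :: a :: l).zip (a :: l), L e.1 e.2 ∨ (e.1 = r ∧ e.2 ∈ A) ∧ e.2 ≠ z := by
    rw [List.zip_cons_cons, List.forall_mem_cons]
    refine ⟨.inr ⟨⟨rfl, ha.1⟩, ha.2⟩, fun e he => .inl ?_⟩
    rcases h2 e he with h | h
    · exact (hM.sub h).1
    · rw [h]; exact hX x hx
  let p : Dipath E := ⟨r, a :: l, (zip_chain _ _).2 fun e he => by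
      rcases hed e he with h | h
      · exact hLE _ _ h
      · have := hAE e.2 ⟨h.1.2, h.2⟩
        rwa [← h.1.1] at this, by
      rw [List.nodup_cons]
      refine ⟨fun h => ?_, h5⟩
      rw [h4] at h
      rcases h with h | h
      · exact hzr h.symm
      · exact (hne r h.1).2 rfl⟩
  have hle : p.lastEdge? = some (x, z) := by
    show ((r :: a :: l).zip (a :: l)).getLast? = _
    rw [List.zip_cons_cons]
    generalize (a :: l).zip l = L at h3
    cases L with
    | nil => simp at h3
    | cons c L => rwa [List.getLast?_cons_cons]
  refine ⟨p, rfl, (Ed.of_last hle).2.symm, hle, ⟨a, ha, h1, fun w => ?_⟩, fun e he =>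
    (hed e he).imp id fun h => h.1⟩
  show w ∈ r :: a :: l ↔ _
  rw [List.mem_cons, h4]

end FL

/-! Part 14 -/
namespace FL
open Relation

theorem bridge2 {A : Set V} {L : V → V → Prop} {r z : V} {E : Set (V × V)}
    (hM : Ln A L z {x | L x z}) (hL : ∀ x y, L x y → x ≠ r ∧ y ≠ r)
    (hLE : ∀ x y, L x y → (x, y) ∈ E) (hAE : ∀ a ∈ A, (r, a) ∈ E) (hrA : r ∉ A) (hzr : z ≠ r)
    (hEL : ∀ x, x ≠ r → (x, z) ∈ E → L x z) : inEdges E z ∈ GSet E r z := by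
  obtain ⟨M, hM⟩ := hM
  have hs := sysOf hM hL (fun x hx => hx) hLE (fun a ha => hAE a ha.1) hrA hzr
  choose p h1 h2 h3 h4 _ using hs
  have hsup : ∀ q : Dipath E, q.start = r → q.rest = [z] → ∀ w ∈ q.support, w = r ∨ w = z := by
    intro q hq hq' w hw
    have : w ∈ q.start :: q.rest := hw
    rw [hq, hq'] at this
    simpa using this
  refine ⟨{q | (∃ x hx, q = p x hx) ∨ (q.start = r ∧ q.rest = [z])}, ⟨?_, ?_⟩, ?_⟩
  · rintro q (⟨x, hx, rfl⟩ | ⟨h, h'⟩)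
    · exact ⟨h1 _ _, h2 _ _⟩
    · refine ⟨h, ?_⟩
      simp [Dipath.last, h']
  · rintro q (⟨x, hx, rfl⟩ | ⟨h, h'⟩) q' (⟨x', hx', rfl⟩ | ⟨g, g'⟩) hne w ⟨hw, hw'⟩
    · obtain ⟨a, ha, -, h5⟩ := h4 x hx
      obtain ⟨a', ha', -, h5'⟩ := h4 x' hx'
      rcases (h5 w).1 hw with h | h | h
      · exact .inl h
      · exact .inr h
      rcases (h5' w).1 hw' with h' | h' | h'
      · exact .inl h'
      · exact .inr h'
      obtain rfl := hM.tgt_unique hx hx' h.2 h'.2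
      exact absurd rfl hne
    · exact hsup _ g g' w hw'
    · exact hsup _ h h' w hw
    · exact hsup _ h h' w hw
  · ext ⟨x, y⟩
    constructor
    · rintro ⟨q, hq, hl⟩
      have := Ed.of_last hl
      refine ⟨this.1.mem, ?_⟩
      show y = z
      rw [this.2]
      rcases hq with (⟨x, hx, rfl⟩ | ⟨h, h'⟩)
      · exact h2 _ _
      · simp [Dipath.last, h']
    · rintro ⟨hxy, rfl⟩
      by_cases hxr : x = r
      · subst hxr
        refine ⟨⟨x, [y], by simpa [List.Chain] using hxy, by simpa using hzr.symm⟩, .inr ⟨rfl, rfl⟩, rfl⟩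
      · have hx : L x y := hEL x hxr hxy
        exact ⟨p x hx, .inl ⟨x, hx, rfl⟩, h3 x hx⟩

theorem bridge3 {L D : V → V → Prop} {r z : V} {E Fs : Set (V × V)} {A : Set V}
    (hA : A = {a | (r, a) ∈ E ∧ a ≠ r})
    (hD : D = fun x y => (x, y) ∈ E ∧ x ≠ r ∧ y ≠ r) (hLD : L ≤ D)
    (hLF : ∀ x y, L x y → (x, y) ∈ Fs) (hAF : ∀ a ∈ A, (r, a) ∈ Fs) (hzr : z ≠ r)
    {T D0 : Set V} {M1 M2 : V → V → Prop} (hT : ∀ x, D x z → ¬ Rc (Gz A D z) (A \ {z}) T x)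
    (hM1 : Lk (Gz A L z) (A \ {z}) T M1) (hD0 : ∀ d ∈ D0, L d z)
    (hM2 : Lk (Gb (Gz A L z) (Rc (Gz A L z) (A \ {z}) T)) T D0 M2)
    (hfan : ∀ t ∈ T, ∃ y ∈ D0, ReflTransGen M2 t y) : VLarge E r Fs z := by
  have hL : ∀ x y, L x y → (x, y) ∈ E ∧ x ≠ r ∧ y ≠ r := fun x y h => by
    have := hLD x y h; rwa [hD] at this
  have hrA : r ∉ A := by rw [hA]; exact fun h => h.2 rfl
  have hN := hM1.comp' hM2
  set N : V → V → Prop := fun x y => (M1 x y ∧ Rc (Gz A L z) (A \ {z}) T x) ∨ M2 x y with hNd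
  have hM2N : ∀ {x y}, ReflTransGen M2 x y → ReflTransGen N x y := fun h => h.mn fun _ _ h => .inr h
  have hs := sysOf (E := E \ {(r, z)}) hN (fun x y h => (hL x y h).2) hD0 (fun x y h => ⟨(hL x y h).1, by
      intro h'
      exact (hL x y h).2.1 (Prod.mk.inj h').1⟩) (fun a ha => by
      have h' := ha.1
      rw [hA] at h'
      exact ⟨h'.1, fun h' => ha.2 (Prod.mk.inj h').2⟩) hrA hzr
  choose p h1 h2 h3 h4 h5 using hs
  have hTn : ∀ t ∈ T, t ≠ r ∧ t ≠ z := by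
    intro t ht
    obtain ⟨a, ha, h⟩ := hM1.tgt ht
    rcases h.cases_tail with h | ⟨w, -, h⟩
    · rw [h]; exact ⟨fun e => hrA (e ▸ ha.1), ha.2⟩
    · exact ⟨(hL _ _ (hM1.sub h).1).2.2, (hM1.sub h).2.2.1⟩
  have hpre : ∀ a ∈ A \ {z}, ∀ d, ReflTransGen N a d → ∀ t ∈ T, ReflTransGen N t d →
      ReflTransGen N a t := by
    intro a ha d h t ht h'
    rcases hN.btotal h h' with h6 | h6
    · exact h6
    · rw [hN.eq_of_src ha h6]
  have hnR : ∀ t ∈ T, ∀ w, ReflTransGen N t w → ¬ Rc (Gz A L z) (A \ {z}) T w := by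
    intro t ht w h
    induction h with
    | refl => exact fun h => h.notMem ht
    | tail _ h6 ih =>
      rcases h6 with h6 | h6
      · exact absurd h6.2 ih
      · exact (hM2.sub h6).2.2
  have hTT : ∀ t ∈ T, ∀ t' ∈ T, ReflTransGen N t t' → t = t' := by
    intro t ht t' ht' h
    rcases h.cases_tail with h | ⟨w, h6, h7⟩
    · exact h.symm
    · rcases h7 with h7 | h7
      · exact absurd h7.2 (hnR t ht w h6)
      · exact absurd ht' (hM2.inA h7)
  refine ⟨fun h => hAF z (by rw [hA]; exact ⟨h, hzr⟩), {q | ∃ x hx, q = p x hx},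
    ⟨⟨?_, ?_⟩, T, ⟨fun h => (hTn r h).1 rfl, fun h => (hTn z h).2 rfl, ?_⟩, ?_, ?_⟩, ?_⟩
  · rintro q ⟨x, hx, rfl⟩; exact ⟨h1 _ _, h2 _ _⟩
  · rintro q ⟨x, hx, rfl⟩ q' ⟨x', hx', rfl⟩ hne w ⟨hw, hw'⟩
    obtain ⟨a, ha, -, h6⟩ := h4 x hx
    obtain ⟨a', ha', -, h6'⟩ := h4 x' hx'
    rcases (h6 w).1 hw with h | h | h
    · exact .inl h
    · exact .inr h
    rcases (h6' w).1 hw' with h' | h' | h'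
    · exact .inl h'
    · exact .inr h'
    obtain rfl := hN.tgt_unique hx hx' h.2 h'.2
    exact absurd rfl hne
  · intro q hq1 hq2
    by_contra hcon
    have hqT : ∀ w ∈ q.support, w ∉ T := fun w hw hw' => hcon ⟨w, hw, hw'⟩
    have key : ∀ w, ReflTransGen (Ed q) r w → w ≠ r → w ≠ z → Rc (Gz A D z) (A \ {z}) T w := by
      intro w hw
      induction hw with
      | refl => intro h; exact absurd rfl h
      | @tail u w h6 h7 ih =>
        intro hwr hwz
        have hwT := hqT w h7.right
        by_cases hwA : w ∈ A
        · exact .base ⟨hwA, hwz⟩ hwT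
        · have hur : u ≠ r := by
            rintro rfl
            exact hwA (by rw [hA]; exact ⟨h7.mem.1, hwr⟩)
          have huz : u ≠ z := by rw [← hq2]; exact h7.ne_last
          exact .step (ih hur huz) ⟨by rw [hD]; exact ⟨h7.mem.1, hur, hwr⟩, huz, hwz, hwA⟩ hwT
    have hrz := Ed.rtg (last_mem q)
    rw [hq1, hq2] at hrz
    rcases hrz.cases_tail with h | ⟨u, h6, h7⟩
    · exact hzr h
    · have hur : u ≠ r := by rintro rfl; exact h7.mem.2 rfl
      have huz : u ≠ z := by rw [← hq2]; exact h7.ne_last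
      exact hT u (by rw [hD]; exact ⟨h7.mem.1, hur, hzr⟩) (key u h6 hur huz)
  · rintro q ⟨x, hx, rfl⟩
    obtain ⟨a, ha, hax, h6⟩ := h4 x hx
    obtain ⟨t, ht, htx⟩ := hM2.tgt hx
    have htx' := hM2N htx
    refine ⟨t, ⟨(h6 t).2 (.inr (.inr ⟨hpre a ha x hax t ht htx', htx'⟩)), ht⟩, ?_⟩
    rintro t' ⟨hs, ht'⟩
    have h7 : ReflTransGen N t' x := by
      rcases (h6 t').1 hs with h | h | h
      · exact absurd h (hTn t' ht').1
      · exact absurd h (hTn t' ht').2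
      · exact h.2
    rcases hN.btotal h7 htx' with h8 | h8
    · exact hTT _ ht' _ ht h8
    · exact (hTT _ ht _ ht' h8).symm
  · intro t ht
    obtain ⟨x, hx, htx⟩ := hfan t ht
    obtain ⟨a, ha, hax, h6⟩ := h4 x hx
    exact ⟨p x hx, ⟨x, hx, rfl⟩, (h6 t).2 (.inr (.inr ⟨hpre a ha x hax t ht (hM2N htx), hM2N htx⟩))⟩
  · rintro q ⟨x, hx, rfl⟩ ⟨e1, e2⟩ he
    rcases h5 x hx _ he with h | ⟨h, h'⟩
    · exact hLF _ _ h
    · have : e1 = r := h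
      rw [this]; exact hAF _ h'

theorem final [Countable V] (E : Set (V × V)) (r : V)
    (F : Set (V × V)) (hFE : F ⊆ E) (hF : IsFlame F r) :
    ∃ Fstar : Set (V × V), F ⊆ Fstar ∧ Fstar ⊆ E ∧
      IsFlame Fstar r ∧ Large E r Fstar := by
  let A : Set V := {a | (r, a) ∈ E ∧ a ≠ r}
  let D : V → V → Prop := fun x y => (x, y) ∈ E ∧ x ≠ r ∧ y ≠ r
  have hrA : r ∉ A := fun h => h.2 rfl
  obtain ⟨L, hFL, hLD, hL1, hL2⟩ := mainAbs (A := A) (F := fun x y => (x, y) ∈ F ∧ x ≠ r ∧ y ≠ r)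
    (D := D) (fun x y h => ⟨hFE h.1, h.2⟩) (by
      intro z
      by_cases hz : z = r
      · subst hz
        exact ⟨fun _ _ => False, False.elim, False.elim, False.elim, False.elim,
          fun h => (h.2.2 rfl).elim, fun _ => id⟩
      · exact bridge1 hz hrA (fun a ha har => ⟨hFE ha, har⟩) (hF z hz))
  let Fs : Set (V × V) := {e | e ∈ F ∨ L e.1 e.2 ∨ (e.1 = r ∧ e.2 ∈ A)}
  have hLF : ∀ x y, L x y → (x, y) ∈ Fs := fun x y h => .inr (.inl h)
  have hAF : ∀ a ∈ A, (r, a) ∈ Fs := fun a ha => .inr (.inr ⟨rfl, ha⟩)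
  refine ⟨Fs, fun e he => .inl he, ?_, fun z hz => ?_, fun z hz => ?_⟩
  · rintro ⟨x, y⟩ (h | h | ⟨h, h'⟩)
    · exact hFE h
    · exact (hLD _ _ h).1
    · have : x = r := h
      rw [this]; exact h'.1
  · refine bridge2 (hL1 z) (fun x y h => (hLD x y h).2) hLF hAF hrA hz ?_
    rintro x hx (h | h | ⟨h, h'⟩)
    · exact hFL x z ⟨h, hx, hz⟩
    · exact h
    · exact absurd h hx
  · obtain ⟨T, D0, M1, M2, h1, h2, h3, h4, h5⟩ := hL2 z
    exact bridge3 rfl rfl hLD hLF hAF hz h1 h2 h3 h4 h5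

end FL

/-- **Main theorem.** In a countable rooted digraph every vertex-flame extends to a
large vertex-flame. -/
theorem stmt17 {V : Type u} [Countable V] (E : Set (V × V)) (r : V)
    (F : Set (V × V)) (hFE : F ⊆ E) (hF : IsFlame F r) :
    ∃ Fstar : Set (V × V), F ⊆ Fstar ∧ Fstar ⊆ E ∧
      IsFlame Fstar r ∧ Large E r Fstar := by
  exact FL.final E r F hFE hF
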